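/- arXiv:0710.2648 — 2 statements merged into one kernel-verified Lean document; each statement's English description precedes it below -/
import Mathlib

section
/- Let k be a positive integer and λ a partition with ℓ(λ) ≤ k. Then, in the field of fractions of ℚ[x_1,…,x_k]: s_λ(x_1,…,x_k,x_1^{−1},…,x_k^{−1}) = Σ_{μ : ℓ(μ) ≤ k} (Σ_β c^λ_{βμ}) sp_μ(x_1,…,x_k), where the inner sum runs over all partitions β whose conjugate β' has all parts even, and s_λ is the Schur polynomial in 2k variables evaluated at x_1,…,x_k,x_1^{−1},…,x_k^{−1}. This is the stable form of the branching rule GL(2k) ⊃ Sp(2k): {λ} → ⟨λ/B⟩ with B = ∏_{i<j}(1 − x_i x_j)^{−1} = Σ_{β' even} {β}. -/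
open MvPolynomial
open scoped Classical

/-- A partition: a weakly decreasing sequence of non-negative integers
with finitely many nonzero parts (indexed from 0). -/
structure Partn where
  parts : ℕ → ℕ
  antitone : ∀ i j, i ≤ j → parts j ≤ parts i
  eventually_zero : ∃ N, ∀ i, N ≤ i → parts i = 0

namespace Partn

/-- The weight `|λ|` of a partition: the sum of its parts. -/
noncomputable def weight (p : Partn) : ℕ := ∑ᶠ i, p.parts i

/-- `ℓ(λ) ≤ n`: all parts from index `n` on vanish. -/
def LengthLE (p : Partn) (n : ℕ) : Prop := ∀ i, n ≤ i → p.parts i = 0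

/-- The parts of the conjugate partition `λ'`:
`λ'_i` is the number of indices `j` with `λ_j > i`. -/
noncomputable def conjParts (p : Partn) (i : ℕ) : ℕ := Nat.card {j : ℕ // i < p.parts j}

end Partn

/-- The alternant `det(x_i^{l_j + n - j})_{1 ≤ i,j ≤ n}` (indices taken 0-based). -/
noncomputable def alternant (n : ℕ) (l : ℕ → ℕ) : MvPolynomial (Fin n) ℤ :=
  (Matrix.of fun i j : Fin n =>
    (X i : MvPolynomial (Fin n) ℤ) ^ (l (j : ℕ) + (n - 1 - (j : ℕ)))).det

/-- The Vandermonde determinant `det(x_i^{n-j})_{1 ≤ i,j ≤ n}` (0-based). -/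
noncomputable def vandermondeP (n : ℕ) : MvPolynomial (Fin n) ℤ :=
  (Matrix.of fun i j : Fin n =>
    (X i : MvPolynomial (Fin n) ℤ) ^ (n - 1 - (j : ℕ))).det

/-- The Schur polynomial `s_l(x_1,…,x_n)`: the (unique, since `ℤ[x]` is a domain
and the Vandermonde determinant is nonzero) quotient of the alternant by the
Vandermonde determinant, when the latter divides the former. -/
noncomputable def schur (n : ℕ) (l : ℕ → ℕ) : MvPolynomial (Fin n) ℤ :=
  if h : ∃ q : MvPolynomial (Fin n) ℤ, q * vandermondeP n = alternant n l then h.choose else 0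

/-- The Littlewood–Richardson coefficient `c^ν_{λμ}`: the coefficient of `s_ν` in the
Schur-basis expansion of `s_λ · s_μ` in `|λ| + |μ|` variables, extracted as the
coefficient of the dominant monomial `x^{ν+ρ}` in `s_λ · s_μ · (Vandermonde)`.
It is zero unless `|ν| = |λ| + |μ|`. -/
noncomputable def lrCoeff (l m ν : Partn) : ℤ :=
  if ν.weight = l.weight + m.weight then
    MvPolynomial.coeff
      (Finsupp.equivFunOnFinite.symm fun j : Fin (l.weight + m.weight) =>
        ν.parts (j : ℕ) + (l.weight + m.weight - 1 - (j : ℕ)))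
      (schur (l.weight + m.weight) l.parts * schur (l.weight + m.weight) m.parts *
        vandermondeP (l.weight + m.weight))
  else 0

/-- The field of fractions of `ℚ[x_1,…,x_k]`. -/
abbrev RatFn (k : ℕ) := FractionRing (MvPolynomial (Fin k) ℚ)

/-- The image of the variable `x_i` in the field of fractions. -/
noncomputable def xv (k : ℕ) (i : Fin k) : RatFn k :=
  algebraMap (MvPolynomial (Fin k) ℚ) (RatFn k) (X i)

/-- The symplectic character `sp_λ(x_1,…,x_k)`:
`det(x_i^{λ_j+k−j+1} − x_i^{−(λ_j+k−j+1)}) / det(x_i^{k−j+1} − x_i^{−(k−j+1)})`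
(1-based `j`; below `j` is 0-based so the exponents are `λ_j + (k − j)`). -/
noncomputable def spChar (k : ℕ) (l : ℕ → ℕ) : RatFn k :=
  (Matrix.of fun i j : Fin k =>
      xv k i ^ ((l (j : ℕ) + (k - (j : ℕ)) : ℕ) : ℤ) -
        xv k i ^ (-((l (j : ℕ) + (k - (j : ℕ)) : ℕ) : ℤ))).det /
  (Matrix.of fun i j : Fin k =>
      xv k i ^ (((k - (j : ℕ) : ℕ)) : ℤ) -
        xv k i ^ (-((k - (j : ℕ) : ℕ) : ℤ))).det

/-- The odd orthogonal character `so_λ(z_1,…,z_k)`: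
`det(z_i^{2(λ_j+k−j)+1} − z_i^{−(2(λ_j+k−j)+1)}) / det(z_i^{2(k−j)+1} − z_i^{−(2(k−j)+1)})`
(1-based `j`; below `j` is 0-based so the exponents are `2(λ_j + (k−1−j)) + 1`). -/
noncomputable def soChar (k : ℕ) (l : ℕ → ℕ) : RatFn k :=
  (Matrix.of fun i j : Fin k =>
      xv k i ^ ((2 * (l (j : ℕ) + (k - 1 - (j : ℕ))) + 1 : ℕ) : ℤ) -
        xv k i ^ (-((2 * (l (j : ℕ) + (k - 1 - (j : ℕ))) + 1 : ℕ) : ℤ))).det /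
  (Matrix.of fun i j : Fin k =>
      xv k i ^ ((2 * (k - 1 - (j : ℕ)) + 1 : ℕ) : ℤ) -
        xv k i ^ (-((2 * (k - 1 - (j : ℕ)) + 1 : ℕ) : ℤ))).det

/-- The list of values `x_1,…,x_k,x_1^{−1},…,x_k^{−1}` at which Schur polynomials
in `2k` variables are evaluated for `Sp(2k)`. -/
noncomputable def spEval (k : ℕ) : Fin (2 * k) → RatFn k := fun i =>
  if h : (i : ℕ) < k then xv k ⟨i, h⟩
  else (xv k ⟨(i : ℕ) - k, by have := i.isLt; omega⟩)⁻¹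

/-- The list of values `z_1²,…,z_k²,z_1^{−2},…,z_k^{−2},1` at which Schur polynomials
in `2k+1` variables are evaluated for `SO(2k+1)`. -/
noncomputable def soEval (k : ℕ) : Fin (2 * k + 1) → RatFn k := fun i =>
  if h : (i : ℕ) < k then xv k ⟨i, h⟩ ^ 2
  else if h2 : (i : ℕ) < 2 * k then ((xv k ⟨(i : ℕ) - k, by omega⟩)⁻¹) ^ 2
  else 1

namespace GLSp

section Generic

variable {R : Type*} [CommRing R]

/-- The alternant with exponents `l_j + n - 1 - j` evaluated at elements of a ring. -/
noncomputable def altD {n : ℕ} (l : ℕ → ℕ) (y : Fin n → R) : R :=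
  (Matrix.of fun i j : Fin n => y i ^ (l (j : ℕ) + (n - 1 - (j : ℕ)))).det

theorem map_altD {S : Type*} [CommRing S] (f : R →+* S) {n : ℕ} (l : ℕ → ℕ) (y : Fin n → R) :
    f (altD l y) = altD l (fun i => f (y i)) := by
  unfold altD
  rw [RingHom.map_det]
  congr 1
  ext i j
  simp

theorem altD_perm {n : ℕ} (l : ℕ → ℕ) (y : Fin n → R) (σ : Equiv.Perm (Fin n)) :
    altD l (fun i => y (σ i)) = ((Equiv.Perm.sign σ : ℤ) : R) * altD l y := by
  unfold altD
  rw [← Matrix.det_permute]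
  rfl

theorem altD_zero_eq {n : ℕ} (y : Fin n → R) :
    altD 0 y = (Matrix.projVandermonde (fun _ => 1) y).det := by
  unfold altD
  congr 1
  ext i j
  simp only [Matrix.of_apply, Pi.zero_apply, zero_add, Matrix.projVandermonde_apply, one_pow,
    one_mul, Fin.val_rev]
  congr 1
  omega

theorem altD_zero_prod {n : ℕ} (y : Fin n → R) :
    altD 0 y = ∏ i : Fin n, ∏ j ∈ Finset.Ioi i, (y i - y j) := by
  rw [altD_zero_eq, Matrix.det_projVandermonde]
  simp

theorem altD_zero_ne_zero [IsDomain R] {n : ℕ} (y : Fin n → R) (hy : Function.Injective y) :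
    altD 0 y ≠ 0 := by
  rw [altD_zero_prod]
  simp only [Finset.prod_ne_zero_iff, Finset.mem_univ, true_imp_iff, Finset.mem_Ioi]
  intro i j hij h
  exact hij.ne (hy (sub_eq_zero.1 h))

theorem altD_dvd [Nontrivial R] {n : ℕ} (l : ℕ → ℕ) (y : Fin n → R) :
    ∃ q, q * altD 0 y = altD l y := by
  let P : Polynomial R := ∏ i : Fin n, (Polynomial.X - Polynomial.C (y i))
  have hP : P.Monic := Polynomial.monic_prod_of_monic _ _ fun i _ => Polynomial.monic_X_sub_C _
  have hdeg : P.degree = n := by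
    rw [Polynomial.degree_prod_of_monic _ _ (fun i _ => Polynomial.monic_X_sub_C _)]
    simp
  let r : ℕ → Polynomial R := fun m => (Polynomial.X ^ m) %ₘ P
  have hr : ∀ m (i : Fin n), y i ^ m = ∑ p : Fin n, y i ^ (n - 1 - (p : ℕ)) * (r m).coeff (n - 1 - p) := by
    intro m i
    have h1 : (r m).eval (y i) = y i ^ m := by
      have := Polynomial.modByMonic_add_div (Polynomial.X ^ m) P
      have h2 := congrArg (Polynomial.eval (y i)) this
      have h3 : P.eval (y i) = 0 := by
        rw [Polynomial.eval_prod]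
        exact Finset.prod_eq_zero (Finset.mem_univ i) (by simp)
      simpa [h3] using h2
    have h4 : (r m).degree < n := by
      rw [← hdeg]; exact Polynomial.degree_modByMonic_lt _ hP
    have h5 : (r m).eval (y i) = ∑ p ∈ Finset.range n, (r m).coeff p * y i ^ p := by
      by_cases h0 : n = 0
      · exact absurd i.isLt (by omega)
      · apply Polynomial.eval_eq_sum_range'
        by_cases hz : r m = 0
        · rw [hz]; simp; omega
        · exact (Polynomial.natDegree_lt_iff_degree_lt hz).2 h4
    rw [← h1, h5, ← Fin.sum_univ_eq_sum_range (fun p => (r m).coeff p * y i ^ p),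
      ← Equiv.sum_comp Fin.revPerm]
    refine Finset.sum_congr rfl fun p _ => ?_
    simp only [Fin.revPerm_apply, Fin.val_rev]
    have : n - (p + 1) = n - 1 - (p : ℕ) := by omega
    rw [this, mul_comm]
  refine ⟨(Matrix.of fun p j : Fin n => (r (l j + (n - 1 - j))).coeff (n - 1 - p)).det, ?_⟩
  unfold altD
  rw [mul_comm, ← Matrix.det_mul]
  congr 1
  ext i j
  rw [Matrix.mul_apply]
  simp only [Matrix.of_apply, Pi.zero_apply, zero_add]
  rw [← hr]

theorem altD_last {n : ℕ} (l : ℕ → ℕ) (y : Fin (n + 1) → R) (hy : y (Fin.last n) = 0) :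
    altD l y = if l n = 0 then
      (∏ i : Fin n, y i.castSucc) * altD l (fun i : Fin n => y i.castSucc) else 0 := by
  unfold altD
  rw [Matrix.det_succ_row _ (Fin.last n), Finset.sum_eq_single (Fin.last n)]
  · simp only [Matrix.of_apply, hy, Fin.val_last]
    by_cases h : l n = 0
    · rw [if_pos h, ← Matrix.det_mul_column]
      have : ((-1 : R) ^ (n + n)) = 1 := by rw [← two_mul, pow_mul]; simp
      rw [this, h]
      simp only [add_tsub_cancel_right, le_refl, tsub_eq_zero_of_le, add_zero, pow_zero, mul_one,
        one_mul]
      congr 1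
      ext i j
      simp only [Matrix.submatrix_apply, Fin.succAbove_last, Matrix.of_apply, Fin.val_castSucc]
      rw [← pow_succ']
      congr 1
      omega
    · rw [if_neg h, zero_pow (by omega)]
      simp
  · intro j _ hj
    have : (j : ℕ) < n := by
      have := j.isLt
      have h2 : (j : ℕ) ≠ n := fun h => hj (Fin.ext (by simpa using h))
      omega
    simp only [Matrix.of_apply, hy]
    rw [zero_pow (by omega)]
    simp
  · simp

/-- The product `∏_{p<q} (1 - y_p y_q)`. -/
noncomputable def W {n : ℕ} (y : Fin n → R) : R :=
  ∏ p : Fin n, ∏ q : Fin n, if p < q then 1 - y p * y q else 1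

theorem map_W {S : Type*} [CommRing S] (f : R →+* S) {n : ℕ} (y : Fin n → R) :
    f (W y) = W (fun i => f (y i)) := by
  unfold W
  simp only [map_prod]
  refine Finset.prod_congr rfl fun p _ => Finset.prod_congr rfl fun q _ => ?_
  split_ifs <;> simp

theorem W_succAbove {n : ℕ} (y : Fin (n + 1) → R) (i : Fin (n + 1)) :
    W y = (∏ q : Fin n, (1 - y i * y (i.succAbove q))) * W (fun q => y (i.succAbove q)) := by
  unfold W
  rw [Fin.prod_univ_succAbove _ i, Fin.prod_univ_succAbove _ i]
  simp only [lt_irrefl, if_false, one_mul]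
  simp_rw [Fin.prod_univ_succAbove (fun q => if _ < q then 1 - y _ * y q else 1) i]
  rw [Finset.prod_mul_distrib, ← mul_assoc, ← Finset.prod_mul_distrib]
  congr 1
  · refine Finset.prod_congr rfl fun q _ => ?_
    rcases lt_trichotomy i (i.succAbove q) with h | h | h
    · rw [if_pos h, if_neg h.not_gt, mul_one]
    · exact absurd h.symm (Fin.succAbove_ne i q)
    · rw [if_neg h.not_gt, if_pos h, one_mul, mul_comm (y i)]
  · refine Finset.prod_congr rfl fun p _ => Finset.prod_congr rfl fun q _ => ?_
    simp only [(Fin.strictMono_succAbove i).lt_iff_lt]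

theorem W_last {n : ℕ} (y : Fin (n + 1) → R) (hy : y (Fin.last n) = 0) :
    W y = W (fun i : Fin n => y i.castSucc) := by
  rw [W_succAbove y (Fin.last n)]
  simp [hy]

theorem W_sq {n : ℕ} (y : Fin n → R) :
    W y * W y = ∏ p : Fin n, ∏ q : Fin n, if p = q then 1 else 1 - y p * y q := by
  have : W y = ∏ p : Fin n, ∏ q : Fin n, if q < p then 1 - y p * y q else 1 := by
    unfold W
    rw [Finset.prod_comm]
    simp only [mul_comm]
  nth_rewrite 2 [this]
  unfold W
  rw [← Finset.prod_mul_distrib]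
  refine Finset.prod_congr rfl fun p _ => ?_
  rw [← Finset.prod_mul_distrib]
  refine Finset.prod_congr rfl fun q _ => ?_
  rcases lt_trichotomy p q with h | h | h
  · simp [h, h.not_gt, h.ne]
  · simp [h]
  · simp [h, h.not_gt, h.ne']

theorem W_sq_perm {n : ℕ} (y : Fin n → R) (σ : Equiv.Perm (Fin n)) :
    W (fun i => y (σ i)) * W (fun i => y (σ i)) = W y * W y := by
  rw [W_sq, W_sq, ← Equiv.prod_comp σ
    (fun p => ∏ q : Fin n, if p = q then 1 else 1 - y p * y q)]
  refine Finset.prod_congr rfl fun p _ => ?_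
  rw [← Equiv.prod_comp σ (fun q => if σ p = q then 1 else 1 - y (σ p) * y q)]
  simp

theorem VW_eq {n : ℕ} (y : Fin n → R) :
    (Matrix.projVandermonde (fun i => 1 + y i ^ 2) y).det = altD 0 y * W y := by
  rw [altD_zero_prod, Matrix.det_projVandermonde]
  unfold W
  rw [← Finset.prod_mul_distrib]
  refine Finset.prod_congr rfl fun p _ => ?_
  rw [Finset.prod_ite, Finset.prod_const_one, mul_one]
  have : Finset.univ.filter (fun q => p < q) = Finset.Ioi p := by ext; simp
  rw [this, ← Finset.prod_mul_distrib]
  refine Finset.prod_congr rfl fun q _ => ?_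
  ring

/-- Key polynomial identity behind Littlewood's identity. -/
theorem littlewood_key [IsDomain R] [CharZero R] {m : ℕ} (y : Fin (m + 1) → R)
    (hy : ∀ i, 1 - y i * y i ≠ 0) :
    ∑ i : Fin (m + 1), (-1) ^ ((i : ℕ) + m) * (∏ q : Fin m, (1 - y i * y (i.succAbove q))) *
      (Matrix.of fun p j : Fin m => y (i.succAbove p) ^ (m - (j : ℕ))).det
      = (1 - if Even (m + 1) then ∏ i, y i else 0) * altD 0 y := by
  let Q : Polynomial R := ∏ i : Fin (m + 1), (1 - Polynomial.C (y i) * Polynomial.X)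
  let P : Polynomial R := ∏ i : Fin (m + 1), (Polynomial.X - Polynomial.C (y i))
  let T : Polynomial R := if Even (m + 1) then 1 else Polynomial.X
  have hroot1 : (Q - T * P).eval 1 = 0 := by
    simp only [Q, P, T]
    split_ifs <;> simp [Polynomial.eval_prod]
  have hroot2 : (Q - T * P).eval (-1) = 0 := by
    have e : ∏ i, ((-1 : R) - y i) = (-1) ^ (m + 1) * ∏ i, (1 + y i) := by
      rw [Finset.prod_congr rfl (fun i _ => (by ring : (-1 : R) - y i = (-1) * (1 + y i))),
        Finset.prod_mul_distrib]
      simp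
    simp only [Q, P, T]
    split_ifs with h
    · simp [Polynomial.eval_prod, e, h.neg_one_pow]
    · rw [Nat.not_even_iff_odd] at h
      simp [Polynomial.eval_prod, e, h.neg_one_pow]
  obtain ⟨q1, hq1⟩ := Polynomial.dvd_iff_isRoot.2 hroot1
  have hq1r : q1.IsRoot (-1) := by
    rw [hq1] at hroot2
    simp only [Polynomial.eval_mul, Polynomial.eval_sub, Polynomial.eval_X, Polynomial.eval_C] at hroot2
    rcases mul_eq_zero.1 hroot2 with h | h
    · exfalso
      have : (2 : R) = 0 := by linear_combination -h
      exact two_ne_zero this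
    · exact h
  obtain ⟨q2, hq2⟩ := Polynomial.dvd_iff_isRoot.2 hq1r
  have hp : Q - T * P = (1 - Polynomial.X ^ 2) * (- q2) := by
    rw [hq1, hq2]; simp; ring
  set p := - q2 with hpdef
  have hpdeg : p.natDegree < m + 1 := by
    by_cases hp0 : p = 0
    · rw [hp0]; simp
    have hd : (1 - Polynomial.X ^ 2 : Polynomial R).natDegree = 2 := by
      have : (1 - Polynomial.X ^ 2 : Polynomial R) = - (Polynomial.X ^ 2 - Polynomial.C 1) := by
        simp
      rw [this, Polynomial.natDegree_neg, Polynomial.natDegree_X_pow_sub_C]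
    have hne : (1 - Polynomial.X ^ 2 : Polynomial R) ≠ 0 := by
      intro h; rw [h] at hd; simp at hd
    have h1 := Polynomial.natDegree_mul hne hp0
    rw [← hp, hd] at h1
    have hQ : Q.natDegree ≤ m + 1 := by
      refine (Polynomial.natDegree_prod_le _ _).trans ?_
      refine (Finset.sum_le_card_nsmul _ _ 1 ?_).trans (by simp)
      intro i _
      compute_degree
    have hP : P.natDegree ≤ m + 1 := by
      refine (Polynomial.natDegree_prod_le _ _).trans ?_
      refine (Finset.sum_le_card_nsmul _ _ 1 ?_).trans (by simp)
      intro i _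
      compute_degree
    have hT : T.natDegree ≤ 1 := by
      simp only [T]; split_ifs <;> simp
    have h2 := Polynomial.natDegree_sub_le Q (T * P)
    have h3 := Polynomial.natDegree_mul_le (p := T) (q := P)
    have h4 := max_le (hQ.trans (Nat.le_succ _)) (h3.trans (by omega : _ ≤ m + 2))
    omega
  have hp0 : p.coeff 0 = 1 - if Even (m + 1) then ∏ i, y i else 0 := by
    have := congrArg (Polynomial.eval 0) hp
    rw [Polynomial.coeff_zero_eq_eval_zero]
    simp only [Polynomial.eval_mul, Polynomial.eval_sub, Polynomial.eval_one, Polynomial.eval_pow,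
      Polynomial.eval_X] at this
    have h2 : (1 - (0 : R) ^ 2) * p.eval 0 = p.eval 0 := by ring
    rw [h2] at this
    rw [← this]
    simp only [Q, P, T]
    split_ifs with h
    · simp [Polynomial.eval_prod, Finset.prod_neg, h.neg_one_pow]
    · simp [Polynomial.eval_prod]
  have hpy : ∀ i, p.eval (y i) = ∏ q : Fin m, (1 - y i * y (i.succAbove q)) := by
    intro i
    have := congrArg (Polynomial.eval (y i)) hp
    have hPi : P.eval (y i) = 0 := by
      rw [Polynomial.eval_prod]
      exact Finset.prod_eq_zero (Finset.mem_univ i) (by simp)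
    simp only [Polynomial.eval_mul, Polynomial.eval_sub, Polynomial.eval_one, Polynomial.eval_pow,
      Polynomial.eval_X, hPi, mul_zero, sub_zero] at this
    have hQi : Q.eval (y i) = (1 - y i * y i) * ∏ q : Fin m, (1 - y i * y (i.succAbove q)) := by
      rw [Polynomial.eval_prod, Fin.prod_univ_succAbove _ i]
      simp only [Polynomial.eval_mul, Polynomial.eval_sub, Polynomial.eval_one,
        Polynomial.eval_X, Polynomial.eval_C]
      congr 1
      exact Finset.prod_congr rfl fun q _ => by ring
    rw [hQi] at this
    apply mul_left_cancel₀ (hy i)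
    rw [this]; ring
  let B : Matrix (Fin (m + 1)) (Fin (m + 1)) R :=
    Matrix.of fun i j => y i ^ (m + 1 - 1 - (j : ℕ))
  let b : Fin (m + 1) → R := fun j => p.coeff (m - j)
  have hdet : (B * (1 : Matrix (Fin (m + 1)) (Fin (m + 1)) R).updateCol (Fin.last m) b).det
      = p.coeff 0 * altD 0 y := by
    rw [Matrix.det_mul, mul_comm]
    congr 1
    · rw [← Matrix.cramer_apply, Matrix.cramer_one]
      simp [b]
    · simp [altD, B]
  rw [← hp0, ← hdet, Matrix.det_succ_column _ (Fin.last m)]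
  refine Finset.sum_congr rfl fun i _ => ?_
  congr 1
  · congr 1
    rw [← hpy, Matrix.mul_apply, Polynomial.eval_eq_sum_range' hpdeg,
      ← Fin.sum_univ_eq_sum_range (fun j => p.coeff j * y i ^ j), ← Equiv.sum_comp Fin.revPerm]
    refine Finset.sum_congr rfl fun j _ => ?_
    simp only [Fin.revPerm_apply, Fin.val_rev, Matrix.updateCol_self, B, b, Matrix.of_apply]
    have : m + 1 - (j + 1) = m - (j : ℕ) := by omega
    rw [this, mul_comm]
    congr 2
  · congr 1
    ext a j
    simp only [Matrix.of_apply, Matrix.submatrix_apply, Matrix.mul_apply]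
    rw [Finset.sum_eq_single j.castSucc]
    · rw [Fin.succAbove_last, Matrix.updateCol_ne (Fin.castSucc_lt_last j).ne]
      simp [B]
    · intro c _ hc
      rw [Fin.succAbove_last, Matrix.updateCol_ne (Fin.castSucc_lt_last j).ne,
        Matrix.one_apply_ne hc, mul_zero]
    · simp

end Generic

end GLSp

namespace GLSp

section Cauchy

variable {K : Type*} [Field K] {D : Type*} [CommRing D] [Algebra K D]

theorem homog_prod {ι : Type*} (s : Finset ι) (a : ι → K) (v w : D) :
    ∏ i ∈ s, (v - algebraMap K D (a i) * w) =
      ∑ m ∈ Finset.range (s.card + 1),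
        algebraMap K D ((∏ i ∈ s, (Polynomial.X - Polynomial.C (a i))).coeff m) *
          (v ^ m * w ^ (s.card - m)) := by
  induction s using Finset.induction_on with
  | empty => simp
  | insert b s hb ih =>
    rw [Finset.prod_insert hb, Finset.prod_insert hb, Finset.card_insert_of_notMem hb, ih]
    set p := ∏ i ∈ s, (Polynomial.X - Polynomial.C (a i)) with hp
    have hdeg : p.coeff (s.card + 1) = 0 := by
      apply Polynomial.coeff_eq_zero_of_natDegree_lt
      rw [hp, Polynomial.natDegree_prod_of_monic _ _ (fun i _ => Polynomial.monic_X_sub_C _)]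
      simp
    have h1 : ∑ m ∈ Finset.range (s.card + 1 + 1),
        algebraMap K D ((Polynomial.X * p).coeff m) * (v ^ m * w ^ (s.card + 1 - m)) =
        v * ∑ m ∈ Finset.range (s.card + 1),
          algebraMap K D (p.coeff m) * (v ^ m * w ^ (s.card - m)) := by
      rw [Finset.sum_range_succ', Finset.mul_sum]
      simp only [Polynomial.coeff_X_mul, Polynomial.mul_coeff_zero, Polynomial.coeff_X_zero,
        zero_mul, map_zero, add_zero]
      refine Finset.sum_congr rfl fun m _ => ?_
      rw [Nat.add_sub_add_right]
      ring
    have h2 : ∑ m ∈ Finset.range (s.card + 1 + 1),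
        algebraMap K D (p.coeff m) * (v ^ m * w ^ (s.card + 1 - m)) =
        w * ∑ m ∈ Finset.range (s.card + 1),
          algebraMap K D (p.coeff m) * (v ^ m * w ^ (s.card - m)) := by
      rw [Finset.sum_range_succ, hdeg, map_zero, zero_mul, add_zero, Finset.mul_sum]
      refine Finset.sum_congr rfl fun m hm => ?_
      rw [Finset.mem_range] at hm
      have : s.card + 1 - m = (s.card - m) + 1 := by omega
      rw [this]
      ring
    rw [sub_mul, ← h1, mul_assoc, ← h2, Finset.mul_sum, ← Finset.sum_sub_distrib]
    refine Finset.sum_congr rfl fun m _ => ?_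
    rw [sub_mul, Polynomial.coeff_sub, Polynomial.coeff_C_mul, map_sub, map_mul]
    ring

/-- The constant in the Cauchy determinant. -/
noncomputable def cC {n : ℕ} (a : Fin n → K) : K :=
  (Matrix.of fun i m : Fin n =>
    (∏ i' ∈ Finset.univ.erase i, (Polynomial.X - Polynomial.C (a i'))).coeff m).det

theorem cauchy_det {n : ℕ} (a : Fin n → K) (v w : Fin n → D) :
    (Matrix.of fun i j : Fin n =>
      ∏ i' ∈ Finset.univ.erase i, (v j - algebraMap K D (a i') * w j)).det =
    algebraMap K D (cC a) * (Matrix.projVandermonde v w).det := by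
  unfold cC
  rw [RingHom.map_det, ← Matrix.det_transpose (Matrix.projVandermonde v w), ← Matrix.det_mul]
  congr 1
  ext i j
  rw [Matrix.mul_apply, Matrix.of_apply, homog_prod]
  have hc : (Finset.univ.erase i).card + 1 = n := by
    rw [Finset.card_erase_of_mem (Finset.mem_univ i)]
    simp
    have := i.isLt
    omega
  rw [hc, Finset.sum_range]
  refine Finset.sum_congr rfl fun m _ => ?_
  simp only [RingHom.mapMatrix_apply, Matrix.map_apply, Matrix.of_apply, Matrix.transpose_apply,
    Matrix.projVandermonde_apply, Fin.val_rev]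
  congr 3
  omega

theorem cC_ne_zero {n : ℕ} (a : Fin n → K) (ha : Function.Injective a) : cC a ≠ 0 := by
  have h := cauchy_det (D := K) a a (fun _ => 1)
  have h2 : (Matrix.of fun i j : Fin n =>
      ∏ i' ∈ Finset.univ.erase i, (a j - algebraMap K K (a i') * 1)) =
      Matrix.diagonal fun i => ∏ i' ∈ Finset.univ.erase i, (a i - a i') := by
    ext i j
    by_cases hij : i = j
    · subst hij; simp
    · rw [Matrix.diagonal_apply_ne _ hij, Matrix.of_apply]
      exact Finset.prod_eq_zero (Finset.mem_erase.2 ⟨Ne.symm hij, Finset.mem_univ j⟩) (by simp)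
  rw [h2, Matrix.det_diagonal] at h
  intro h0
  rw [h0, map_zero, zero_mul] at h
  revert h
  simp only [imp_false, ← ne_eq, Finset.prod_ne_zero_iff]
  intro i _ i' hi'
  exact fun h => (Finset.mem_erase.1 hi').1 (ha (sub_eq_zero.1 h)).symm

end Cauchy

section Series

variable {K : Type*} [Field K]

/-- The exponent vector `l + δ`. -/
noncomputable def ex (n : ℕ) (l : ℕ → ℕ) : Fin n →₀ ℕ :=
  Finsupp.equivFunOnFinite.symm fun j : Fin n => l (j : ℕ) + (n - 1 - (j : ℕ))

@[simp] theorem ex_apply (n : ℕ) (l : ℕ → ℕ) (j : Fin n) :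
    ex n l j = l (j : ℕ) + (n - 1 - (j : ℕ)) := rfl

/-- A one-variable power series in the variable `y_j`. -/
noncomputable def U {n : ℕ} (j : Fin n) (f : PowerSeries K) : MvPowerSeries (Fin n) K :=
  MvPowerSeries.rename (fun _ : Unit => j) f

theorem coeff_U_single {n : ℕ} (j : Fin n) (f : PowerSeries K) (r : ℕ) :
    MvPowerSeries.coeff (Finsupp.single j r) (U j f) = PowerSeries.coeff r f := by
  have := MvPowerSeries.coeff_embDomain_rename (R := K)
    (⟨fun _ : Unit => j, fun _ _ _ => rfl⟩ : Unit ↪ Fin n) f (Finsupp.single () r)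
  rw [Finsupp.embDomain_single] at this
  exact this

theorem coeff_U_ne {n : ℕ} (j : Fin n) (f : PowerSeries K) (e : Fin n →₀ ℕ)
    (he : e ≠ Finsupp.single j (e j)) :
    MvPowerSeries.coeff e (U j f) = 0 := by
  apply MvPowerSeries.coeff_rename_eq_zero
  rintro ⟨x, rfl⟩
  apply he
  have : x = Finsupp.single () (x ()) := by ext; simp
  rw [this]
  simp [Finsupp.mapDomain_single]

theorem coeff_prod_U {n : ℕ} (f : Fin n → PowerSeries K) (e : Fin n →₀ ℕ) :
    MvPowerSeries.coeff e (∏ j, U j (f j)) = ∏ j, PowerSeries.coeff (e j) (f j) := by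
  rw [MvPowerSeries.coeff_prod, Finset.sum_eq_single
    (Finsupp.equivFunOnFinite.symm fun j => Finsupp.single j (e j))]
  · refine Finset.prod_congr rfl fun j _ => ?_
    rw [Finsupp.equivFunOnFinite_symm_apply_apply, coeff_U_single]
  · intro l hl hne
    by_contra hprod
    rw [← ne_eq, Finset.prod_ne_zero_iff] at hprod
    have h1 : ∀ j, l j = Finsupp.single j (l j j) := fun j => by
      by_contra h
      exact hprod j (Finset.mem_univ j) (coeff_U_ne j _ _ h)
    rw [Finset.mem_finsuppAntidiag] at hl
    apply hne
    ext j : 1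
    rw [Finsupp.equivFunOnFinite_symm_apply_apply, h1 j]
    congr 1
    rw [← hl.1, Finsupp.finsetSum_apply, Finset.sum_eq_single j]
    · intro b _ hb
      rw [h1 b, Finsupp.single_eq_of_ne (Ne.symm hb)]
    · simp
  · intro h
    exfalso
    apply h
    rw [Finset.mem_finsuppAntidiag]
    refine ⟨?_, by simp⟩
    ext j
    rw [Finsupp.finsetSum_apply, Finset.sum_eq_single j]
    · simp
    · intro b _ hb
      simp [Finsupp.single_eq_of_ne (Ne.symm hb)]
    · simp

theorem coeff_det_U {n : ℕ} (f : Fin n → PowerSeries K) (e : Fin n →₀ ℕ) :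
    MvPowerSeries.coeff e (Matrix.of fun i j : Fin n => U j (f i)).det =
      (Matrix.of fun i j : Fin n => PowerSeries.coeff (e j) (f i)).det := by
  rw [Matrix.det_apply, Matrix.det_apply, map_sum]
  refine Finset.sum_congr rfl fun σ _ => ?_
  simp only [Matrix.of_apply, Units.smul_def]
  rw [map_zsmul, coeff_prod_U (fun i => f (σ i))]

theorem cauchy_coeff {n : ℕ} (a : Fin n → K)
    (v w : Fin n → MvPowerSeries (Fin n) K) (f : Fin n → PowerSeries K)
    (hf : ∀ i j, (v j - MvPowerSeries.C (a i) * w j) * U j (f i) = 1) (l : ℕ → ℕ) :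
    (Matrix.of fun i j : Fin n => PowerSeries.coeff (l (j : ℕ) + (n - 1 - (j : ℕ))) (f i)).det =
    cC a * MvPowerSeries.coeff (ex n l)
      ((Matrix.projVandermonde v w).det * ∏ j, ∏ i, U j (f i)) := by
  have h1 := coeff_det_U f (ex n l)
  simp only [ex_apply] at h1
  rw [← h1]
  have h2 : (Matrix.of fun i j : Fin n => U j (f i)) = Matrix.of fun i j : Fin n =>
      (∏ i', U j (f i')) * (Matrix.of fun i j : Fin n => ∏ i' ∈ Finset.univ.erase i,
        (v j - algebraMap K (MvPowerSeries (Fin n) K) (a i') * w j)) i j := by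
    ext1 i j
    simp only [Matrix.of_apply]
    rw [← Finset.mul_prod_erase Finset.univ _ (Finset.mem_univ i), mul_assoc,
      ← Finset.prod_mul_distrib, Finset.prod_eq_one, mul_one]
    intro i' _
    rw [mul_comm]
    exact hf i' j
  rw [h2, Matrix.det_mul_row, cauchy_det, mul_comm, mul_assoc]
  exact MvPowerSeries.coeff_C_mul _ _ _

end Series

end GLSp

namespace GLSp

section Stab

variable {K : Type*} [Field K]

theorem kill_castSucc {n : ℕ} (i : Fin n) :
    MvPowerSeries.killCompl (R := K) (Fin.castSuccEmb (n := n))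
      (MvPowerSeries.X i.castSucc) = MvPowerSeries.X i :=
  MvPowerSeries.killCompl_X (R := K) (e := (Fin.castSuccEmb (n := n))) i

theorem kill_last {n : ℕ} :
    MvPowerSeries.killCompl (R := K) (Fin.castSuccEmb (n := n))
      (MvPowerSeries.X (Fin.last n)) = 0 := by
  apply MvPowerSeries.killCompl_X_eq_zero
  rintro ⟨i, hi⟩
  exact (Fin.castSucc_lt_last i).ne hi

theorem kill_alt {n : ℕ} (l : ℕ → ℕ) :
    MvPowerSeries.killCompl (R := K) (Fin.castSuccEmb (n := n))
      (altD l (fun i => MvPowerSeries.X i)) =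
    if l n = 0 then (∏ i : Fin n, MvPowerSeries.X i) * altD l (fun i => MvPowerSeries.X i)
      else 0 := by
  have h := map_altD (MvPowerSeries.killCompl (R := K)
    (Fin.castSuccEmb (n := n))).toRingHom l (fun i => MvPowerSeries.X i)
  simp only [AlgHom.toRingHom_eq_coe, RingHom.coe_coe] at h
  rw [h, altD_last _ _ kill_last]
  simp only [kill_castSucc]

theorem prod_X_eq {n : ℕ} : (∏ i : Fin n, (MvPowerSeries.X i : MvPowerSeries (Fin n) K)) =
    MvPowerSeries.monomial (Finsupp.equivFunOnFinite.symm fun _ => 1) 1 := by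
  simp only [MvPowerSeries.X]
  rw [MvPowerSeries.prod_monomial]
  have h : ∑ i : Fin n, Finsupp.single i 1 =
      (Finsupp.equivFunOnFinite.symm fun _ => 1 : Fin n →₀ ℕ) := by
    ext j
    rw [Finsupp.finsetSum_apply, Finset.sum_eq_single j]
    · simp
    · intro b _ hb
      simp [Finsupp.single_eq_of_ne (Ne.symm hb)]
    · simp
  rw [h]
  simp

theorem coeff_prod_X_mul {n : ℕ} (e : Fin n →₀ ℕ) (f : MvPowerSeries (Fin n) K) :
    MvPowerSeries.coeff (Finsupp.equivFunOnFinite.symm (fun _ => 1) + e)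
      ((∏ i : Fin n, MvPowerSeries.X i) * f) = MvPowerSeries.coeff e f := by
  rw [prod_X_eq, MvPowerSeries.coeff_add_monomial_mul, one_mul]

instance instDomainM {n : ℕ} : IsDomain (MvPowerSeries (Fin n) K) := NoZeroDivisors.to_isDomain _

theorem X_injM {n : ℕ} :
    Function.Injective (fun i => (MvPowerSeries.X i : MvPowerSeries (Fin n) K)) := by
  intro i j h
  exact MvPowerSeries.X_inj.1 h

theorem alt_ne_zero {n : ℕ} :
    altD 0 (fun i => (MvPowerSeries.X i : MvPowerSeries (Fin n) K)) ≠ 0 :=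
  altD_zero_ne_zero _ X_injM

theorem stab {n : ℕ} (l : ℕ → ℕ) (hl : l n = 0) (f : MvPowerSeries (Fin (n + 1)) K) :
    MvPowerSeries.coeff (ex (n + 1) l) (altD 0 (fun i => MvPowerSeries.X i) * f) =
    MvPowerSeries.coeff (ex n l) (altD 0 (fun i => MvPowerSeries.X i) *
      MvPowerSeries.killCompl (R := K) (Fin.castSuccEmb (n := n)) f) := by
  have h : ex (n + 1) l = Finsupp.embDomain (Fin.castSuccEmb (n := n))
      (Finsupp.equivFunOnFinite.symm (fun _ => 1) + ex n l) := by
    ext j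
    refine Fin.lastCases ?_ (fun i => ?_) j
    · rw [Finsupp.embDomain_of_notMem_range]
      · simp [hl]
      · rintro ⟨i, hi⟩
        exact (Fin.castSucc_lt_last i).ne hi
    · have := Finsupp.embDomain_apply_self (Fin.castSuccEmb (n := n))
        (Finsupp.equivFunOnFinite.symm (fun _ => 1) + ex n l) i
      simp only [Fin.coe_castSuccEmb] at this
      rw [this]
      simp
      omega
  rw [h, ← MvPowerSeries.coeff_killCompl, map_mul, kill_alt]
  simp only [Pi.zero_apply, if_true]
  rw [mul_assoc, coeff_prod_X_mul]

variable (K) in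
/-- Polynomials over `ℤ` as power series over `K`. -/
noncomputable def toM (n : ℕ) : MvPolynomial (Fin n) ℤ →+* MvPowerSeries (Fin n) K :=
  (MvPolynomial.coeToMvPowerSeries.ringHom).comp (MvPolynomial.map (Int.castRingHom K))

theorem coeff_toM {n : ℕ} (p : MvPolynomial (Fin n) ℤ) (e : Fin n →₀ ℕ) :
    MvPowerSeries.coeff e (toM K n p) = ((MvPolynomial.coeff e p : ℤ) : K) := by
  simp [toM, MvPolynomial.coeff_map]

theorem toM_X {n : ℕ} (i : Fin n) : toM K n (X i) = MvPowerSeries.X i := by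
  simp [toM]

theorem alternant_eq (n : ℕ) (l : ℕ → ℕ) :
    alternant n l = altD l (fun i => (X i : MvPolynomial (Fin n) ℤ)) := rfl

theorem vandermondeP_eq (n : ℕ) :
    vandermondeP n = altD 0 (fun i => (X i : MvPolynomial (Fin n) ℤ)) := by
  simp [altD, vandermondeP]

theorem schur_spec (n : ℕ) (l : ℕ → ℕ) : schur n l * vandermondeP n = alternant n l := by
  have h : ∃ q : MvPolynomial (Fin n) ℤ, q * vandermondeP n = alternant n l := by
    rw [vandermondeP_eq, alternant_eq]
    exact altD_dvd _ _
  unfold schur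
  rw [dif_pos h]
  exact h.choose_spec

variable (K) in
/-- Schur polynomial as a power series. -/
noncomputable def S (n : ℕ) (l : ℕ → ℕ) : MvPowerSeries (Fin n) K := toM K n (schur n l)

theorem toM_vand (n : ℕ) : toM K n (vandermondeP n) = altD 0 (fun i => MvPowerSeries.X i) := by
  rw [vandermondeP_eq, map_altD]
  simp only [toM_X]

theorem S_mul (n : ℕ) (l : ℕ → ℕ) :
    S K n l * altD 0 (fun i => MvPowerSeries.X i) = altD l (fun i => MvPowerSeries.X i) := by
  have := congrArg (toM K n) (schur_spec n l)
  rw [map_mul, alternant_eq, map_altD, toM_vand] at this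
  simp only [toM_X] at this
  exact this

theorem kill_S (n : ℕ) (l : ℕ → ℕ) :
    MvPowerSeries.killCompl (R := K) (Fin.castSuccEmb (n := n)) (S K (n + 1) l) =
    if l n = 0 then S K n l else 0 := by
  have h := congrArg (MvPowerSeries.killCompl (R := K) (Fin.castSuccEmb (n := n)))
    (S_mul (K := K) (n + 1) l)
  rw [map_mul, kill_alt, kill_alt] at h
  simp only [Pi.zero_apply, if_true] at h
  have hne : (∏ i : Fin n, (MvPowerSeries.X i : MvPowerSeries (Fin n) K)) *
      altD 0 (fun i => MvPowerSeries.X i) ≠ 0 := by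
    apply mul_ne_zero _ alt_ne_zero
    rw [Finset.prod_ne_zero_iff]
    intro i _
    intro h0
    have := congrArg (MvPowerSeries.coeff (Finsupp.single i 1)) h0
    simp [MvPowerSeries.coeff_X] at this
  apply mul_right_cancel₀ hne
  rw [h]
  split_ifs
  · rw [← S_mul]; ring
  · simp

variable (K) in
/-- Littlewood-Richardson coefficients in `n` variables. -/
noncomputable def lrK (n : ℕ) (b m l : ℕ → ℕ) : K :=
  MvPowerSeries.coeff (ex n l) (S K n b * S K n m * altD 0 (fun i => MvPowerSeries.X i))

theorem lrK_succ (n : ℕ) (b m l : ℕ → ℕ) (hl : l n = 0) :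
    lrK K (n + 1) b m l = if b n = 0 ∧ m n = 0 then lrK K n b m l else 0 := by
  unfold lrK
  rw [mul_comm, stab l hl, map_mul (MvPowerSeries.killCompl _), kill_S, kill_S]
  by_cases h1 : b n = 0 <;> by_cases h2 : m n = 0 <;> simp [h1, h2, mul_comm]

end Stab

section Partn

theorem lengthLE_mono {p : Partn} {n m : ℕ} (h : p.LengthLE n) (hnm : n ≤ m) : p.LengthLE m :=
  fun i hi => h i (hnm.trans hi)

theorem lengthLE_succ {p : Partn} {n : ℕ} : p.LengthLE n ↔ p.LengthLE (n + 1) ∧ p.parts n = 0 := by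
  constructor
  · exact fun h => ⟨lengthLE_mono h (Nat.le_succ n), h n le_rfl⟩
  · rintro ⟨h1, h2⟩ i hi
    rcases Nat.eq_or_lt_of_le hi with rfl | h
    · exact h2
    · exact h1 i h

theorem weight_eq {p : Partn} {n : ℕ} (h : p.LengthLE n) :
    p.weight = ∑ j : Fin n, p.parts j := by
  unfold Partn.weight
  rw [finsum_eq_sum_of_support_subset (s := Finset.range n), Finset.sum_range]
  intro i hi
  simp only [Function.mem_support] at hi
  simp only [Finset.coe_range, Set.mem_Iio]
  by_contra hc
  exact hi (h i (by omega))

theorem lengthLE_weight (p : Partn) : p.LengthLE p.weight := by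
  intro i hi
  by_contra hne
  obtain ⟨N, hN⟩ := p.eventually_zero
  have hiN : i < N := by
    by_contra h
    exact hne (hN i (by omega))
  have h1 : p.weight = ∑ j ∈ Finset.range N, p.parts j := by
    rw [weight_eq (n := N) hN, Finset.sum_range]
  have h2 : ∑ j ∈ Finset.range (i + 1), 1 ≤ ∑ j ∈ Finset.range (i + 1), p.parts j := by
    apply Finset.sum_le_sum
    intro j hj
    rw [Finset.mem_range] at hj
    have := p.antitone j i (by omega)
    omega
  have h3 : ∑ j ∈ Finset.range (i + 1), p.parts j ≤ ∑ j ∈ Finset.range N, p.parts j :=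
    Finset.sum_le_sum_of_subset (by intro x; simp; omega)
  simp at h2
  omega

theorem partn_ext {p q : Partn} (h : p.parts = q.parts) : p = q := by
  cases p; cases q; simp only at h; subst h; rfl

end Partn

section LR

variable {K : Type*} [Field K]

variable (K) in
/-- Length-corrected LR coefficient. -/
noncomputable def lrL (n : ℕ) (b m l : Partn) : K :=
  if b.LengthLE n ∧ m.LengthLE n then lrK K n b.parts m.parts l.parts else 0

theorem lrL_succ (n : ℕ) (b m l : Partn) (hl : l.LengthLE n) :
    lrL K (n + 1) b m l = lrL K n b m l := by
  unfold lrL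
  rw [lrK_succ n _ _ _ (hl n le_rfl), lengthLE_succ (p := b) (n := n),
    lengthLE_succ (p := m) (n := n)]
  by_cases h1 : b.LengthLE (n + 1) <;> by_cases h2 : m.LengthLE (n + 1) <;> simp [h1, h2]

theorem lrL_const (b m l : Partn) (n d : ℕ) (hl : l.LengthLE n) :
    lrL K (n + d) b m l = lrL K n b m l := by
  induction d with
  | zero => rfl
  | succ d ih =>
    rw [← ih, ← add_assoc]
    exact lrL_succ _ _ _ _ (lengthLE_mono hl (by omega))

theorem lrL_eq (b m l : Partn) (n n' : ℕ) (hl : l.LengthLE n) (hl' : l.LengthLE n') :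
    lrL K n b m l = lrL K n' b m l := by
  rcases le_total n n' with h | h
  · obtain ⟨d, rfl⟩ := Nat.exists_eq_add_of_le h
    exact (lrL_const b m l n d hl).symm
  · obtain ⟨d, rfl⟩ := Nat.exists_eq_add_of_le h
    exact lrL_const b m l n' d hl'

theorem lrCoeff_cast (b m l : Partn) (k : ℕ) (hl : l.LengthLE k)
    (hw : l.weight = b.weight + m.weight) :
    ((lrCoeff b m l : ℤ) : K) = lrL K k b m l := by
  have h0 : l.LengthLE (b.weight + m.weight) := hw ▸ lengthLE_weight l
  rw [lrL_eq b m l k (b.weight + m.weight) hl h0]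
  unfold lrCoeff lrL
  rw [if_pos hw, if_pos ⟨lengthLE_mono (lengthLE_weight b) (by omega),
    lengthLE_mono (lengthLE_weight m) (by omega)⟩, ← coeff_toM, (toM K _).map_mul,
    (toM K _).map_mul, toM_vand]
  rfl

theorem altD_smul {R : Type*} [CommRing R] {n : ℕ} (l : ℕ → ℕ) (c : R) (y : Fin n → R) :
    altD l (fun i => c * y i) =
      c ^ (∑ j : Fin n, (l j + (n - 1 - (j : ℕ)))) * altD l y := by
  unfold altD
  rw [← Finset.prod_pow_eq_pow_sum, ← Matrix.det_mul_row]
  congr 1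
  ext i j
  simp [mul_pow]

theorem rescale_alt {n : ℕ} (l : ℕ → ℕ) (c : K) :
    MvPowerSeries.rescale (fun _ => c) (altD l (fun i : Fin n => MvPowerSeries.X i)) =
      MvPowerSeries.C (c ^ (∑ j : Fin n, (l j + (n - 1 - (j : ℕ))))) *
        altD l (fun i : Fin n => MvPowerSeries.X i) := by
  have hX : ∀ i : Fin n, MvPowerSeries.rescale (fun _ => c) (MvPowerSeries.X i) =
      MvPowerSeries.C c * MvPowerSeries.X i := by
    intro i
    ext e
    rw [MvPowerSeries.coeff_rescale, MvPowerSeries.coeff_C_mul, MvPowerSeries.coeff_X]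
    split_ifs with h
    · subst h; simp
    · simp
  rw [map_altD]
  simp only [hX]
  rw [altD_smul, map_pow]

theorem rescale_S {n : ℕ} (l : ℕ → ℕ) (c : K) (hc : c ≠ 0) :
    MvPowerSeries.rescale (fun _ => c) (S K n l) =
      MvPowerSeries.C (c ^ (∑ j : Fin n, l j)) * S K n l := by
  have h := congrArg (MvPowerSeries.rescale (fun _ => c)) (S_mul (K := K) n l)
  rw [map_mul, rescale_alt, rescale_alt, ← S_mul (K := K) n l] at h
  simp only [Pi.zero_apply, zero_add, Finset.sum_add_distrib, pow_add, map_mul] at h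
  have hne : MvPowerSeries.C (c ^ (∑ j : Fin n, (n - 1 - (j : ℕ)))) *
      altD 0 (fun i : Fin n => (MvPowerSeries.X i : MvPowerSeries (Fin n) K)) ≠ 0 := by
    apply mul_ne_zero _ alt_ne_zero
    intro h0
    have := congrArg MvPowerSeries.constantCoeff h0
    rw [MvPowerSeries.constantCoeff_C, map_zero] at this
    exact pow_ne_zero _ hc this
  apply mul_right_cancel₀ hne
  rw [h]; ring

theorem lrK_eq_zero [CharZero K] {n : ℕ} (b m l : ℕ → ℕ)
    (hw : ∑ j : Fin n, l j ≠ ∑ j : Fin n, b j + ∑ j : Fin n, m j) : lrK K n b m l = 0 := by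
  unfold lrK
  have h : MvPowerSeries.rescale (fun _ => (2 : K))
      (S K n b * S K n m * altD 0 (fun i => MvPowerSeries.X i)) =
      MvPowerSeries.C (2 ^ (∑ j : Fin n, b j + ∑ j : Fin n, m j +
        ∑ j : Fin n, (n - 1 - (j : ℕ)))) *
      (S K n b * S K n m * altD 0 (fun i => MvPowerSeries.X i)) := by
    rw [map_mul, map_mul, rescale_S _ _ two_ne_zero, rescale_S _ _ two_ne_zero, rescale_alt,
      pow_add, pow_add, map_mul, map_mul]
    simp only [Pi.zero_apply, zero_add]
    ring
  have h2 := congrArg (MvPowerSeries.coeff (ex n l)) h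
  rw [MvPowerSeries.coeff_rescale, MvPowerSeries.coeff_C_mul,
    Finsupp.prod_fintype _ _ (by simp), Finset.prod_pow_eq_pow_sum] at h2
  by_contra hne
  have h3 := mul_right_cancel₀ hne h2
  have h4 : (2 : ℕ) ^ (∑ j : Fin n, ex n l j) = 2 ^ (∑ j : Fin n, b j + ∑ j : Fin n, m j +
        ∑ j : Fin n, (n - 1 - (j : ℕ))) := by exact_mod_cast h3
  have h5 := Nat.pow_right_injective (le_refl 2) h4
  simp only [ex_apply, Finset.sum_add_distrib] at h5
  omega

theorem lrCoeff_cast' [CharZero K] (b m l : Partn) (k : ℕ) (hl : l.LengthLE k) :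
    ((lrCoeff b m l : ℤ) : K) = lrL K k b m l := by
  by_cases hw : l.weight = b.weight + m.weight
  · exact lrCoeff_cast b m l k hl hw
  · unfold lrCoeff lrL
    rw [if_neg hw, Int.cast_zero]
    split_ifs with h
    · rw [lrK_eq_zero]
      rw [← weight_eq hl, ← weight_eq h.1, ← weight_eq h.2]
      exact hw
    · rfl

end LR

end GLSp

namespace GLSp

section Anti

variable {K : Type*} [Field K]

/-- Antisymmetric power series. -/
def Anti {n : ℕ} (A : MvPowerSeries (Fin n) K) : Prop :=
  ∀ σ : Equiv.Perm (Fin n), MvPowerSeries.rename (R := K) σ.toEmbedding A =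
    (((Equiv.Perm.sign σ : ℤˣ) : ℤ) : MvPowerSeries (Fin n) K) * A

/-- Symmetric power series. -/
def Symm {n : ℕ} (A : MvPowerSeries (Fin n) K) : Prop :=
  ∀ σ : Equiv.Perm (Fin n), MvPowerSeries.rename (R := K) σ.toEmbedding A = A

theorem Anti.mul_symm {n : ℕ} {A B : MvPowerSeries (Fin n) K} (hA : Anti A) (hB : Symm B) :
    Anti (A * B) := by
  intro σ
  rw [map_mul, hA σ, hB σ, mul_assoc]

theorem anti_alt {n : ℕ} (l : ℕ → ℕ) :
    Anti (altD l (fun i : Fin n => (MvPowerSeries.X i : MvPowerSeries (Fin n) K))) := by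
  intro σ
  have h := map_altD (MvPowerSeries.rename (R := K) σ.toEmbedding).toRingHom l
    (fun i => MvPowerSeries.X i)
  simp only [AlgHom.toRingHom_eq_coe, RingHom.coe_coe, MvPowerSeries.rename_X] at h
  rw [h]
  exact altD_perm l (fun i => MvPowerSeries.X i) σ

theorem anti_sum {n : ℕ} {ι : Type*} (s : Finset ι) (c : ι → K)
    (A : ι → MvPowerSeries (Fin n) K) (hA : ∀ i ∈ s, Anti (A i)) :
    Anti (∑ i ∈ s, c i • A i) := by
  intro σ
  rw [map_sum, Finset.mul_sum]
  refine Finset.sum_congr rfl fun i hi => ?_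
  rw [map_smul, hA i hi σ, mul_smul_comm]

/-- Permuted exponent. -/
noncomputable def pe {n : ℕ} (e : Fin n →₀ ℕ) (σ : Equiv.Perm (Fin n)) : Fin n →₀ ℕ :=
  Finsupp.equivFunOnFinite.symm fun i => e (σ i)

theorem sign_coeff {n : ℕ} (σ : Equiv.Perm (Fin n)) (e : Fin n →₀ ℕ)
    (A : MvPowerSeries (Fin n) K) :
    MvPowerSeries.coeff e ((((Equiv.Perm.sign σ : ℤˣ) : ℤ) : MvPowerSeries (Fin n) K) * A) =
      (((Equiv.Perm.sign σ : ℤˣ) : ℤ) : K) * MvPowerSeries.coeff e A := by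
  rw [← zsmul_eq_mul, map_zsmul, zsmul_eq_mul]

theorem Anti.coeff {n : ℕ} {A : MvPowerSeries (Fin n) K} (hA : Anti A)
    (σ : Equiv.Perm (Fin n)) (e : Fin n →₀ ℕ) :
    (((Equiv.Perm.sign σ : ℤˣ) : ℤ) : K) * MvPowerSeries.coeff e A =
      MvPowerSeries.coeff (pe e σ) A := by
  have h : e = Finsupp.embDomain σ.toEmbedding (pe e σ) := by
    ext j
    have := Finsupp.embDomain_apply_self σ.toEmbedding (pe e σ) (σ.symm j)
    simp only [Equiv.coe_toEmbedding, Equiv.apply_symm_apply] at this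
    rw [this]
    simp [pe]
  have h2 := MvPowerSeries.coeff_embDomain_rename σ.toEmbedding A (pe e σ)
  rw [← h, hA σ, sign_coeff] at h2
  exact h2

theorem Anti.coeff_rep [CharZero K] {n : ℕ} {A : MvPowerSeries (Fin n) K} (hA : Anti A)
    (e : Fin n →₀ ℕ) (he : ¬ Function.Injective e) : MvPowerSeries.coeff e A = 0 := by
  simp only [Function.Injective, not_forall] at he
  obtain ⟨i, j, hij, hne⟩ := he
  have h := hA.coeff (Equiv.swap i j) e
  have h2 : pe e (Equiv.swap i j) = e := by
    ext p
    simp only [pe, Finsupp.equivFunOnFinite_symm_apply_apply]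
    rw [Equiv.swap_apply_def]
    split_ifs with h1 h2
    · rw [h1, hij]
    · rw [h2, hij]
    · rfl
  rw [h2, Equiv.Perm.sign_swap hne] at h
  simp at h
  exact (self_eq_neg (G := K)).1 h.symm

theorem strictAnti_le {n : ℕ} {f : Fin n → ℕ} (hf : StrictAnti f) (i j : Fin n) (hij : i ≤ j) :
    f j + ((j : ℕ) - i) ≤ f i := by
  obtain ⟨i, hi⟩ := i
  obtain ⟨j, hj⟩ := j
  simp only [Fin.mk_le_mk] at hij
  obtain ⟨d, rfl⟩ := Nat.exists_eq_add_of_le hij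
  clear hij
  induction d with
  | zero => simp
  | succ d ih =>
    have h1 := ih (by omega)
    have h2 : f ⟨i + (d + 1), hj⟩ < f ⟨i + d, by omega⟩ := hf (by simp)
    simp only [Nat.add_sub_cancel_left] at h1 ⊢
    omega

theorem exists_partn {n : ℕ} (e : Fin n →₀ ℕ) (he : Function.Injective e) :
    ∃ (σ : Equiv.Perm (Fin n)) (ν : Partn), ν.LengthLE n ∧ pe e σ = ex n ν.parts := by
  let σ := Tuple.sort (fun i => OrderDual.toDual (e i))
  have hm : Monotone ((fun i => OrderDual.toDual (e i)) ∘ σ) := Tuple.monotone_sort _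
  have hs : StrictAnti (fun i => e (σ i)) := by
    intro i j hij
    refine lt_of_le_of_ne (hm hij.le) ?_
    intro h
    exact hij.ne (σ.injective (he h)).symm
  have hlast : ∀ i : Fin n, n - 1 - (i : ℕ) ≤ e (σ i) := by
    intro i
    have := strictAnti_le hs i ⟨n - 1, by have := i.isLt; omega⟩
      (by rw [Fin.le_def]; have := i.isLt; simp; omega)
    simp at this
    omega
  refine ⟨σ, ⟨fun i => if h : i < n then e (σ ⟨i, h⟩) - (n - 1 - i) else 0, ?_, ⟨n, ?_⟩⟩, ?_, ?_⟩
  · intro i j hij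
    by_cases hj : j < n
    · have hi : i < n := by omega
      simp only [dif_pos hi, dif_pos hj]
      have h1 := strictAnti_le hs ⟨i, hi⟩ ⟨j, hj⟩ hij
      have h2 := hlast ⟨i, hi⟩
      have h3 := hlast ⟨j, hj⟩
      simp only at h1 h2 h3
      omega
    · simp [hj]
  · intro i hi
    rw [dif_neg (by omega)]
  · intro i hi
    simp only
    rw [dif_neg (by omega)]
  · ext i
    have := hlast i
    simp [pe]
    omega

theorem sum_pe {n : ℕ} (e : Fin n →₀ ℕ) (σ : Equiv.Perm (Fin n)) :
    ∑ i, pe e σ i = ∑ i, e i := by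
  simp only [pe, Finsupp.equivFunOnFinite_symm_apply_apply]
  exact Equiv.sum_comp σ e

/-- `|δ|`. -/
noncomputable def dl (n : ℕ) : ℕ := ∑ j : Fin n, (n - 1 - (j : ℕ))

theorem sum_ex {n : ℕ} {ν : Partn} (hν : ν.LengthLE n) :
    ∑ i, ex n ν.parts i = ν.weight + dl n := by
  simp only [ex_apply, Finset.sum_add_distrib, ← weight_eq hν, dl]

theorem anti_eq_zero [CharZero K] {n : ℕ} {A B : MvPowerSeries (Fin n) K} (hA : Anti A)
    (hB : Anti B) (d : ℕ)
    (h : ∀ ν : Partn, ν.LengthLE n → ν.weight ≤ d →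
      MvPowerSeries.coeff (ex n ν.parts) A = MvPowerSeries.coeff (ex n ν.parts) B)
    (e : Fin n →₀ ℕ) (he : ∑ i, e i ≤ d + dl n) :
    MvPowerSeries.coeff e A = MvPowerSeries.coeff e B := by
  by_cases hi : Function.Injective e
  · obtain ⟨σ, ν, hν, hσ⟩ := exists_partn e hi
    have h1 := hA.coeff σ e
    have h2 := hB.coeff σ e
    have h3 := sum_pe e σ
    rw [hσ, sum_ex hν] at h3
    rw [hσ] at h1 h2
    rw [h ν hν (by omega), ← h2] at h1
    refine mul_left_cancel₀ ?_ h1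
    rcases Int.units_eq_one_or (Equiv.Perm.sign σ) with h | h <;> simp [h]
  · rw [hA.coeff_rep e hi, hB.coeff_rep e hi]

theorem ex_strictAnti {n : ℕ} (ν : Partn) : StrictAnti (ex n ν.parts) := by
  intro i j hij
  have := ν.antitone i j hij.le
  have h1 := j.isLt
  have h2 : (i : ℕ) < j := hij
  simp
  omega

theorem ex_inj {n : ℕ} {μ ν : Partn} (hμ : μ.LengthLE n) (hν : ν.LengthLE n)
    (h : ∀ i, ex n μ.parts i = ex n ν.parts i) : μ = ν := by
  apply partn_ext
  funext i
  by_cases hi : i < n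
  · have := h ⟨i, hi⟩
    simp at this
    exact this
  · rw [hμ i (by omega), hν i (by omega)]

theorem U_pow {n : ℕ} (j : Fin n) (r : ℕ) :
    U j (PowerSeries.X ^ r) = (MvPowerSeries.X j : MvPowerSeries (Fin n) K) ^ r := by
  unfold U
  rw [map_pow]
  congr 1
  exact MvPowerSeries.rename_X _ ()

theorem coeff_alt_ex {n : ℕ} (μ ν : Partn) (hμ : μ.LengthLE n) (hν : ν.LengthLE n) :
    MvPowerSeries.coeff (ex n ν.parts)
      (altD μ.parts (fun i : Fin n => (MvPowerSeries.X i : MvPowerSeries (Fin n) K))) =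
      if μ = ν then 1 else 0 := by
  have h : altD μ.parts (fun i : Fin n => (MvPowerSeries.X i : MvPowerSeries (Fin n) K)) =
      (Matrix.of fun i j : Fin n => U j (PowerSeries.X ^ (ex n μ.parts i))).det := by
    unfold altD
    rw [← Matrix.det_transpose]
    congr 1
    ext1 i j
    simp only [Matrix.transpose_apply, Matrix.of_apply, U_pow, ex_apply]
  rw [h, coeff_det_U]
  simp only [PowerSeries.coeff_X_pow]
  split_ifs with hμν
  · subst hμν
    have : (Matrix.of fun i j : Fin n =>
        if ex n μ.parts j = ex n μ.parts i then (1 : K) else 0) = 1 := by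
      ext i j
      rw [Matrix.of_apply, Matrix.one_apply]
      simp only [(ex_strictAnti μ).injective.eq_iff, eq_comm]
    rw [this, Matrix.det_one]
  · by_contra hne
    apply hμν
    have hrow : ∀ i, ∃ j, ex n ν.parts j = ex n μ.parts i := by
      intro i
      by_contra hc
      push Not at hc
      apply hne
      apply Matrix.det_eq_zero_of_row_eq_zero i
      intro j
      rw [Matrix.of_apply, if_neg (hc j)]
    have hsub : Finset.univ.image (ex n μ.parts) ⊆ Finset.univ.image (ex n ν.parts) := by
      intro x hx
      simp only [Finset.mem_image, Finset.mem_univ, true_and] at hx ⊢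
      obtain ⟨i, rfl⟩ := hx
      exact hrow i
    have heq := Finset.eq_of_subset_of_card_le hsub (by
      rw [Finset.card_image_of_injective _ (ex_strictAnti μ).injective,
        Finset.card_image_of_injective _ (ex_strictAnti ν).injective])
    have hr : Set.range (ex n μ.parts) = Set.range (ex n ν.parts) := by
      have := congrArg (fun s : Finset ℕ => (s : Set ℕ)) heq
      simpa using this
    have := (StrictAnti.range_inj (ex_strictAnti μ) (ex_strictAnti ν)).1 hr
    exact ex_inj hμ hν (fun i => congrFun this i)

theorem finite_P (n d : ℕ) : {p : Partn | p.LengthLE n ∧ p.weight ≤ d}.Finite := by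
  apply Set.Finite.of_injOn (f := fun p : Partn => fun i : Fin n => p.parts i)
    (t := Set.Iic (fun _ => d)) _ _ (Set.finite_Iic _)
  · rintro p ⟨hp, hw⟩ i
    rw [weight_eq hp] at hw
    exact (Finset.single_le_sum (f := fun j : Fin n => p.parts j)
      (fun _ _ => Nat.zero_le _) (Finset.mem_univ i)).trans hw
  · rintro p ⟨hp, _⟩ q ⟨hq, _⟩ h
    apply ex_inj hp hq
    intro i
    have := congrFun h i
    simp at this
    simp [this]

/-- Partitions with at most `n` parts and weight at most `d`. -/
noncomputable def PP (n d : ℕ) : Finset Partn := (finite_P n d).toFinset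

theorem mem_PP {n d : ℕ} {p : Partn} : p ∈ PP n d ↔ p.LengthLE n ∧ p.weight ≤ d := by
  simp [PP]

/-- Main expansion. -/
theorem anti_expand [CharZero K] {n : ℕ} {A : MvPowerSeries (Fin n) K} (hA : Anti A)
    (C : MvPowerSeries (Fin n) K) (d : ℕ) (e : Fin n →₀ ℕ) (he : ∑ i, e i ≤ d + dl n) :
    MvPowerSeries.coeff e (C * A) = ∑ μ ∈ PP n d, MvPowerSeries.coeff (ex n μ.parts) A *
      MvPowerSeries.coeff e (C * altD μ.parts (fun i => MvPowerSeries.X i)) := by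
  set B : MvPowerSeries (Fin n) K := ∑ μ ∈ PP n d, MvPowerSeries.coeff (ex n μ.parts) A •
    altD μ.parts (fun i => MvPowerSeries.X i) with hB
  have hBa : Anti B := anti_sum _ _ _ (fun μ _ => anti_alt _)
  have h1 : ∀ e' : Fin n →₀ ℕ, ∑ i, e' i ≤ d + dl n →
      MvPowerSeries.coeff e' A = MvPowerSeries.coeff e' B := by
    apply anti_eq_zero hA hBa
    intro ν hν hw
    rw [hB, map_sum, Finset.sum_eq_single ν]
    · rw [MvPowerSeries.coeff_smul, coeff_alt_ex ν ν hν hν]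
      simp
    · intro μ hμ hne
      rw [MvPowerSeries.coeff_smul, coeff_alt_ex μ ν (mem_PP.1 hμ).1 hν, if_neg hne, mul_zero]
    · intro h
      exact absurd (mem_PP.2 ⟨hν, hw⟩) h
  have h2 : MvPowerSeries.coeff e (C * A) = MvPowerSeries.coeff e (C * B) := by
    rw [MvPowerSeries.coeff_mul, MvPowerSeries.coeff_mul]
    refine Finset.sum_congr rfl fun p hp => ?_
    rw [h1]
    rw [Finset.HasAntidiagonal.mem_antidiagonal] at hp
    refine le_trans (Finset.sum_le_sum fun i _ => ?_) he
    rw [← hp]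
    simp
  rw [h2, hB, Finset.mul_sum, map_sum]
  refine Finset.sum_congr rfl fun μ _ => ?_
  rw [mul_smul_comm, MvPowerSeries.coeff_smul]

/-- The zero partition. -/
def Partn0 : Partn := ⟨0, fun _ _ _ => le_rfl, ⟨0, fun _ _ => rfl⟩⟩

theorem coeff_zero_alt [CharZero K] {n : ℕ} (F : MvPowerSeries (Fin n) K)
    (hF : MvPowerSeries.constantCoeff F = 1) :
    MvPowerSeries.coeff (ex n 0) (altD 0 (fun i => MvPowerSeries.X i) * F) = 1 := by
  induction n with
  | zero =>
    have h : ex 0 0 = 0 := by ext i; exact i.elim0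
    rw [h, MvPowerSeries.coeff_zero_eq_constantCoeff_apply, map_mul, hF]
    simp [altD]
  | succ n ih =>
    rw [stab _ rfl, ih]
    rw [← MvPowerSeries.coeff_zero_eq_constantCoeff_apply, MvPowerSeries.coeff_killCompl]
    simpa using hF

end Anti

end GLSp

namespace GLSp

section Littlewood

variable {K : Type*} [Field K]

variable (K) in
/-- `∏_{i<j} (1 - y_i y_j)`. -/
noncomputable def WX (n : ℕ) : MvPowerSeries (Fin n) K := W (fun i => MvPowerSeries.X i)

variable (K) in
/-- `∏_{i<j} (1 - y_i y_j)⁻¹`. -/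
noncomputable def Phi (n : ℕ) : MvPowerSeries (Fin n) K := (WX K n)⁻¹

theorem constWX (n : ℕ) : MvPowerSeries.constantCoeff (WX K n) = 1 := by
  unfold WX
  rw [map_W]
  simp [W]

theorem WX_ne (n : ℕ) : WX K n ≠ 0 := by
  intro h
  have := constWX (K := K) n
  rw [h] at this
  simp at this

theorem WX_mul_Phi (n : ℕ) : WX K n * Phi K n = 1 :=
  MvPowerSeries.mul_inv_cancel _ (by rw [constWX]; exact one_ne_zero)

theorem Phi_mul_WX (n : ℕ) : Phi K n * WX K n = 1 := by rw [mul_comm, WX_mul_Phi]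

theorem rename_WX {n m : ℕ} (f : Fin n ↪ Fin m) :
    MvPowerSeries.rename (R := K) f (WX K n) = W (fun i => MvPowerSeries.X (f i)) := by
  have h := map_W (MvPowerSeries.rename (R := K) f).toRingHom (fun i => MvPowerSeries.X i)
  simp only [AlgHom.toRingHom_eq_coe, RingHom.coe_coe, MvPowerSeries.rename_X] at h
  exact h

theorem symm_WX [CharZero K] (n : ℕ) : Symm (WX K n) := by
  intro σ
  have h : MvPowerSeries.rename (R := K) σ.toEmbedding (WX K n) *
      MvPowerSeries.rename (R := K) σ.toEmbedding (WX K n) = WX K n * WX K n := by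
    rw [rename_WX]
    exact W_sq_perm (fun i => MvPowerSeries.X i) σ
  rcases mul_self_eq_mul_self_iff.1 h with h1 | h1
  · exact h1
  · exfalso
    have h2 := congrArg MvPowerSeries.constantCoeff h1
    rw [MvPowerSeries.constantCoeff_rename, map_neg, constWX] at h2
    exact one_ne_zero ((self_eq_neg (G := K)).1 h2)

theorem symm_Phi [CharZero K] (n : ℕ) : Symm (Phi K n) := by
  intro σ
  apply mul_right_cancel₀ (WX_ne (K := K) n)
  nth_rewrite 1 [← symm_WX n σ]
  rw [← map_mul, Phi_mul_WX, map_one]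

theorem kill_WX (n : ℕ) :
    MvPowerSeries.killCompl (R := K) (Fin.castSuccEmb (n := n)) (WX K (n + 1)) = WX K n := by
  have h := map_W (MvPowerSeries.killCompl (R := K) (Fin.castSuccEmb (n := n))).toRingHom
    (fun i => MvPowerSeries.X i)
  simp only [AlgHom.toRingHom_eq_coe, RingHom.coe_coe] at h
  unfold WX
  rw [h, W_last _ kill_last]
  simp only [kill_castSucc]

theorem kill_Phi (n : ℕ) :
    MvPowerSeries.killCompl (R := K) (Fin.castSuccEmb (n := n)) (Phi K (n + 1)) = Phi K n := by
  apply mul_right_cancel₀ (WX_ne (K := K) n)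
  nth_rewrite 1 [← kill_WX n]
  rw [← map_mul, Phi_mul_WX, map_one, Phi_mul_WX]

theorem rename_Phi (m : ℕ) (i : Fin (m + 1)) :
    MvPowerSeries.rename (R := K) (Fin.succAboveEmb i) (Phi K m) =
    (∏ q : Fin m, (1 - MvPowerSeries.X i * MvPowerSeries.X (i.succAbove q))) * Phi K (m + 1) := by
  apply mul_right_cancel₀ (WX_ne (K := K) (m + 1))
  rw [mul_assoc, Phi_mul_WX, mul_one]
  have h : WX K (m + 1) = (∏ q : Fin m, (1 - MvPowerSeries.X i * MvPowerSeries.X (i.succAbove q))) *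
      MvPowerSeries.rename (R := K) (Fin.succAboveEmb i) (WX K m) := by
    rw [rename_WX]
    exact W_succAbove (fun i => MvPowerSeries.X i) i
  rw [h, mul_left_comm, ← map_mul, Phi_mul_WX, map_one, mul_one]

theorem coeff_rename_succ (m : ℕ) (i : Fin (m + 1)) (A : MvPowerSeries (Fin m) K)
    (e : Fin (m + 1) →₀ ℕ) (he : e i ≠ 0) :
    MvPowerSeries.coeff e (MvPowerSeries.rename (R := K) (Fin.succAboveEmb i) A) = 0 := by
  apply MvPowerSeries.coeff_rename_eq_zero
  rintro ⟨x, rfl⟩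
  apply he
  apply Finsupp.mapDomain_of_notMem_range
  rintro ⟨q, hq⟩
  exact Fin.succAbove_ne i q hq

theorem minor_rename (m : ℕ) (i : Fin (m + 1)) :
    (Matrix.of fun p j : Fin m =>
      (MvPowerSeries.X (i.succAbove p) : MvPowerSeries (Fin (m + 1)) K) ^ (m - (j : ℕ))).det =
    MvPowerSeries.rename (R := K) (Fin.succAboveEmb i)
      (Matrix.of fun p j : Fin m =>
        (MvPowerSeries.X p : MvPowerSeries (Fin m) K) ^ (m - (j : ℕ))).det := by
  rw [AlgHom.map_det]
  congr 1
  ext1 p j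
  simp [MvPowerSeries.rename_X]

theorem key_Phi [CharZero K] (m : ℕ) (e : Fin (m + 1) →₀ ℕ) (he : ∀ i, e i ≠ 0) :
    MvPowerSeries.coeff e (altD 0 (fun i => MvPowerSeries.X i) * Phi K (m + 1)) =
    if Even (m + 1) then MvPowerSeries.coeff e ((∏ i, MvPowerSeries.X i) *
      (altD 0 (fun i => MvPowerSeries.X i) * Phi K (m + 1))) else 0 := by
  have : CharZero (MvPowerSeries (Fin (m + 1)) K) :=
    charZero_of_injective_algebraMap (R := K) (FaithfulSMul.algebraMap_injective _ _)
  have h := littlewood_key (fun i => (MvPowerSeries.X i : MvPowerSeries (Fin (m + 1)) K))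
    (fun i h => by
      have := congrArg MvPowerSeries.constantCoeff h
      simp at this)
  have h2 := congrArg (fun z => MvPowerSeries.coeff e (z * Phi K (m + 1))) h
  simp only [Finset.sum_mul, map_sum] at h2
  rw [Finset.sum_eq_zero] at h2
  · by_cases hev : Even (m + 1)
    · simp only [if_pos hev, sub_mul, one_mul, map_sub] at h2 ⊢
      rw [mul_assoc] at h2
      exact sub_eq_zero.1 h2.symm
    · simp only [if_neg hev, sub_zero, one_mul] at h2 ⊢
      exact h2.symm
  · intro i _
    rw [minor_rename, mul_assoc, mul_comm (MvPowerSeries.rename _ _) (Phi K (m + 1)), mul_assoc,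
      ← mul_assoc (∏ q : Fin m, _) (Phi K (m + 1)), ← rename_Phi, ← map_mul]
    have : ((-1 : MvPowerSeries (Fin (m + 1)) K)) ^ ((i : ℕ) + m) =
        MvPowerSeries.C ((-1) ^ ((i : ℕ) + m)) := by simp
    rw [this, MvPowerSeries.coeff_C_mul, coeff_rename_succ _ _ _ _ (he i), mul_zero]

variable (K) in
/-- Littlewood coefficient. -/
noncomputable def bb (n : ℕ) (l : ℕ → ℕ) : K :=
  MvPowerSeries.coeff (ex n l) (altD 0 (fun i => MvPowerSeries.X i) * Phi K n)

theorem bb_stab (n : ℕ) (l : ℕ → ℕ) (hl : l n = 0) : bb K (n + 1) l = bb K n l := by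
  unfold bb
  rw [stab _ hl, kill_Phi]

theorem bb_step [CharZero K] (m : ℕ) (l : ℕ → ℕ) (ha : Antitone l) (hl : l m ≠ 0) :
    bb K (m + 1) l = if Even (m + 1) then bb K (m + 1) (fun i => l i - 1) else 0 := by
  have hpos : ∀ i : Fin (m + 1), 1 ≤ l i := by
    intro i
    have := ha (show (i : ℕ) ≤ m by have := i.isLt; omega)
    omega
  unfold bb
  rw [key_Phi]
  · have : ex (m + 1) l = Finsupp.equivFunOnFinite.symm (fun _ => 1) +
        ex (m + 1) (fun i => l i - 1) := by
      ext i
      have := hpos i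
      simp
      omega
    rw [this, coeff_prod_X_mul]
  · intro i
    have := hpos i
    simp
    omega

theorem bb_eq [CharZero K] (n : ℕ) : ∀ l : ℕ → ℕ, Antitone l → (∀ i, n ≤ i → l i = 0) →
    bb K n l = if ∀ i, l (2 * i) = l (2 * i + 1) then 1 else 0 := by
  induction n with
  | zero =>
    intro l _ h0
    rw [if_pos (fun i => by rw [h0 _ (Nat.zero_le _), h0 _ (Nat.zero_le _)])]
    unfold bb
    have h1 : ex 0 l = 0 := by ext i; exact i.elim0
    rw [h1, MvPowerSeries.coeff_zero_eq_constantCoeff_apply, map_mul, Phi,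
      MvPowerSeries.constantCoeff_inv, constWX]
    simp [altD]
  | succ m ih =>
    intro l ha h0
    induction hc : l m generalizing l with
    | zero =>
      rw [bb_stab m l hc, ih l ha]
      intro i hi
      rcases Nat.eq_or_lt_of_le hi with rfl | h
      · exact hc
      · exact h0 i h
    | succ c ihc =>
      rw [bb_step m l ha (by omega)]
      by_cases hev : Even (m + 1)
      · rw [if_pos hev, ihc _ (fun i j hij => Nat.sub_le_sub_right (ha hij) 1)
          (fun i hi => by rw [h0 i hi]) (by omega)]
        congr 1
        apply propext
        apply forall_congr'
        intro i
        obtain ⟨r, hr⟩ := hev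
        by_cases hi : 2 * i + 1 ≤ m
        · have h1 := ha hi
          have h2 := ha (show 2 * i ≤ m by omega)
          omega
        · rw [h0 (2 * i) (by omega), h0 (2 * i + 1) (by omega)]
      · rw [if_neg hev, if_neg]
        intro h
        rw [Nat.not_even_iff_odd] at hev
        obtain ⟨r, hr⟩ := hev
        have h1 := h r
        rw [h0 (2 * r + 1) (by omega), show 2 * r = m by omega] at h1
        omega

theorem conj_lt (p : Partn) (i : ℕ) : ∀ j, i < p.parts j ↔ j < p.conjParts i := by
  have hex : ∃ j, p.parts j ≤ i := by
    obtain ⟨N, hN⟩ := p.eventually_zero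
    exact ⟨N, by rw [hN N le_rfl]; exact Nat.zero_le _⟩
  have h : ∀ j, i < p.parts j ↔ j < Nat.find hex := by
    intro j
    constructor
    · intro hj
      by_contra hc
      have h1 := p.antitone _ _ (not_lt.1 hc)
      have h2 := Nat.find_spec hex
      omega
    · intro hj
      have := Nat.find_min hex hj
      omega
  have hcard : p.conjParts i = Nat.find hex := by
    unfold Partn.conjParts
    rw [Nat.card_congr (Equiv.subtypeEquivRight h), Nat.card_congr (Fin.equivSubtype).symm]
    simp
  rw [hcard]
  exact h

theorem even_conj_iff (p : Partn) :
    (∀ i, Even (p.conjParts i)) ↔ ∀ i, p.parts (2 * i) = p.parts (2 * i + 1) := by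
  constructor
  · intro h i
    by_contra hne
    have h1 := p.antitone (2 * i) (2 * i + 1) (by omega)
    have h2 := conj_lt p (p.parts (2 * i + 1))
    have h3 := (h2 (2 * i)).1 (by omega)
    have h4 := (h2 (2 * i + 1)).not.1 (by omega)
    obtain ⟨r, hr⟩ := h (p.parts (2 * i + 1))
    omega
  · intro h i
    by_contra hodd
    rw [Nat.not_even_iff_odd] at hodd
    obtain ⟨r, hr⟩ := hodd
    have h2 := conj_lt p i
    have h3 := (h2 (2 * r)).2 (by omega)
    have h4 := (h2 (2 * r + 1)).not.2 (by omega)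
    have := h r
    omega

theorem bb_partn [CharZero K] (n : ℕ) (β : Partn) (hβ : β.LengthLE n) :
    bb K n β.parts = if ∀ i, Even (β.conjParts i) then 1 else 0 := by
  rw [bb_eq n β.parts (fun i j h => β.antitone i j h) hβ]
  simp only [even_conj_iff]

end Littlewood

end GLSp

namespace GLSp

section CauchyApp

variable {K : Type*} [Field K]

/-- Geometric series. -/
noncomputable def geo (z : K) : PowerSeries K := PowerSeries.mk fun r => z ^ r

theorem geo_mul (z : K) : (1 - PowerSeries.C z * PowerSeries.X) * geo z = 1 := by
  ext r
  rw [sub_mul, one_mul, mul_assoc, map_sub, PowerSeries.coeff_C_mul]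
  cases r with
  | zero => simp [geo]
  | succ r =>
    rw [PowerSeries.coeff_succ_X_mul]
    simp [geo, PowerSeries.coeff_one, pow_succ, mul_comm]

theorem U_mul {n : ℕ} (j : Fin n) (f g : PowerSeries K) : U j (f * g) = U j f * U j g :=
  map_mul (MvPowerSeries.rename (R := K) (fun _ : Unit => j)) f g

theorem U_one {n : ℕ} (j : Fin n) : U j (1 : PowerSeries K) = 1 :=
  map_one (MvPowerSeries.rename (R := K) (fun _ : Unit => j))

theorem U_sub {n : ℕ} (j : Fin n) (f g : PowerSeries K) : U j (f - g) = U j f - U j g :=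
  map_sub (MvPowerSeries.rename (R := K) (fun _ : Unit => j)) f g

theorem U_C {n : ℕ} (j : Fin n) (c : K) : U j (PowerSeries.C c) = MvPowerSeries.C c :=
  MvPowerSeries.rename_C (fun _ : Unit => j) c

theorem U_X {n : ℕ} (j : Fin n) : U j (PowerSeries.X : PowerSeries K) = MvPowerSeries.X j :=
  MvPowerSeries.rename_X (fun _ : Unit => j) ()

theorem U_geo {n : ℕ} (j : Fin n) (z : K) :
    (1 - MvPowerSeries.C z * MvPowerSeries.X j) * U j (geo z) = 1 := by
  have h := congrArg (U j) (geo_mul z)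
  rwa [U_mul, U_sub, U_mul, U_one, U_C, U_X] at h

theorem U_rename {n m : ℕ} (f : Fin n ↪ Fin m) (j : Fin n) (g : PowerSeries K) :
    MvPowerSeries.rename (R := K) f (U j g) = U (f j) g :=
  MvPowerSeries.rename_rename (R := K) (fun _ : Unit => j) f g

/-- The Cauchy kernel. -/
noncomputable def FF {m : ℕ} (n : ℕ) (z : Fin m → K) : MvPowerSeries (Fin n) K :=
  ∏ j : Fin n, ∏ i : Fin m, U j (geo (z i))

theorem constU (n : ℕ) (j : Fin n) (z : K) :
    MvPowerSeries.constantCoeff (U j (geo z)) = 1 := by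
  have h := congrArg MvPowerSeries.constantCoeff (U_geo j z)
  simpa using h

theorem const_FF {m : ℕ} (n : ℕ) (z : Fin m → K) :
    MvPowerSeries.constantCoeff (FF n z) = 1 := by
  unfold FF
  simp only [map_prod, constU, Finset.prod_const_one]

theorem symm_FF {m : ℕ} (n : ℕ) (z : Fin m → K) : Symm (FF n z) := by
  intro σ
  unfold FF
  simp only [map_prod, U_rename]
  exact Equiv.prod_comp σ (fun j => ∏ i : Fin m, U j (geo (z i)))

theorem kill_FF {m : ℕ} (n : ℕ) (z : Fin m → K) :
    MvPowerSeries.killCompl (R := K) (Fin.castSuccEmb (n := n)) (FF (n + 1) z) = FF n z := by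
  have h1 : ∀ (j : Fin n) (g : PowerSeries K),
      MvPowerSeries.killCompl (R := K) (Fin.castSuccEmb (n := n)) (U j.castSucc g) = U j g := by
    intro j g
    have : MvPowerSeries.rename (R := K) (Fin.castSuccEmb (n := n)) (U j g) = U j.castSucc g :=
      U_rename (K := K) (Fin.castSuccEmb (n := n)) j g
    rw [← this]
    exact MvPowerSeries.killCompl_rename_app _
  have h2 : ∀ (c : K),
      MvPowerSeries.killCompl (R := K) (Fin.castSuccEmb (n := n)) (U (Fin.last n) (geo c)) = 1 := by
    intro c
    have := congrArg (MvPowerSeries.killCompl (R := K) (Fin.castSuccEmb (n := n)))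
      (U_geo (Fin.last n) c)
    rw [map_mul, map_sub, map_mul, map_one, kill_last] at this
    simpa using this
  unfold FF
  simp only [map_prod]
  rw [Fin.prod_univ_castSucc]
  simp only [h1, h2, Finset.prod_const_one, mul_one]

theorem stab_FF {m : ℕ} (n d : ℕ) (z : Fin m → K) (l : ℕ → ℕ) (hl : ∀ i, n ≤ i → l i = 0) :
    MvPowerSeries.coeff (ex (n + d) l) (altD 0 (fun i => MvPowerSeries.X i) * FF (n + d) z) =
    MvPowerSeries.coeff (ex n l) (altD 0 (fun i => MvPowerSeries.X i) * FF n z) := by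
  induction d with
  | zero => rfl
  | succ d ih =>
    rw [← ih]
    have := stab (K := K) (n := n + d) l (hl _ (by omega)) (FF (n + d + 1) z)
    rw [kill_FF] at this
    exact this

theorem stab_FF' {m : ℕ} (n N : ℕ) (hN : n ≤ N) (z : Fin m → K) (l : ℕ → ℕ)
    (hl : ∀ i, n ≤ i → l i = 0) :
    MvPowerSeries.coeff (ex N l) (altD 0 (fun i => MvPowerSeries.X i) * FF N z) =
    MvPowerSeries.coeff (ex n l) (altD 0 (fun i => MvPowerSeries.X i) * FF n z) := by
  obtain ⟨d, rfl⟩ := Nat.exists_eq_add_of_le hN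
  exact stab_FF n d z l hl

theorem gl_cauchy [CharZero K] {n : ℕ} (z : Fin n → K) (l : ℕ → ℕ) :
    altD l z = cC z * MvPowerSeries.coeff (ex n l)
      (altD 0 (fun i => MvPowerSeries.X i) * FF n z) := by
  have h := cauchy_coeff z (fun _ => 1) (fun j => MvPowerSeries.X j) (fun i => geo (z i))
    (fun i j => U_geo j (z i)) l
  rw [← altD_zero_eq] at h
  rw [FF, ← h]
  unfold altD
  simp [geo]

theorem aeval_schur [CharZero K] [Algebra ℤ K] {n : ℕ} (z : Fin n → K)
    (hz : Function.Injective z) (l : ℕ → ℕ) :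
    MvPolynomial.aeval z (schur n l) = MvPowerSeries.coeff (ex n l)
      (altD 0 (fun i => MvPowerSeries.X i) * FF n z) := by
  have h0 := gl_cauchy z 0
  rw [coeff_zero_alt _ (const_FF n z), mul_one] at h0
  have h1 := gl_cauchy z l
  have hm : ∀ l, MvPolynomial.aeval z (altD l (fun i => (X i : MvPolynomial (Fin n) ℤ))) =
      altD l z := by
    intro l
    have h := map_altD (MvPolynomial.aeval (R := ℤ) z).toRingHom l (fun i => X i)
    simp only [AlgHom.toRingHom_eq_coe, RingHom.coe_coe, aeval_X] at h
    exact h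
  have h2 := congrArg (MvPolynomial.aeval z) (schur_spec n l)
  rw [map_mul, alternant_eq, vandermondeP_eq, hm, hm, h1, ← h0, mul_comm] at h2
  exact mul_left_cancel₀ (altD_zero_ne_zero z hz) h2

theorem sp_series (x : K) (hx : x ≠ 0) (r : ℕ) :
    (x - x⁻¹) * PowerSeries.coeff r (geo x * geo x⁻¹) =
      x ^ ((r + 1 : ℕ) : ℤ) - x ^ (-((r + 1 : ℕ) : ℤ)) := by
  have h1 := geo_mul x
  have h2 := geo_mul x⁻¹
  have h : PowerSeries.C (x - x⁻¹) * (geo x * geo x⁻¹) =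
      PowerSeries.C x * geo x - PowerSeries.C x⁻¹ * geo x⁻¹ := by
    have hxx : (PowerSeries.C x * PowerSeries.C x⁻¹ : PowerSeries K) = 1 := by
      rw [← map_mul, mul_inv_cancel₀ hx, map_one]
    rw [map_sub]
    linear_combination (PowerSeries.C x * geo x) * h2 - (PowerSeries.C x⁻¹ * geo x⁻¹) * h1
  have h3 := congrArg (PowerSeries.coeff r) h
  rw [PowerSeries.coeff_C_mul, map_sub, PowerSeries.coeff_C_mul, PowerSeries.coeff_C_mul] at h3
  rw [h3]
  simp only [geo, PowerSeries.coeff_mk, zpow_neg, zpow_natCast, pow_succ, inv_pow, mul_inv]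
  ring

theorem sp_cauchy {n : ℕ} (x : Fin n → K) (hx : ∀ i, x i ≠ 0) (l : ℕ → ℕ) :
    (Matrix.of fun i j : Fin n =>
      x i ^ ((l (j : ℕ) + (n - (j : ℕ)) : ℕ) : ℤ) -
        x i ^ (-((l (j : ℕ) + (n - (j : ℕ)) : ℕ) : ℤ))).det =
    (∏ i, (x i - (x i)⁻¹)) * cC (fun i => x i + (x i)⁻¹) * MvPowerSeries.coeff (ex n l)
      (altD 0 (fun i => MvPowerSeries.X i) * (WX K n *
        ∏ j, ∏ i, (U j (geo (x i)) * U j (geo (x i)⁻¹)))) := by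
  have h := cauchy_coeff (fun i => x i + (x i)⁻¹) (fun j => 1 + MvPowerSeries.X j ^ 2)
    (fun j => MvPowerSeries.X j) (fun i => geo (x i) * geo (x i)⁻¹)
    (fun i j => by
      have h1 := U_geo j (x i)
      have h2 := U_geo j (x i)⁻¹
      have hxx : (MvPowerSeries.C (x i) * MvPowerSeries.C (x i)⁻¹ :
          MvPowerSeries (Fin n) K) = 1 := by
        rw [← map_mul, mul_inv_cancel₀ (hx i), map_one]
      rw [U_mul, map_add]
      linear_combination h1 * ((1 - MvPowerSeries.C (x i)⁻¹ * MvPowerSeries.X j) *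
        U j (geo (x i)⁻¹)) + h2 - hxx * (MvPowerSeries.X j ^ 2 * U j (geo (x i)) *
        U j (geo (x i)⁻¹))) l
  rw [VW_eq] at h
  simp only [U_mul] at h
  rw [mul_assoc (altD 0 _)] at h
  unfold WX
  rw [mul_assoc, ← h, ← Matrix.det_mul_column]
  congr 1
  ext1 i j
  simp only [Matrix.of_apply]
  rw [sp_series (x i) (hx i)]
  have : l (j : ℕ) + (n - (j : ℕ)) = l j + (n - 1 - (j : ℕ)) + 1 := by
    have := j.isLt
    omega
  rw [this]

end CauchyApp

section Main

theorem xv_inj (k : ℕ) : Function.Injective (xv k) := by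
  intro i j h
  have := IsFractionRing.injective (MvPolynomial (Fin k) ℚ) (RatFn k) h
  exact MvPolynomial.X_injective this

theorem xv_ne (k : ℕ) (i : Fin k) : xv k i ≠ 0 := by
  intro h
  have : algebraMap (MvPolynomial (Fin k) ℚ) (RatFn k) (X i) =
    algebraMap (MvPolynomial (Fin k) ℚ) (RatFn k) 0 := by rw [map_zero]; exact h
  exact MvPolynomial.X_ne_zero i (IsFractionRing.injective _ _ this)

theorem xv_mul_ne (k : ℕ) (i j : Fin k) : xv k i * xv k j ≠ 1 := by
  intro h
  have h1 : algebraMap (MvPolynomial (Fin k) ℚ) (RatFn k) (X i * X j) =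
    algebraMap (MvPolynomial (Fin k) ℚ) (RatFn k) 1 := by rw [map_one, map_mul]; exact h
  have h2 := IsFractionRing.injective _ _ h1
  have h3 := congrArg MvPolynomial.constantCoeff h2
  simp at h3

theorem spEval_inj (k : ℕ) : Function.Injective (spEval k) := by
  intro i j h
  unfold spEval at h
  have key : ∀ a b : Fin k, xv k a ≠ (xv k b)⁻¹ := by
    intro a b hab
    apply xv_mul_ne k a b
    rw [hab, inv_mul_cancel₀ (xv_ne k b)]
  split_ifs at h with h1 h2 h2
  · have := xv_inj k h
    simp only [Fin.mk.injEq] at this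
    exact Fin.ext this
  · exact absurd h (key _ _)
  · exact absurd h.symm (key _ _)
  · have := xv_inj k (inv_injective h)
    simp only [Fin.mk.injEq] at this
    apply Fin.ext
    omega

theorem sum_inj (k : ℕ) : Function.Injective (fun i => xv k i + (xv k i)⁻¹) := by
  intro i j h
  simp only at h
  have hi := xv_ne k i
  have hj := xv_ne k j
  field_simp at h
  have h2 : (xv k i - xv k j) * (xv k i * xv k j - 1) = 0 := by linear_combination h
  rcases mul_eq_zero.1 h2 with h3 | h3
  · exact xv_inj k (sub_eq_zero.1 h3)
  · exact absurd (sub_eq_zero.1 h3) (xv_mul_ne k i j)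

theorem prod_spEval {M : Type*} [CommMonoid M] (k : ℕ) (g : RatFn k → M) :
    ∏ i, g (spEval k i) = ∏ i : Fin k, (g (xv k i) * g (xv k i)⁻¹) := by
  rw [← Equiv.prod_comp (finCongr (two_mul k).symm), Fin.prod_univ_add, Finset.prod_mul_distrib]
  congr 1
  · refine Finset.prod_congr rfl fun i _ => ?_
    simp [spEval]
  · refine Finset.prod_congr rfl fun i _ => ?_
    simp [spEval]

theorem sp_coeff (k : ℕ) (l : ℕ → ℕ) :
    MvPowerSeries.coeff (ex k l) (altD 0 (fun i => MvPowerSeries.X i) *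
      (WX (RatFn k) k * FF k (spEval k))) = spChar k l := by
  have hF : FF k (spEval k) = ∏ j : Fin k, ∏ i, (U j (geo (xv k i)) * U j (geo (xv k i)⁻¹)) := by
    unfold FF
    refine Finset.prod_congr rfl fun j _ => ?_
    exact prod_spEval k (fun z => U j (geo z))
  have h1 := sp_cauchy (xv k) (xv_ne k) l
  have h2 := sp_cauchy (xv k) (xv_ne k) 0
  rw [← hF] at h1 h2
  rw [coeff_zero_alt _ (by rw [map_mul, constWX, const_FF, mul_one]), mul_one] at h2
  simp only [Pi.zero_apply, zero_add] at h2
  unfold spChar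
  rw [h1, h2]
  have hne : (∏ i, (xv k i - (xv k i)⁻¹)) * cC (fun i => xv k i + (xv k i)⁻¹) ≠ 0 := by
    apply mul_ne_zero _ (cC_ne_zero _ (sum_inj k))
    rw [Finset.prod_ne_zero_iff]
    intro i _ h
    apply xv_mul_ne k i i
    nth_rewrite 2 [sub_eq_zero.1 h]
    exact mul_inv_cancel₀ (xv_ne k i)
  rw [mul_div_cancel_left₀ _ hne]

theorem main_sum (k : ℕ) (l : Partn) (hl : l.LengthLE k) :
    MvPolynomial.aeval (spEval k) (schur (2 * k) l.parts) =
    ∑ μ ∈ PP k l.weight, spChar k μ.parts * ∑ β ∈ PP k l.weight,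
      (if ∀ i, Even (β.conjParts i) then (1 : RatFn k) else 0) *
        lrK (RatFn k) k β.parts μ.parts l.parts := by
  rw [aeval_schur _ (spEval_inj k)]
  have hst : MvPowerSeries.coeff (ex (2 * k) l.parts)
      (altD 0 (fun i => MvPowerSeries.X i) * FF (2 * k) (spEval k)) =
      MvPowerSeries.coeff (ex k l.parts)
      (altD 0 (fun i => MvPowerSeries.X i) * FF k (spEval k)) :=
    stab_FF' k (2 * k) (by omega) _ _ hl
  rw [hst]
  have hexp : ∑ i, ex k l.parts i ≤ l.weight + dl k := (sum_ex hl).le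
  have hfac : altD 0 (fun i => MvPowerSeries.X i) * FF k (spEval k) =
      Phi (RatFn k) k * (altD 0 (fun i => MvPowerSeries.X i) *
        (WX (RatFn k) k * FF k (spEval k))) := by
    have := Phi_mul_WX (K := RatFn k) k
    linear_combination (-(altD 0 (fun i => MvPowerSeries.X i) * FF k (spEval k))) * this
  have hsymm : Symm (WX (RatFn k) k * FF k (spEval k)) := by
    intro σ
    rw [map_mul, symm_WX, symm_FF]
  rw [hfac, anti_expand ((anti_alt 0).mul_symm hsymm) _ _ _ hexp]
  refine Finset.sum_congr rfl fun μ hμ => ?_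
  rw [sp_coeff]
  congr 1
  have h1 : Phi (RatFn k) k * altD μ.parts (fun i => MvPowerSeries.X i) =
      S (RatFn k) k μ.parts * (altD 0 (fun i => MvPowerSeries.X i) * Phi (RatFn k) k) := by
    rw [← S_mul]
    ring
  rw [h1, anti_expand ((anti_alt 0).mul_symm (symm_Phi k)) _ _ _ hexp]
  refine Finset.sum_congr rfl fun β hβ => ?_
  congr 1
  · exact bb_partn k β (mem_PP.1 hβ).1
  · rw [← S_mul, lrK]
    congr 1
    ring

theorem lr_support {k : ℕ} {b m l : Partn} (hl : l.LengthLE k) (h : lrCoeff b m l ≠ 0) :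
    b ∈ PP k l.weight ∧ m ∈ PP k l.weight := by
  have hw : l.weight = b.weight + m.weight := by
    by_contra hc
    exact h (by rw [lrCoeff, if_neg hc])
  have h1 : ((lrCoeff b m l : ℤ) : ℚ) ≠ 0 := by exact_mod_cast h
  rw [lrCoeff_cast' b m l k hl, lrL] at h1
  have h2 : b.LengthLE k ∧ m.LengthLE k := by
    by_contra hc
    exact h1 (if_neg hc)
  exact ⟨mem_PP.2 ⟨h2.1, by omega⟩, mem_PP.2 ⟨h2.2, by omega⟩⟩

theorem inner_sum (k : ℕ) (l : Partn) (hl : l.LengthLE k) (μ : Partn) :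
    (∑ᶠ (β : Partn) (_ : ∀ i, Even (β.conjParts i)), lrCoeff β μ l) =
    ∑ β ∈ PP k l.weight, if ∀ i, Even (β.conjParts i) then lrCoeff β μ l else 0 := by
  simp only [finsum_eq_if]
  apply finsum_eq_sum_of_support_subset
  intro β hβ
  simp only [Function.mem_support, ne_eq, ite_eq_right_iff, not_forall] at hβ
  obtain ⟨_, h⟩ := hβ
  exact (lr_support hl h).1

end Main

end GLSp

theorem gl_to_sp_branching (k : ℕ) (hk : 0 < k) (l : Partn) (hl : l.LengthLE k) :
    MvPolynomial.aeval (spEval k) (schur (2 * k) l.parts) =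
    ∑ᶠ (μ : Partn) (_ : μ.LengthLE k),
      (((∑ᶠ (β : Partn) (_ : ∀ i, Even (β.conjParts i)), lrCoeff β μ l) : ℤ) : RatFn k) *
        spChar k μ.parts := by
  rw [GLSp.main_sum k l hl]
  simp only [GLSp.inner_sum k l hl]
  simp only [finsum_eq_if]
  rw [finsum_eq_sum_of_support_subset (s := GLSp.PP k l.weight)]
  · refine Finset.sum_congr rfl fun μ hμ => ?_
    rw [if_pos (GLSp.mem_PP.1 hμ).1, mul_comm, Int.cast_sum]
    congr 1
    refine Finset.sum_congr rfl fun β hβ => ?_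
    split_ifs
    · rw [GLSp.lrCoeff_cast' β μ l k hl, GLSp.lrL,
        if_pos ⟨(GLSp.mem_PP.1 hβ).1, (GLSp.mem_PP.1 hμ).1⟩, one_mul]
    · simp
  · intro μ hμ
    simp only [Function.mem_support, ne_eq] at hμ
    by_contra hc
    apply hμ
    rw [Finset.sum_eq_zero]
    · simp
    · intro β _
      split_ifs
      · by_contra h
        exact hc (GLSp.lr_support hl h).2
      · rfl
end

section
/- Let k be a positive integer and λ a partition with ℓ(λ) ≤ k. Then, in the field of fractions of ℚ[z_1,…,z_k]: s_λ(z_1²,…,z_k²,z_1^{−2},…,z_k^{−2},1) = Σ_{μ : ℓ(μ) ≤ k} (Σ_δ c^λ_{δμ}) so_μ(z_1,…,z_k), where the inner sum runs over all partitions δ with all parts even, and s_λ is the Schur polynomial in 2k+1 variables evaluated at z_1²,…,z_k²,z_1^{−2},…,z_k^{−2},1. This is the stable form of the branching rule GL(2k+1) ⊃ O(2k+1): {λ} → [λ/D] with D = ∏_{i≤j}(1 − x_i x_j)^{−1} = Σ_{δ even} {δ}. -/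
open MvPolynomial
open scoped Classical

/-! ### Jacobi-Trudi in an arbitrary commutative ring -/

/-- The generating series of complete homogeneous symmetric polynomials. -/
noncomputable def hgen {R : Type*} [CommRing R] {n : ℕ} (x : Fin n → R) : PowerSeries R :=
  ∏ l, PowerSeries.mk (fun m => x l ^ m)

lemma geom_mul {R : Type*} [CommRing R] (x : R) :
    PowerSeries.mk (fun m => x ^ m) * (1 - PowerSeries.C x * PowerSeries.X) = 1 := by
  ext m
  rw [mul_sub, mul_one, ← mul_assoc, mul_comm _ (PowerSeries.C x), mul_assoc]
  cases m with
  | zero => simp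
  | succ m =>
    simp [PowerSeries.coeff_succ_mul_X, pow_succ', PowerSeries.coeff_one]

lemma isLT_aux {R : Type*} [CommRing R] (n : ℕ) (M : Matrix (Fin n) (Fin n) R)
    (h : ∀ i j, i < j → M i j = 0) (h1 : ∀ i, M i i = 1) : M.det = 1 := by
  rw [Matrix.det_of_isLowerTriangular]
  · simp [h1]
  · intro i j hij
    exact h i j hij

/-- The Jacobi-Trudi matrix. -/
noncomputable def jtMat {R : Type*} [CommRing R] (n : ℕ) (f : PowerSeries R) (a : Fin n → ℕ) :
    Matrix (Fin n) (Fin n) R :=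
  Matrix.of fun r j => PowerSeries.coeff (a j) (PowerSeries.X ^ (n - 1 - (r : ℕ)) * f)

lemma hgen_coeff_zero {R : Type*} [CommRing R] {n : ℕ} (x : Fin n → R) :
    PowerSeries.constantCoeff (hgen x) = 1 := by
  simp [hgen, map_prod]

lemma jtMat_rho {R : Type*} [CommRing R] (n : ℕ) (f : PowerSeries R)
    (hf : PowerSeries.constantCoeff f = 1) :
    (jtMat n f (fun j => n - 1 - (j : ℕ))).det = 1 := by
  apply isLT_aux
  · intro i j hij
    have h1 : (i : ℕ) < j := hij
    have h2 := j.isLt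
    simp only [jtMat, Matrix.of_apply, PowerSeries.coeff_X_pow_mul']
    rw [if_neg (by omega)]
  · intro i
    simp only [jtMat, Matrix.of_apply, PowerSeries.coeff_X_pow_mul']
    simp [hf]

lemma prod_erase_poly {R : Type*} [CommRing R] {n : ℕ} (x : Fin n → R) (i : Fin n) :
    ∃ b : Fin n → R, (∏ l ∈ Finset.univ.erase i, (1 - PowerSeries.C (x l) * PowerSeries.X)) =
      ∑ r : Fin n, PowerSeries.C (b r) * PowerSeries.X ^ (n - 1 - (r : ℕ)) := by
  set p : Polynomial R := ∏ l ∈ Finset.univ.erase i, (1 - Polynomial.C (x l) * Polynomial.X) with hp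
  have hn := i.isLt
  have hdeg : p.natDegree < n := by
    have h1 : p.natDegree ≤ ∑ l ∈ Finset.univ.erase i, 1 := by
      refine (Polynomial.natDegree_prod_le _ _).trans (Finset.sum_le_sum ?_)
      intro l _
      refine (Polynomial.natDegree_sub_le _ _).trans ?_
      simp only [Polynomial.natDegree_one, zero_le, sup_of_le_right]
      exact (Polynomial.natDegree_C_mul_le _ _).trans Polynomial.natDegree_X_le
    simp at h1
    omega
  refine ⟨fun r => p.coeff (n - 1 - r), ?_⟩
  have h2 : (∏ l ∈ Finset.univ.erase i, (1 - PowerSeries.C (x l) * PowerSeries.X)) =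
      (p : PowerSeries R) := by
    rw [hp, ← Polynomial.coeToPowerSeries.ringHom_apply, map_prod]
    simp
  rw [h2, Fin.sum_univ_eq_sum_range
    (fun m => PowerSeries.C (p.coeff (n-1-m)) * PowerSeries.X ^ (n-1-m)) n,
    Finset.sum_range_reflect (fun m => PowerSeries.C (p.coeff m) * PowerSeries.X ^ m) n]
  conv_lhs => rw [p.as_sum_range' n hdeg]
  rw [← Polynomial.coeToPowerSeries.ringHom_apply, map_sum]
  refine Finset.sum_congr rfl fun m _ => ?_
  rw [← Polynomial.C_mul_X_pow_eq_monomial]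
  simp

theorem jacobi_trudi {R : Type*} [CommRing R] {n : ℕ} (x : Fin n → R) (a : Fin n → ℕ) :
    (Matrix.of fun i j : Fin n => x i ^ a j).det =
      (jtMat n (hgen x) a).det * (Matrix.of fun i j : Fin n => x i ^ (n - 1 - (j : ℕ))).det := by
  choose b hb using fun i => prod_erase_poly x i
  have key : ∀ (i : Fin n) (m : ℕ), x i ^ m =
      ∑ r : Fin n, b i r * PowerSeries.coeff m (PowerSeries.X ^ (n - 1 - (r : ℕ)) * hgen x) := by
    intro i m
    have h1 : PowerSeries.mk (fun m => x i ^ m) =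
        hgen x * ∏ l ∈ Finset.univ.erase i, (1 - PowerSeries.C (x l) * PowerSeries.X) := by
      rw [hgen, ← Finset.mul_prod_erase _ _ (Finset.mem_univ i), mul_assoc,
        ← Finset.prod_mul_distrib]
      simp [geom_mul]
    have h2 := congrArg (PowerSeries.coeff m) h1
    rw [PowerSeries.coeff_mk, hb] at h2
    rw [h2, Finset.mul_sum, map_sum]
    refine Finset.sum_congr rfl fun r _ => ?_
    rw [← PowerSeries.coeff_C_mul]
    congr 1
    ring
  have mm : ∀ a : Fin n → ℕ, (Matrix.of fun i j : Fin n => x i ^ a j) =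
      Matrix.of b * jtMat n (hgen x) a := by
    intro a
    ext i j
    simp only [Matrix.mul_apply, Matrix.of_apply, jtMat]
    exact key i (a j)
  rw [mm a, mm (fun j => n - 1 - (j : ℕ)), Matrix.det_mul, Matrix.det_mul,
    jtMat_rho _ _ (hgen_coeff_zero x)]
  ring

lemma det_rho {R : Type*} [CommRing R] {n : ℕ} (x : Fin n → R) :
    (Matrix.of fun i j : Fin n => x i ^ (n - 1 - (j : ℕ))).det =
      ∏ i : Fin n, ∏ j ∈ Finset.Ioi i, (x i - x j) := by
  have h := Matrix.det_projVandermonde (1 : Fin n → R) x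
  simp only [Pi.one_apply, one_mul] at h
  rw [← h]
  congr 1
  ext i j
  simp only [Matrix.of_apply, Matrix.projVandermonde_apply, Pi.one_apply, one_pow, one_mul]
  congr 1
  rw [Fin.val_rev]; omega

/-! ### Schur polynomials -/

lemma vandermondeP_ne_zero (n : ℕ) : vandermondeP n ≠ 0 := by
  rw [vandermondeP, det_rho]
  refine Finset.prod_ne_zero_iff.2 fun i _ => Finset.prod_ne_zero_iff.2 fun j hj => ?_
  rw [Finset.mem_Ioi] at hj
  rw [sub_ne_zero]
  intro h
  exact hj.ne (X_injective h)

noncomputable def expo (n : ℕ) (l : ℕ → ℕ) : Fin n → ℕ := fun j => l j + (n - 1 - (j : ℕ))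

lemma schur_eq (n : ℕ) (l : ℕ → ℕ) :
    schur n l = (jtMat n (hgen (X : Fin n → MvPolynomial (Fin n) ℤ)) (expo n l)).det := by
  have h : ∃ q : MvPolynomial (Fin n) ℤ, q * vandermondeP n = alternant n l :=
    ⟨_, (jacobi_trudi (X : Fin n → MvPolynomial (Fin n) ℤ) (expo n l)).symm⟩
  rw [schur, dif_pos h]
  have h1 := h.choose_spec
  apply mul_right_cancel₀ (vandermondeP_ne_zero n)
  rw [h1]
  exact jacobi_trudi (X : Fin n → MvPolynomial (Fin n) ℤ) (expo n l)

lemma schur_mul (n : ℕ) (l : ℕ → ℕ) : schur n l * vandermondeP n = alternant n l := by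
  rw [schur_eq]
  exact (jacobi_trudi (X : Fin n → MvPolynomial (Fin n) ℤ) (expo n l)).symm

lemma hgen_map {R S : Type*} [CommRing R] [CommRing S] {n : ℕ} (x : Fin n → R) (f : R →+* S) :
    PowerSeries.map f (hgen x) = hgen (fun i => f (x i)) := by
  simp only [hgen, map_prod]
  refine Finset.prod_congr rfl fun l _ => ?_
  ext m
  simp

lemma jtMat_map {R S : Type*} [CommRing R] [CommRing S] {n : ℕ} (g : PowerSeries R) (a : Fin n → ℕ)
    (f : R →+* S) : f (jtMat n g a).det = (jtMat n (PowerSeries.map f g) a).det := by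
  rw [RingHom.map_det]
  congr 1
  ext i j
  simp only [jtMat, RingHom.mapMatrix_apply, Matrix.map_apply, Matrix.of_apply,
    PowerSeries.coeff_X_pow_mul', PowerSeries.coeff_map]
  split_ifs <;> simp

lemma schur_aeval {S : Type*} [CommRing S] (n : ℕ) (l : ℕ → ℕ) (y : Fin n → S) :
    MvPolynomial.aeval y (schur n l) = (jtMat n (hgen y) (expo n l)).det := by
  have h := jtMat_map (hgen (X : Fin n → MvPolynomial (Fin n) ℤ)) (expo n l)
    (MvPolynomial.aeval y : MvPolynomial (Fin n) ℤ →ₐ[ℤ] S).toRingHom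
  rw [schur_eq]
  rw [hgen_map] at h
  simpa using h

/-- reduction of the size of the Jacobi-Trudi determinant -/
lemma jtMat_succ {R : Type*} [CommRing R] (n : ℕ) (f : PowerSeries R)
    (hf : PowerSeries.constantCoeff f = 1) (l : ℕ → ℕ) (hl : l n = 0) :
    (jtMat (n+1) f (expo (n+1) l)).det = (jtMat n f (expo n l)).det := by
  rw [Matrix.det_succ_column _ (Fin.last n), Fin.sum_univ_castSucc, Finset.sum_eq_zero]
  · rw [zero_add]
    have h1 : jtMat (n+1) f (expo (n+1) l) (Fin.last n) (Fin.last n) = 1 := by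
      simp [jtMat, expo, hl, hf]
    rw [h1]
    have h2 : (jtMat (n+1) f (expo (n+1) l)).submatrix (Fin.last n).succAbove (Fin.last n).succAbove
        = jtMat n f (expo n l) := by
      ext i j
      have := i.isLt
      have := j.isLt
      simp only [jtMat, expo, Matrix.submatrix_apply, Matrix.of_apply, Fin.succAbove_last,
        Fin.val_castSucc, PowerSeries.coeff_X_pow_mul']
      have e1 : (n + 1 - 1 - (i:ℕ) ≤ l j + (n + 1 - 1 - (j:ℕ))) ↔
        (n - 1 - (i:ℕ) ≤ l j + (n - 1 - (j:ℕ))) := by omega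
      have e2 : l j + (n + 1 - 1 - (j:ℕ)) - (n + 1 - 1 - (i:ℕ))
        = l j + (n - 1 - (j:ℕ)) - (n - 1 - (i:ℕ)) := by omega
      simp only [e1, e2]
    rw [h2]
    simp
  · intro i _
    have h1 : jtMat (n+1) f (expo (n+1) l) i.castSucc (Fin.last n) = 0 := by
      have := i.isLt
      simp only [jtMat, expo, Matrix.of_apply, PowerSeries.coeff_X_pow_mul', Fin.val_last,
        Fin.val_castSucc, hl]
      rw [if_neg (by omega)]
    rw [h1]
    simp

lemma jtMat_stable {R : Type*} [CommRing R] (k n : ℕ) (f : PowerSeries R)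
    (hf : PowerSeries.constantCoeff f = 1) (l : ℕ → ℕ) (hl : ∀ i, k ≤ i → l i = 0) (hkn : k ≤ n) :
    (jtMat n f (expo n l)).det = (jtMat k f (expo k l)).det := by
  induction n, hkn using Nat.le_induction with
  | base => rfl
  | succ m hm ih => rw [jtMat_succ m f hf l (hl m hm), ih]


/-! ### Weights -/

lemma weight_eq (p : Partn) (N : ℕ) (h : p.LengthLE N) :
    p.weight = ∑ i : Fin N, p.parts i := by
  rw [Partn.weight, Fin.sum_univ_eq_sum_range (fun i => p.parts i)]
  apply finsum_eq_sum_of_support_subset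
  intro i hi
  rw [Function.mem_support] at hi
  simp only [Finset.coe_range, Set.mem_Iio]
  by_contra hc
  exact hi (h i (by omega))

lemma lengthLE_mono (p : Partn) {m n : ℕ} (h : p.LengthLE m) (hmn : m ≤ n) : p.LengthLE n :=
  fun i hi => h i (hmn.trans hi)

lemma lengthLE_weight (p : Partn) : p.LengthLE p.weight := by
  obtain ⟨N, hN⟩ := p.eventually_zero
  intro i hi
  by_contra hc
  have h1 := weight_eq p (N + i + 1) (fun j hj => hN j (by omega))
  have h2 : (i + 1) ≤ ∑ j : Fin (N+i+1), p.parts j := by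
    rw [Fin.sum_univ_eq_sum_range (fun i => p.parts i)]
    calc i + 1 = ∑ j ∈ Finset.range (i+1), 1 := by simp
      _ ≤ ∑ j ∈ Finset.range (i+1), p.parts j := by
        refine Finset.sum_le_sum fun j hj => ?_
        have := p.antitone j i (by simp at hj; omega)
        omega
      _ ≤ _ := by
        refine Finset.sum_le_sum_of_subset ?_
        intro j hj
        simp at *
        omega
  omega

lemma parts_le_weight (p : Partn) (i : ℕ) : p.parts i ≤ p.weight := by
  by_cases hi : i < p.weight
  · rw [weight_eq p _ (lengthLE_weight p)]
    exact Finset.single_le_sum (f := fun j : Fin p.weight => p.parts j) (fun _ _ => Nat.zero_le _)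
      (Finset.mem_univ (⟨i, hi⟩ : Fin p.weight))
  · rw [lengthLE_weight p i (by omega)]
    omega

/-! ### Setting the last variable to zero -/

noncomputable def killLast (n : ℕ) : MvPolynomial (Fin (n+1)) ℤ →ₐ[ℤ] MvPolynomial (Fin n) ℤ :=
  MvPolynomial.aeval (Fin.snoc (α := fun _ => MvPolynomial (Fin n) ℤ) (fun i => X i) 0)

lemma killLast_X_castSucc (n : ℕ) (i : Fin n) : killLast n (X i.castSucc) = X i := by
  simp [killLast]

lemma killLast_X_last (n : ℕ) : killLast n (X (Fin.last n)) = 0 := by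
  simp [killLast]

noncomputable def fexp {n : ℕ} (a : Fin n → ℕ) : Fin n →₀ ℕ := Finsupp.equivFunOnFinite.symm a

@[simp] lemma fexp_apply {n : ℕ} (a : Fin n → ℕ) (i : Fin n) : fexp a i = a i := rfl

lemma killLast_coeff (n : ℕ) (p : MvPolynomial (Fin (n+1)) ℤ) (a : Fin (n+1) → ℕ)
    (ha : a (Fin.last n) = 0) :
    MvPolynomial.coeff (fexp a) p =
      MvPolynomial.coeff (fexp fun i : Fin n => a i.castSucc) (killLast n p) := by
  induction p using MvPolynomial.induction_on' with
  | add p q hp hq => rw [map_add, coeff_add, coeff_add, hp, hq]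
  | monomial u c =>
    rw [killLast, aeval_monomial, Finsupp.prod_fintype _ _ (by simp), Fin.prod_univ_castSucc]
    simp only [Fin.snoc_castSucc, Fin.snoc_last]
    by_cases hu : u (Fin.last n) = 0
    · rw [hu, pow_zero, mul_one]
      have h1 : (algebraMap ℤ (MvPolynomial (Fin n) ℤ)) c *
          ∏ i : Fin n, (X i : MvPolynomial (Fin n) ℤ) ^ u i.castSucc =
          monomial (fexp fun i : Fin n => u i.castSucc) c := by
        rw [monomial_eq, Finsupp.prod_fintype _ _ (by simp)]
        simp
      rw [h1, coeff_monomial, coeff_monomial]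
      congr 1
      rw [eq_iff_iff]
      constructor
      · rintro rfl
        rfl
      · intro h
        ext i
        refine Fin.lastCases ?_ (fun j => ?_) i
        · simp [hu, ha]
        · have := DFunLike.congr_fun h j
          simpa using this
    · rw [zero_pow hu, mul_zero, mul_zero, coeff_zero, coeff_monomial, if_neg]
      rintro rfl
      exact hu ha

lemma killLast_alternant_zero (n : ℕ) (l : ℕ → ℕ) (hl : l n ≠ 0) :
    killLast n (alternant (n+1) l) = 0 := by
  rw [alternant, AlgHom.map_det]
  apply Matrix.det_eq_zero_of_row_eq_zero (Fin.last n)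
  intro j
  have := j.isLt
  simp only [AlgHom.mapMatrix_apply, Matrix.map_apply, Matrix.of_apply, map_pow, killLast_X_last]
  apply zero_pow
  by_cases hj : (j : ℕ) = n
  · rw [hj]; omega
  · omega

lemma killLast_alternant (n : ℕ) (l : ℕ → ℕ) (hl : l n = 0) :
    killLast n (alternant (n+1) l) = (∏ i, X i) * alternant n l := by
  rw [alternant, AlgHom.map_det, Matrix.det_succ_row _ (Fin.last n), Fin.sum_univ_castSucc,
    Finset.sum_eq_zero]
  · rw [zero_add, alternant, ← Matrix.det_mul_column]
    simp only [AlgHom.mapMatrix_apply, Matrix.map_apply, Matrix.of_apply, map_pow, killLast_X_last,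
      Fin.val_last, hl, Fin.succAbove_last]
    simp only [add_tsub_cancel_right, tsub_self, add_zero, pow_zero, mul_one]
    rw [Even.neg_one_pow ⟨n, rfl⟩, one_mul]
    congr 1
    ext1 i j
    have := j.isLt
    simp only [Matrix.submatrix_apply, Matrix.map_apply, Matrix.of_apply, map_pow,
      killLast_X_castSucc, Fin.val_castSucc, ← pow_succ']
    congr 1
    omega
  · intro j _
    have := j.isLt
    simp only [AlgHom.mapMatrix_apply, Matrix.map_apply, Matrix.of_apply, map_pow, killLast_X_last,
      Fin.val_castSucc]
    rw [zero_pow (by omega)]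
    simp

lemma vandermondeP_eq (n : ℕ) : vandermondeP n = alternant n (fun _ => 0) := by
  simp [vandermondeP, alternant]

lemma killLast_vandermonde (n : ℕ) :
    killLast n (vandermondeP (n+1)) = (∏ i, X i) * vandermondeP n := by
  rw [vandermondeP_eq, vandermondeP_eq, killLast_alternant _ _ rfl]

lemma prodX_ne_zero (n : ℕ) : (∏ i, X i : MvPolynomial (Fin n) ℤ) ≠ 0 :=
  Finset.prod_ne_zero_iff.2 fun i _ => X_ne_zero i

lemma killLast_schur (n : ℕ) (l : ℕ → ℕ) (hl : l n = 0) :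
    killLast n (schur (n+1) l) = schur n l := by
  have h := congrArg (killLast n) (schur_mul (n+1) l)
  rw [map_mul, killLast_vandermonde, killLast_alternant _ _ hl, ← schur_mul n l] at h
  apply mul_right_cancel₀ (mul_ne_zero (prodX_ne_zero n) (vandermondeP_ne_zero n))
  rw [h]; ring

lemma killLast_schur_zero (n : ℕ) (l : ℕ → ℕ) (hl : l n ≠ 0) :
    killLast n (schur (n+1) l) = 0 := by
  have h := congrArg (killLast n) (schur_mul (n+1) l)
  rw [map_mul, killLast_vandermonde, killLast_alternant_zero _ _ hl] at h
  exact (mul_eq_zero.1 h).resolve_right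
    (mul_ne_zero (prodX_ne_zero n) (vandermondeP_ne_zero n))

/-! ### Littlewood-Richardson coefficients in `n` variables -/

noncomputable def lrN (n : ℕ) (d m l : Partn) : ℤ :=
  if d.LengthLE n ∧ m.LengthLE n then
    MvPolynomial.coeff (fexp (expo n l.parts))
      (schur n d.parts * schur n m.parts * vandermondeP n)
  else 0

lemma coeff_step (n : ℕ) (l : Partn) (hl : l.LengthLE n) (p : MvPolynomial (Fin (n+1)) ℤ) :
    MvPolynomial.coeff (fexp (expo (n+1) l.parts)) (p * vandermondeP (n+1)) =
      MvPolynomial.coeff (fexp (expo n l.parts)) (killLast n p * vandermondeP n) := by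
  rw [killLast_coeff _ _ _ (by simp [expo, hl n le_rfl]), map_mul, killLast_vandermonde]
  have h1 : (fexp fun i : Fin n => expo (n+1) l.parts i.castSucc) =
      fexp (fun _ : Fin n => 1) + fexp (expo n l.parts) := by
    ext i
    have := i.isLt
    simp [expo]
    omega
  have h2 : (∏ i, X i : MvPolynomial (Fin n) ℤ) = monomial (fexp (fun _ : Fin n => 1)) 1 := by
    rw [monomial_eq, Finsupp.prod_fintype _ _ (by simp)]
    simp
  rw [h1, h2, mul_left_comm, coeff_monomial_mul, one_mul]

lemma lengthLE_succ_iff (n : ℕ) (d : Partn) : d.LengthLE n ↔ d.LengthLE (n+1) ∧ d.parts n = 0 := by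
  constructor
  · intro h
    exact ⟨lengthLE_mono d h (Nat.le_succ n), h n le_rfl⟩
  · rintro ⟨h1, h2⟩ i hi
    have := d.antitone n i hi
    omega

lemma lrN_succ (n : ℕ) (d m l : Partn) (hl : l.LengthLE n) :
    lrN (n+1) d m l = lrN n d m l := by
  unfold lrN
  rw [coeff_step n l hl, map_mul]
  by_cases hd : d.parts n = 0
  · by_cases hm : m.parts n = 0
    · rw [killLast_schur _ _ hd, killLast_schur _ _ hm]
      simp [lengthLE_succ_iff n, hd, hm]
    · rw [killLast_schur_zero _ _ hm]
      simp [lengthLE_succ_iff n m, hm]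
  · rw [killLast_schur_zero _ _ hd]
    simp [lengthLE_succ_iff n d, hd]

lemma lrN_stable (n N : ℕ) (h : n ≤ N) (d m l : Partn) (hl : l.LengthLE n) :
    lrN N d m l = lrN n d m l := by
  induction N, h using Nat.le_induction with
  | base => rfl
  | succ M hM ih => rw [lrN_succ M d m l (lengthLE_mono l hl hM), ih]

/-! ### Homogeneity -/

lemma hgen_coeff_hom (n m : ℕ) :
    (PowerSeries.coeff m (hgen (X : Fin n → MvPolynomial (Fin n) ℤ))).IsHomogeneous m := by
  rw [hgen, PowerSeries.coeff_prod]
  refine IsHomogeneous.sum _ _ _ fun l hl => ?_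
  rw [Finset.mem_finsuppAntidiag] at hl
  rw [← hl.1]
  refine IsHomogeneous.prod _ _ _ fun i _ => ?_
  rw [PowerSeries.coeff_mk]
  simpa using (isHomogeneous_X ℤ i).pow (l i)

lemma schur_hom (n : ℕ) (l : ℕ → ℕ) : (schur n l).IsHomogeneous (∑ j : Fin n, l j) := by
  rw [schur_eq, Matrix.det_apply]
  refine IsHomogeneous.sum _ _ _ fun σ _ => ?_
  have key : (∏ i, jtMat n (hgen (X : Fin n → MvPolynomial (Fin n) ℤ)) (expo n l) (σ i) i).IsHomogeneous
      (∑ j : Fin n, l j) := by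
    by_cases h : ∀ i, n - 1 - (σ i : ℕ) ≤ expo n l i
    · have h1 : ∑ j : Fin n, l j = ∑ i, (expo n l i - (n - 1 - (σ i : ℕ))) := by
        have h2 : ∑ i, (expo n l i - (n - 1 - (σ i : ℕ))) + ∑ i, (n - 1 - (σ i : ℕ)) =
            ∑ i, expo n l i := by
          rw [← Finset.sum_add_distrib]
          exact Finset.sum_congr rfl fun i _ => Nat.sub_add_cancel (h i)
        rw [Equiv.sum_comp σ (fun i : Fin n => n - 1 - (i : ℕ))] at h2
        have h3 : ∑ i, expo n l i = ∑ j : Fin n, l j + ∑ i : Fin n, (n - 1 - (i : ℕ)) := by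
          rw [← Finset.sum_add_distrib]
          rfl
        omega
      rw [h1]
      refine IsHomogeneous.prod _ _ _ fun i _ => ?_
      simp only [jtMat, Matrix.of_apply, PowerSeries.coeff_X_pow_mul', if_pos (h i)]
      exact hgen_coeff_hom _ _
    · push Not at h
      obtain ⟨i, hi⟩ := h
      rw [Finset.prod_eq_zero (Finset.mem_univ i)]
      · exact isHomogeneous_zero _ _ _
      · simp only [jtMat, Matrix.of_apply, PowerSeries.coeff_X_pow_mul']
        rw [if_neg (by omega)]
  rcases Int.units_eq_one_or (Equiv.Perm.sign σ) with h | h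
  · rw [h, one_smul]; exact key
  · rw [h, Units.neg_smul, one_smul]; exact key.neg

lemma vandermonde_hom (n : ℕ) :
    (vandermondeP n).IsHomogeneous (∑ j : Fin n, (n - 1 - (j : ℕ))) := by
  rw [vandermondeP, Matrix.det_apply]
  refine IsHomogeneous.sum _ _ _ fun σ _ => ?_
  have key : (∏ i, (Matrix.of fun i j : Fin n =>
    (X i : MvPolynomial (Fin n) ℤ) ^ (n - 1 - (j : ℕ))) (σ i) i).IsHomogeneous
      (∑ j : Fin n, (n - 1 - (j : ℕ))) := by
    refine IsHomogeneous.prod _ _ _ fun i _ => ?_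
    simpa using (isHomogeneous_X ℤ (σ i)).pow (n - 1 - (i : ℕ))
  rcases Int.units_eq_one_or (Equiv.Perm.sign σ) with h | h
  · rw [h, one_smul]; exact key
  · rw [h, Units.neg_smul, one_smul]; exact key.neg

lemma lrN_weight (n : ℕ) (d m l : Partn) (hl : l.LengthLE n) (h : lrN n d m l ≠ 0) :
    l.weight = d.weight + m.weight := by
  unfold lrN at h
  split_ifs at h with hc
  · have h1 := (((schur_hom n d.parts).mul (schur_hom n m.parts)).mul (vandermonde_hom n)) h
    rw [← weight_eq d n hc.1, ← weight_eq m n hc.2] at h1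
    have h2 : Finsupp.weight 1 (fexp (expo n l.parts)) = l.weight + ∑ j : Fin n, (n - 1 - (j : ℕ)) := by
      rw [weight_eq l n hl, ← Finset.sum_add_distrib, Finsupp.weight_apply,
        Finsupp.sum_fintype _ _ (by simp)]
      simp [expo]
    omega
  · exact absurd rfl h

lemma lrCoeff_eq (n : ℕ) (d m l : Partn) (hl : l.LengthLE n) :
    lrCoeff d m l = lrN n d m l := by
  by_cases hw : l.weight = d.weight + m.weight
  · have h1 : lrCoeff d m l = lrN (d.weight + m.weight) d m l := by
      rw [lrCoeff, if_pos hw, lrN, if_pos ⟨lengthLE_mono d (lengthLE_weight d) (by omega),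
        lengthLE_mono m (lengthLE_weight m) (by omega)⟩]
      rfl
    rw [h1, ← hw]
    rcases le_total n l.weight with h | h
    · exact lrN_stable _ _ h _ _ _ hl
    · exact (lrN_stable _ _ h _ _ _ (lengthLE_weight l)).symm
  · rw [lrCoeff, if_neg hw]
    by_contra hc
    exact hw (lrN_weight n d m l hl (Ne.symm hc))


/-! ### Products of one-variable series in distinct variables -/

noncomputable def qser {K : Type} [CommRing K] {k : ℕ} (f : Fin k → PowerSeries K) :
    MvPowerSeries (Fin k) K := fun e => ∏ j, PowerSeries.coeff (e j) (f j)

lemma coeff_qser {K : Type} [CommRing K] {k : ℕ} (f : Fin k → PowerSeries K) (e : Fin k →₀ ℕ) :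
    MvPowerSeries.coeff e (qser f) = ∏ j, PowerSeries.coeff (e j) (f j) := rfl

lemma qser_mul {K : Type} [CommRing K] {k : ℕ} (f g : Fin k → PowerSeries K) :
    qser (f * g) = qser f * qser g := by
  ext e
  rw [MvPowerSeries.coeff_mul, coeff_qser]
  simp only [coeff_qser, Pi.mul_apply, PowerSeries.coeff_mul]
  rw [Finset.prod_univ_sum]
  refine Finset.sum_bij' (fun p _ => (fexp fun j => (p j).1, fexp fun j => (p j).2))
    (fun q _ => fun j => (q.1 j, q.2 j)) ?_ ?_ ?_ ?_ ?_
  · intro p hp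
    rw [Fintype.mem_piFinset] at hp
    rw [Finset.HasAntidiagonal.mem_antidiagonal]
    ext j
    have := hp j
    rw [Finset.HasAntidiagonal.mem_antidiagonal] at this
    simpa using this
  · intro q hq
    rw [Finset.HasAntidiagonal.mem_antidiagonal] at hq
    rw [Fintype.mem_piFinset]
    intro j
    rw [Finset.HasAntidiagonal.mem_antidiagonal, ← hq]
    rfl
  · intro p hp
    rfl
  · intro q hq
    refine Prod.ext ?_ ?_
    · ext j; rfl
    · ext j; rfl
  · intro p hp
    simp [Finset.prod_mul_distrib]

lemma qser_one {K : Type} [CommRing K] {k : ℕ} : qser (1 : Fin k → PowerSeries K) = 1 := by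
  ext e
  rw [coeff_qser, MvPowerSeries.coeff_one]
  simp only [Pi.one_apply, PowerSeries.coeff_one]
  split_ifs with h
  · subst h; simp
  · obtain ⟨j, hj⟩ : ∃ j, e j ≠ 0 := by
      by_contra hc
      push Not at hc
      exact h (Finsupp.ext hc)
    exact Finset.prod_eq_zero (Finset.mem_univ j) (if_neg hj)

noncomputable def qHom (K : Type) [CommRing K] (k : ℕ) :
    (Fin k → PowerSeries K) →* MvPowerSeries (Fin k) K where
  toFun := qser
  map_one' := qser_one
  map_mul' := qser_mul

lemma coeff_qser_single {K : Type} [CommRing K] {k : ℕ} (j : Fin k) (f : PowerSeries K)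
    (e : Fin k →₀ ℕ) : MvPowerSeries.coeff e (qser (Pi.mulSingle j f)) =
    PowerSeries.coeff (e j) f * ∏ l ∈ Finset.univ.erase j, PowerSeries.coeff (e l) (1 : PowerSeries K) := by
  rw [coeff_qser, ← Finset.mul_prod_erase _ _ (Finset.mem_univ j), Pi.mulSingle_eq_same]
  congr 1
  refine Finset.prod_congr rfl fun l hl => ?_
  rw [Pi.mulSingle_eq_of_ne (Finset.ne_of_mem_erase hl)]

noncomputable def iota {K : Type} [CommRing K] {k : ℕ} (j : Fin k) :
    PowerSeries K →+* MvPowerSeries (Fin k) K where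
  toFun f := qser (Pi.mulSingle j f)
  map_one' := by rw [Pi.mulSingle_one]; exact qser_one
  map_mul' f g := by rw [Pi.mulSingle_mul]; exact qser_mul _ _
  map_zero' := by
    ext e
    rw [coeff_qser_single]; simp
  map_add' f g := by
    ext e
    rw [map_add, coeff_qser_single, coeff_qser_single, coeff_qser_single, map_add, add_mul]

lemma coeff_iota {K : Type} [CommRing K] {k : ℕ} (j : Fin k) (f : PowerSeries K)
    (e : Fin k →₀ ℕ) : MvPowerSeries.coeff e (iota j f) =
    PowerSeries.coeff (e j) f * ∏ l ∈ Finset.univ.erase j, PowerSeries.coeff (e l) (1 : PowerSeries K) :=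
  coeff_qser_single j f e

lemma prod_iota {K : Type} [CommRing K] {k : ℕ} (f : Fin k → PowerSeries K) :
    ∏ j, iota j (f j) = qser f := by
  have h := map_prod (qHom K k) (fun j => (Pi.mulSingle j (f j) : Fin k → PowerSeries K)) Finset.univ
  rw [Finset.univ_prod_mulSingle] at h
  exact h.symm

lemma coeff_prod_iota {K : Type} [CommRing K] {k : ℕ} (f : Fin k → PowerSeries K) (e : Fin k →₀ ℕ) :
    MvPowerSeries.coeff e (∏ j, iota j (f j)) = ∏ j, PowerSeries.coeff (e j) (f j) := by
  rw [prod_iota, coeff_qser]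

lemma iota_C {K : Type} [CommRing K] {k : ℕ} (j : Fin k) (a : K) :
    iota j (PowerSeries.C a) = MvPowerSeries.C a := by
  ext e
  rw [coeff_iota, MvPowerSeries.coeff_C]
  simp only [PowerSeries.coeff_C, PowerSeries.coeff_one]
  split_ifs with h1 h2 h2
  · subst h2; simp
  · obtain ⟨l, hl⟩ : ∃ j, e j ≠ 0 := by
      by_contra hc
      push Not at hc
      exact h2 (Finsupp.ext hc)
    rw [Finset.prod_eq_zero (i := l), mul_zero]
    · rw [Finset.mem_erase]
      exact ⟨by rintro rfl; exact hl h1, Finset.mem_univ _⟩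
    · exact if_neg hl
  · subst h2; simp at h1
  · simp

lemma iota_X {K : Type} [CommRing K] {k : ℕ} (j : Fin k) :
    iota j (PowerSeries.X : PowerSeries K) = MvPowerSeries.X j := by
  ext e
  rw [coeff_iota, MvPowerSeries.coeff_X]
  simp only [PowerSeries.coeff_X, PowerSeries.coeff_one]
  split_ifs with h1 h2 h2
  · subst h2
    rw [one_mul]
    refine Finset.prod_eq_one fun l hl => ?_
    rw [Finsupp.single_eq_of_ne (Finset.ne_of_mem_erase hl), if_pos rfl]
  · obtain ⟨l, hl, hlj⟩ : ∃ l, e l ≠ 0 ∧ l ≠ j := by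
      by_contra hc
      push Not at hc
      apply h2
      ext l
      by_cases h : l = j
      · subst h; simp [h1]
      · rw [Finsupp.single_eq_of_ne h]
        by_contra h'
        exact h (hc l h')
    rw [Finset.prod_eq_zero (i := l), mul_zero]
    · rw [Finset.mem_erase]
      exact ⟨hlj, Finset.mem_univ _⟩
    · exact if_neg hl
  · subst h2; simp at h1
  · simp

lemma coeff_det_iota {K : Type} [CommRing K] {k : ℕ} (f : Fin k → Fin k → PowerSeries K)
    (e : Fin k →₀ ℕ) :
    MvPowerSeries.coeff e (Matrix.of fun i j => iota j (f i j)).det =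
      (Matrix.of fun i j => PowerSeries.coeff (e j) (f i j)).det := by
  rw [Matrix.det_apply, Matrix.det_apply, map_sum]
  refine Finset.sum_congr rfl fun σ _ => ?_
  simp only [Matrix.of_apply]
  rcases Int.units_eq_one_or (Equiv.Perm.sign σ) with h | h
  · rw [h, one_smul, one_smul, coeff_prod_iota]
  · rw [h, Units.neg_smul, one_smul, Units.neg_smul, one_smul, map_neg, coeff_prod_iota]

/-! ### The numerator series `Φ` -/

noncomputable def aRho (K : Type) [CommRing K] (k : ℕ) : MvPowerSeries (Fin k) K :=
  (Matrix.of fun i j : Fin k => (MvPowerSeries.X i : MvPowerSeries (Fin k) K) ^ (k - 1 - (j : ℕ))).det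

lemma coeff_Phi {K : Type} [CommRing K] {k : ℕ} (H : PowerSeries K) (e : Fin k →₀ ℕ) :
    MvPowerSeries.coeff e (aRho K k * ∏ j, iota j H) = (jtMat k H e).det := by
  have h : aRho K k * ∏ j, iota j H =
      (Matrix.of fun i j : Fin k => iota j (PowerSeries.X ^ (k - 1 - (i : ℕ)) * H)).det := by
    rw [aRho, ← Matrix.det_transpose, mul_comm, ← Matrix.det_mul_row]
    congr 1
    ext1 i j
    simp only [Matrix.of_apply, Matrix.transpose_apply, map_mul, map_pow, iota_X]
    ring
  rw [h, coeff_det_iota]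
  rfl

/-! ### Alternating functions of exponents -/

def AltF {K : Type} [CommRing K] {k : ℕ} (f : (Fin k → ℕ) → K) : Prop :=
  (∀ e, ¬ Function.Injective e → f e = 0) ∧
  (∀ e (σ : Equiv.Perm (Fin k)), f (e ∘ σ) = (Equiv.Perm.sign σ : ℤ) * f e)

lemma altF_det {K : Type} [CommRing K] {k : ℕ} (g : Fin k → ℕ → K) :
    AltF (fun e : Fin k → ℕ => (Matrix.of fun i j : Fin k => g i (e j)).det) := by
  constructor
  · intro e he
    rw [Function.not_injective_iff] at he
    obtain ⟨a, b, hab, hne⟩ := he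
    refine Matrix.det_zero_of_column_eq hne fun i => ?_
    simp [hab]
  · intro e σ
    have := Matrix.det_permute' σ (Matrix.of fun i j : Fin k => g i (e j))
    simpa [Matrix.submatrix] using this

lemma inj_le_rho {k : ℕ} (e : Fin k → ℕ) (he : Function.Injective e)
    (hle : ∀ j : Fin k, e j ≤ k - 1 - (j : ℕ)) : ∀ j : Fin k, e j = k - 1 - (j : ℕ) := by
  have key : ∀ m : ℕ, ∀ j : Fin k, k - 1 - (j : ℕ) = m → e j = m := by
    intro m
    induction m using Nat.strong_induction_on with
    | _ m ih =>
      intro j hj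
      have h1 := hle j
      by_contra hc
      have h2 : e j < m := by omega
      have hjk := j.isLt
      have h3 := ih (e j) h2 ⟨k - 1 - e j, by omega⟩ (by simp; omega)
      have h4 := he h3
      have h5 := congrArg Fin.val h4
      simp at h5
      omega
  exact fun j => key _ j rfl

lemma coeff_rho_mul {K : Type} [CommRing K] {k : ℕ} (A B : MvPowerSeries (Fin k) K)
    (f : (Fin k → ℕ) → K) (hf : AltF f) (hB : ∀ e, MvPowerSeries.coeff e B = f e) :
    MvPowerSeries.coeff (fexp fun j : Fin k => k - 1 - (j : ℕ)) (A * B) =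
      MvPowerSeries.coeff 0 A * f (fun j : Fin k => k - 1 - (j : ℕ)) := by
  rw [MvPowerSeries.coeff_mul, Finset.sum_eq_single (0, fexp fun j : Fin k => k - 1 - (j : ℕ))]
  · rw [hB]; rfl
  · rintro ⟨d, e⟩ h hne
    rw [Finset.HasAntidiagonal.mem_antidiagonal] at h
    simp only at h ⊢
    rw [hB]
    by_cases he : Function.Injective (e : Fin k → ℕ)
    · exfalso
      have h1 : ∀ j : Fin k, d j + e j = k - 1 - (j : ℕ) := fun j => DFunLike.congr_fun h j
      have h2 := inj_le_rho e he (fun j => by have := h1 j; omega)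
      apply hne
      ext j
      · have := h1 j
        have := h2 j
        simp; omega
      · have := h2 j
        simp; omega
    · rw [hf.1 _ he, mul_zero]
  · intro h
    exfalso
    apply h
    rw [Finset.HasAntidiagonal.mem_antidiagonal]
    simp

/-! ### The Cauchy identity for odd orthogonal characters -/

noncomputable def gser {K : Type} [Field K] (z : K) : PowerSeries K :=
  PowerSeries.mk fun m => z ^ ((2 * m + 1 : ℕ) : ℤ) - z ^ (-((2 * m + 1 : ℕ) : ℤ))

lemma gser_mul {K : Type} [Field K] (z : K) (hz : z ≠ 0) :
    gser z * ((1 - PowerSeries.C (z ^ 2) * PowerSeries.X) *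
      (1 - PowerSeries.C (z⁻¹ ^ 2) * PowerSeries.X)) =
      PowerSeries.C (z - z⁻¹) * (1 + PowerSeries.X) := by
  have h1 : gser z = PowerSeries.C z * PowerSeries.mk (fun m => (z ^ 2) ^ m) -
      PowerSeries.C z⁻¹ * PowerSeries.mk (fun m => (z⁻¹ ^ 2) ^ m) := by
    ext m
    simp only [gser, PowerSeries.coeff_mk, map_sub, PowerSeries.coeff_C_mul]
    rw [zpow_neg, zpow_natCast, ← inv_pow]
    ring
  have h2 := geom_mul (z ^ 2)
  have h3 := geom_mul (z⁻¹ ^ 2)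
  have h4 : (PowerSeries.C z * PowerSeries.C z⁻¹ : PowerSeries K) = 1 := by
    rw [← map_mul, mul_inv_cancel₀ hz, map_one]
  rw [h1]
  have h5 : ∀ (A B a b x y u v : PowerSeries K), A * a = 1 → B * b = 1 →
      (x * A - y * B) * (a * b) = x * b - y * a := by
    intro A B a b x y u v h h'
    linear_combination x * b * h - y * a * h'
  rw [h5 _ _ _ _ _ _ 1 1 h2 h3]
  simp only [map_sub, map_pow]
  linear_combination (-PowerSeries.C z⁻¹ * PowerSeries.X + PowerSeries.C z * PowerSeries.X) * h4

lemma prod_hom_expand {K : Type} [Field K] {ι : Type} (S : Finset ι) (u : ι → K) :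
    ∃ b : ℕ → K, ∀ (A : Type) [CommRing A] [Algebra K A] (s t : A),
      ∏ l ∈ S, (s - algebraMap K A (u l) * t) =
        ∑ r ∈ Finset.range (S.card + 1), algebraMap K A (b r) * (s ^ r * t ^ (S.card - r)) := by
  induction S using Finset.induction_on with
  | empty => exact ⟨fun _ => 1, fun A _ _ s t => by simp⟩
  | insert a S ha ih =>
    obtain ⟨b, hb⟩ := ih
    refine ⟨fun r => (if r = 0 then 0 else b (r - 1)) - (if r = S.card + 1 then 0 else u a * b r), ?_⟩
    intro A _ _ s t
    rw [Finset.prod_insert ha, hb, Finset.card_insert_of_notMem ha]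
    simp only [map_sub, sub_mul, Finset.sum_sub_distrib]
    congr 1
    · rw [Finset.sum_range_succ' _ (S.card + 1), Finset.mul_sum]
      simp only [Nat.add_eq_zero_iff, one_ne_zero, and_false, if_false, if_true, map_zero, zero_mul,
        add_zero, Nat.add_sub_cancel]
      refine Finset.sum_congr rfl fun r hr => ?_
      rw [Nat.add_sub_add_right]
      ring
    · rw [Finset.sum_range_succ _ (S.card + 1), Finset.mul_sum]
      simp only [if_true, map_zero, zero_mul, add_zero]
      refine Finset.sum_congr rfl fun r hr => ?_
      rw [Finset.mem_range] at hr
      rw [if_neg (by omega), Nat.sub_add_comm (by omega : r ≤ S.card), map_mul]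
      ring

noncomputable def eInv (K : Type) [CommRing K] (k : ℕ) : MvPowerSeries (Fin k) K :=
  (∏ i : Fin k, (1 - MvPowerSeries.X i ^ 2)) *
    ∏ i : Fin k, ∏ j ∈ Finset.Ioi i, (1 - MvPowerSeries.X i * MvPowerSeries.X j)

theorem cauchy_so {K : Type} [Field K] {k : ℕ} (z : Fin k → K) (hz : ∀ i, z i ≠ 0)
    (hz1 : ∀ i, z i - (z i)⁻¹ ≠ 0)
    (hu : Function.Injective fun i => z i ^ 2 + (z i)⁻¹ ^ 2)
    (H : PowerSeries K)
    (hH : H * ((1 - PowerSeries.X) * ∏ l, ((1 - PowerSeries.C (z l ^ 2) * PowerSeries.X) *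
      (1 - PowerSeries.C ((z l)⁻¹ ^ 2) * PowerSeries.X))) = 1) :
    ∃ c : K, c ≠ 0 ∧ (Matrix.of fun i j : Fin k => iota j (gser (z i))).det =
      MvPowerSeries.C c * (eInv K k * (aRho K k * ∏ j, iota j H)) := by
  set u : Fin k → K := fun i => z i ^ 2 + (z i)⁻¹ ^ 2 with hu_def
  choose b hb using fun i : Fin k => prod_hom_expand (Finset.univ.erase i) u
  have hcard : ∀ i : Fin k, (Finset.univ.erase i).card + 1 = k := by
    intro i
    rw [Finset.card_erase_add_one (Finset.mem_univ i)]; simp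
  have hcard' : ∀ i : Fin k, (Finset.univ.erase i).card = k - 1 := by
    intro i
    have := hcard i
    omega
  have hb' : ∀ (i : Fin k) (A : Type) [CommRing A] [Algebra K A] (s t : A),
      ∏ l ∈ Finset.univ.erase i, (s - algebraMap K A (u l) * t) =
        ∑ r : Fin k, algebraMap K A (b i r) * (s ^ (r : ℕ) * t ^ (k - 1 - (r : ℕ))) := by
    intro i A _ _ s t
    rw [hb i A s t, hcard i, hcard' i,
      Fin.sum_univ_eq_sum_range (fun r => algebraMap K A (b i r) * (s ^ r * t ^ (k - 1 - r)))]
  set B : Matrix (Fin k) (Fin k) K := Matrix.of fun i r => b i r with hB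
  have hBne : B.det ≠ 0 := by
    have h1 : B * (Matrix.vandermonde u).transpose =
        Matrix.diagonal (fun i => ∏ l ∈ Finset.univ.erase i, (u i - u l)) := by
      ext i j
      rw [Matrix.mul_apply, Matrix.diagonal_apply]
      have h2 := hb' i K (u j) 1
      simp only [Algebra.algebraMap_self, RingHom.id_apply, mul_one, one_pow] at h2
      simp only [hB, Matrix.of_apply, Matrix.transpose_apply, Matrix.vandermonde_apply]
      rw [← h2]
      split_ifs with hij
      · rw [hij]
      · refine Finset.prod_eq_zero (i := j) ?_ (sub_self _)
        simp [Ne.symm hij]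
    have h3 := congrArg Matrix.det h1
    rw [Matrix.det_mul, Matrix.det_diagonal] at h3
    intro h0
    rw [h0, zero_mul] at h3
    refine Finset.prod_ne_zero_iff.2 (fun i _ => Finset.prod_ne_zero_iff.2 fun l hl => ?_) h3.symm
    rw [sub_ne_zero]
    intro h
    exact Finset.ne_of_mem_erase hl (hu h).symm
  refine ⟨(∏ i, (z i - (z i)⁻¹)) * B.det, mul_ne_zero (Finset.prod_ne_zero_iff.2 fun i _ => hz1 i) hBne, ?_⟩
  have hfac : ∀ l : Fin k, (1 + PowerSeries.X ^ 2 - algebraMap K (PowerSeries K) (u l) * PowerSeries.X) =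
      (1 - PowerSeries.C (z l ^ 2) * PowerSeries.X) *
      (1 - PowerSeries.C ((z l)⁻¹ ^ 2) * PowerSeries.X) := by
    intro l
    have h4 : (PowerSeries.C (z l ^ 2) * PowerSeries.C ((z l)⁻¹ ^ 2) : PowerSeries K) = 1 := by
      rw [← map_mul, ← mul_pow, mul_inv_cancel₀ (hz l), one_pow, map_one]
    have h5 : algebraMap K (PowerSeries K) (u l) =
        PowerSeries.C (z l ^ 2) + PowerSeries.C ((z l)⁻¹ ^ 2) := by
      rw [hu_def, ← map_add]; rfl
    rw [h5]
    linear_combination -PowerSeries.X ^ 2 * h4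
  have hg : ∀ i, gser (z i) = PowerSeries.C (z i - (z i)⁻¹) * ((1 - PowerSeries.X ^ 2) * H) *
      ∑ r : Fin k, PowerSeries.C (b i r) *
        ((1 + PowerSeries.X ^ 2) ^ (r : ℕ) * PowerSeries.X ^ (k - 1 - (r : ℕ))) := by
    intro i
    have h1 := hb' i (PowerSeries K) (1 + PowerSeries.X ^ 2) PowerSeries.X
    have h1' : ∑ r : Fin k, PowerSeries.C (b i r) *
        ((1 + PowerSeries.X ^ 2) ^ (r : ℕ) * PowerSeries.X ^ (k - 1 - (r : ℕ))) =
        ∏ l ∈ Finset.univ.erase i, ((1 - PowerSeries.C (z l ^ 2) * PowerSeries.X) *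
      (1 - PowerSeries.C ((z l)⁻¹ ^ 2) * PowerSeries.X)) := by
      rw [← Finset.prod_congr rfl (fun l _ => hfac l), h1]
      rfl
    rw [h1']
    have h2 := gser_mul (z i) (hz i)
    rw [← Finset.mul_prod_erase _ _ (Finset.mem_univ i)] at hH
    set q := ((1 - PowerSeries.C (z i ^ 2) * PowerSeries.X) *
      (1 - PowerSeries.C ((z i)⁻¹ ^ 2) * PowerSeries.X)) with hq
    set P := ∏ l ∈ Finset.univ.erase i, ((1 - PowerSeries.C (z l ^ 2) * PowerSeries.X) *
      (1 - PowerSeries.C ((z l)⁻¹ ^ 2) * PowerSeries.X)) with hP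
    have hq0 : q ≠ 0 := by
      intro h0
      rw [h0] at hH
      simp at hH
    apply mul_right_cancel₀ hq0
    rw [h2]
    linear_combination (-PowerSeries.C (z i - (z i)⁻¹) * (1 + PowerSeries.X)) * hH
  have hmat : (Matrix.of fun i j : Fin k => iota j (gser (z i))) =
      Matrix.of fun i j : Fin k => (MvPowerSeries.C (z i - (z i)⁻¹) : MvPowerSeries (Fin k) K) *
        (Matrix.of fun i j : Fin k => (iota j ((1 - PowerSeries.X ^ 2) * H)) *
          (((B.map (MvPowerSeries.C (σ := Fin k))) : Matrix (Fin k) (Fin k) (MvPowerSeries (Fin k) K)) * (Matrix.projVandermonde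
            (fun j : Fin k => 1 + (MvPowerSeries.X j : MvPowerSeries (Fin k) K) ^ 2)
              (fun j => MvPowerSeries.X j)).transpose : Matrix (Fin k) (Fin k) (MvPowerSeries (Fin k) K)) i j) i j := by
    ext1 i j
    simp only [Matrix.of_apply, Matrix.mul_apply, Matrix.map_apply, Matrix.transpose_apply,
      Matrix.projVandermonde_apply, hB]
    rw [hg i, map_mul, map_mul, iota_C, map_sum, mul_assoc]
    congr 2
    refine Finset.sum_congr rfl fun r _ => ?_
    simp only [map_mul, map_pow, map_add, map_one, iota_C, iota_X, Fin.val_rev]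
    congr 3
    omega
  rw [hmat, Matrix.det_mul_column, Matrix.det_mul_row, Matrix.det_mul, Matrix.det_transpose,
    Matrix.det_projVandermonde]
  have hBm : (B.map (MvPowerSeries.C (σ := Fin k))).det = MvPowerSeries.C B.det := by
    rw [← RingHom.mapMatrix_apply, ← RingHom.map_det]
  have hv : (∏ i : Fin k, ∏ j ∈ Finset.Ioi i,
      ((1 + (MvPowerSeries.X j : MvPowerSeries (Fin k) K) ^ 2) * MvPowerSeries.X i -
        (1 + MvPowerSeries.X i ^ 2) * MvPowerSeries.X j)) =
      (∏ i : Fin k, ∏ j ∈ Finset.Ioi i, (1 - (MvPowerSeries.X i : MvPowerSeries (Fin k) K) * MvPowerSeries.X j)) *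
        aRho K k := by
    rw [aRho, det_rho, ← Finset.prod_mul_distrib]
    refine Finset.prod_congr rfl fun i _ => ?_
    rw [← Finset.prod_mul_distrib]
    refine Finset.prod_congr rfl fun j _ => ?_
    ring
  rw [hBm, hv, eInv]
  simp only [map_mul, map_prod, Finset.prod_mul_distrib, map_sub, map_one, map_pow, iota_X]
  ring


lemma lagrange_id {L : Type} [Field L] {n : ℕ} (t : Fin n → L) (ht : Function.Injective t)
    (ht0 : ∀ i, t i ≠ 0) :
    ∑ m, (∏ j, (1 - t m * t j)) * ∏ j ∈ Finset.univ.erase m, ((t j - t m)⁻¹ * t j)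
      = 1 - ∏ j, t j ^ 2 := by
  classical
  rcases Nat.eq_zero_or_pos n with h0 | hn
  · subst h0; simp
  have hp1 : (∏ j, (Polynomial.X - Polynomial.C (t j)⁻¹)).Monic :=
    Polynomial.monic_prod_of_monic _ _ fun j _ => Polynomial.monic_X_sub_C _
  have hp2 : (∏ j, (Polynomial.X - Polynomial.C (t j))).Monic :=
    Polynomial.monic_prod_of_monic _ _ fun j _ => Polynomial.monic_X_sub_C _
  have hd1 : (∏ j, (Polynomial.X - Polynomial.C (t j)⁻¹)).degree = (n : WithBot ℕ) := by
    rw [Polynomial.degree_prod]; simp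
  have hd2 : (∏ j, (Polynomial.X - Polynomial.C (t j))).degree = (n : WithBot ℕ) := by
    rw [Polynomial.degree_prod]; simp
  have hdeg : (∏ j, (Polynomial.X - Polynomial.C (t j)⁻¹)
      - ∏ j, (Polynomial.X - Polynomial.C (t j))).degree < (n : WithBot ℕ) := by
    rw [← hd1]
    exact Polynomial.degree_sub_lt_left (hd1.trans hd2.symm) hp1.ne_zero
      (by rw [hp1.leadingCoeff, hp2.leadingCoeff])
  set f : Polynomial L := Polynomial.C (∏ j, (- t j)) * (∏ j, (Polynomial.X - Polynomial.C (t j)⁻¹)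
      - ∏ j, (Polynomial.X - Polynomial.C (t j))) with hf
  have hfd : f.degree < (Finset.univ : Finset (Fin n)).card := by
    rw [Finset.card_univ, Fintype.card_fin]
    rw [hf, Polynomial.degree_C_mul (Finset.prod_ne_zero_iff.2 fun j _ => neg_ne_zero.2 (ht0 j))]
    exact hdeg
  have hev : ∀ i ∈ (Finset.univ : Finset (Fin n)), f.eval (t i) = ∏ j, (1 - t i * t j) := by
    intro i _
    rw [hf, Polynomial.eval_mul, Polynomial.eval_sub, Polynomial.eval_prod, Polynomial.eval_prod,
      Finset.prod_eq_zero (f := fun j => Polynomial.eval (t i) (Polynomial.X - Polynomial.C (t j)))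
        (i := i) (Finset.mem_univ _) (by simp), sub_zero, Polynomial.eval_C,
      ← Finset.prod_mul_distrib]
    refine Finset.prod_congr rfl fun j _ => ?_
    have := ht0 j
    simp
    field_simp
    ring
  have h := congrArg (Polynomial.eval 0)
    (Lagrange.eq_interpolate_of_eval_eq (s := Finset.univ) (v := t) _ ht.injOn hfd hev)
  rw [Lagrange.interpolate_apply, Polynomial.eval_finsetSum] at h
  have hf0 : f.eval 0 = 1 - ∏ j, t j ^ 2 := by
    rw [hf, Polynomial.eval_mul, Polynomial.eval_sub, Polynomial.eval_prod, Polynomial.eval_prod,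
      Polynomial.eval_C, mul_sub, ← Finset.prod_mul_distrib, ← Finset.prod_mul_distrib]
    congr 1
    · refine Finset.prod_eq_one fun j _ => ?_
      have := ht0 j
      simp [this]
    · refine Finset.prod_congr rfl fun j _ => ?_
      simp; ring
  rw [hf0] at h
  rw [h]
  refine Finset.sum_congr rfl fun m _ => ?_
  rw [Polynomial.eval_mul, Polynomial.eval_C, Lagrange.basis, Polynomial.eval_prod]
  congr 1
  refine Finset.prod_congr rfl fun j _ => ?_
  simp only [Lagrange.basisDivisor, Polynomial.eval_mul, Polynomial.eval_C, Polynomial.eval_sub,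
    Polynomial.eval_X, zero_sub]
  rw [← neg_sub (t m) (t j), inv_neg]
  ring

lemma prod_swap_succ {M : Type} [CommMonoid M] {n : ℕ} (m : Fin (n+1)) (g : Fin (n+1) → M) :
    ∏ i : Fin n, g (Equiv.swap 0 m i.succ) = ∏ j ∈ Finset.univ.erase m, g j := by
  rw [← Fin.prod_Ioi_zero (fun i => g (Equiv.swap 0 m i))]
  refine Finset.prod_equiv (Equiv.swap 0 m) ?_ (fun _ _ => rfl)
  intro i
  simp only [Finset.mem_Ioi, Finset.mem_erase, Finset.mem_univ, and_true]
  rw [Ne, Equiv.swap_apply_eq_iff, Equiv.swap_apply_right, ← ne_eq, Fin.pos_iff_ne_zero]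

/-- The product of `1 - t_i t_j` over `i ≤ j`. -/
def ppr {L : Type} [CommRing L] {n : ℕ} (t : Fin n → L) : L :=
  (∏ i, (1 - t i ^ 2)) * ∏ i, ∏ j ∈ Finset.Ioi i, (1 - t i * t j)

lemma ppr_comp {L : Type} [Field L] {n : ℕ} (t : Fin n → L) (ht : Function.Injective t)
    (σ : Equiv.Perm (Fin n)) : ppr (t ∘ σ) = ppr t := by
  unfold ppr
  have h1 := σ.prod_Ioi_comp_eq_sign_mul_prod (f := fun i j => (t j - t i)) (fun i j => by ring)
  have h2 := σ.prod_Ioi_comp_eq_sign_mul_prod (f := fun i j => (t j - t i) * (1 - t i * t j))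
    (fun i j => by ring)
  simp only [Finset.prod_mul_distrib] at h2
  rw [h1] at h2
  have h3 : (∏ i, ∏ j ∈ Finset.Ioi i, (t j - t i)) ≠ 0 := by
    rw [← Matrix.det_vandermonde]
    exact Matrix.det_vandermonde_ne_zero_iff.2 ht
  have h4 : ((σ.sign : ℤ) : L) ≠ 0 := by
    rcases Int.units_eq_one_or σ.sign with h | h <;> simp [h]
  rw [mul_assoc] at h2
  have h5 := mul_left_cancel₀ h3 (mul_left_cancel₀ h4 h2)
  simp only [Function.comp]
  rw [h5, Equiv.prod_comp σ (fun i => 1 - t i ^ 2)]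

lemma ppr_succ {L : Type} [Field L] {n : ℕ} (t : Fin (n+1) → L) :
    ppr t = (∏ i, (1 - t 0 * t i)) * ppr (t ∘ Fin.succ) := by
  unfold ppr
  rw [Fin.prod_univ_succ, Fin.prod_univ_succ (fun i => ∏ j ∈ Finset.Ioi i, (1 - t i * t j)),
    Fin.prod_univ_succ (fun i => (1 - t 0 * t i)), Fin.prod_Ioi_zero]
  simp only [Fin.prod_Ioi_succ, Function.comp]
  ring

lemma littlewood_field {L : Type} [Field L] {n : ℕ} : ∀ (t : Fin n → L) (_ : Function.Injective t)
    (_ : ∀ i, t i ≠ 0) (_ : ∀ i j, 1 - t i * t j ≠ 0)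
    (_ : ∀ S : Finset (Fin n), S.Nonempty → 1 - ∏ i ∈ S, t i ^ 2 ≠ 0),
    ∑ w : Equiv.Perm (Fin n), ((w.sign : ℤ) : L) *
      ∏ i, (t (w i) ^ (i : ℕ) * (1 - ∏ j ∈ Finset.Ici i, t (w j) ^ 2)⁻¹)
    = (Matrix.vandermonde t).det * (ppr t)⁻¹ := by
  induction n with
  | zero => intro t _ _ _ _; simp [ppr]
  | succ n ih =>
    intro t ht ht0 ht1 ht2
    rw [← Equiv.sum_comp Equiv.Perm.decomposeFin.symm, Fintype.sum_prod_type]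
    have hp0 : ∀ m : Fin (n+1), (∏ j, (1 - t m * t j)) ≠ 0 := fun m =>
      Finset.prod_ne_zero_iff.2 fun j _ => ht1 m j
    have key : ∀ m : Fin (n+1), ∑ w' : Equiv.Perm (Fin n),
        (((Equiv.Perm.decomposeFin.symm (m, w')).sign : ℤ) : L) *
        ∏ i, (t (Equiv.Perm.decomposeFin.symm (m, w') i) ^ (i : ℕ) *
          (1 - ∏ j ∈ Finset.Ici i, t (Equiv.Perm.decomposeFin.symm (m, w') j) ^ 2)⁻¹)
        = (1 - ∏ j, t j ^ 2)⁻¹ * ((Matrix.vandermonde t).det * (ppr t)⁻¹) *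
          ((∏ j, (1 - t m * t j)) * ∏ j ∈ Finset.univ.erase m, ((t j - t m)⁻¹ * t j)) := by
      intro m
      set σ : Equiv.Perm (Fin (n+1)) := Equiv.swap 0 m with hσ
      have hinj : Function.Injective (t ∘ σ ∘ Fin.succ) :=
        ht.comp (σ.injective.comp (Fin.succ_injective _))
      have h := ih (t ∘ σ ∘ Fin.succ) hinj (fun i => ht0 _) (fun i j => ht1 _ _) (by
        intro S hS
        have := ht2 (S.map ⟨σ ∘ Fin.succ, σ.injective.comp (Fin.succ_injective _)⟩)
          (hS.map)
        simpa [Finset.prod_map] using this)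
      have hsgn : ∀ w' : Equiv.Perm (Fin n),
          (((Equiv.Perm.decomposeFin.symm (m, w')).sign : ℤ) : L)
          = ((σ.sign : ℤ) : L) * ((w'.sign : ℤ) : L) := by
        intro w'
        rw [Equiv.Perm.decomposeFin.symm_sign, hσ]
        by_cases hm : m = 0
        · simp [hm]
        · rw [Equiv.Perm.sign_swap (Ne.symm hm)]; simp [hm]
      have hterm : ∀ w' : Equiv.Perm (Fin n), (((Equiv.Perm.decomposeFin.symm (m, w')).sign : ℤ) : L) *
        ∏ i, (t (Equiv.Perm.decomposeFin.symm (m, w') i) ^ (i : ℕ) *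
          (1 - ∏ j ∈ Finset.Ici i, t (Equiv.Perm.decomposeFin.symm (m, w') j) ^ 2)⁻¹)
        = ((σ.sign : ℤ) : L) * (1 - ∏ j, t j ^ 2)⁻¹ * (∏ j ∈ Finset.univ.erase m, t j) *
          (((w'.sign : ℤ) : L) * ∏ i, ((t ∘ σ ∘ Fin.succ) (w' i) ^ (i : ℕ) *
            (1 - ∏ j ∈ Finset.Ici i, (t ∘ σ ∘ Fin.succ) (w' j) ^ 2)⁻¹)) := by
        intro w'
        rw [hsgn, Fin.prod_univ_succ]
        have e1 : (Finset.Ici (0 : Fin (n+1))) = Finset.univ := by ext; simp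
        rw [e1, Equiv.prod_comp (Equiv.Perm.decomposeFin.symm (m, w')) (fun j => t j ^ 2)]
        simp only [Fin.prod_Ici_succ, Equiv.Perm.decomposeFin_symm_apply_succ, Fin.val_zero, pow_zero,
          one_mul, Fin.val_succ, Function.comp, pow_succ]
        rw [← prod_swap_succ m t, ← Equiv.prod_comp w' (fun i => t (Equiv.swap 0 m i.succ))]
        simp only [Finset.prod_mul_distrib]
        ring
      rw [Finset.sum_congr rfl fun w' _ => hterm w', ← Finset.mul_sum, h]
      have hV : (∏ j ∈ Finset.univ.erase m, (t j - t m)) * (Matrix.vandermonde (t ∘ σ ∘ Fin.succ)).det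
          = ((σ.sign : ℤ) : L) * (Matrix.vandermonde t).det := by
        have h1 := σ.prod_Ioi_comp_eq_sign_mul_prod (f := fun i j => (t j - t i)) (fun i j => by ring)
        rw [Matrix.det_vandermonde, Matrix.det_vandermonde, ← h1, Fin.prod_univ_succ, Fin.prod_Ioi_zero,
          ← prod_swap_succ m (fun j => t j - t m)]
        simp only [Fin.prod_Ioi_succ, Function.comp, hσ, Equiv.swap_apply_left]
      have hPP : ppr t = (∏ i, (1 - t m * t i)) * ppr (t ∘ σ ∘ Fin.succ) := by
        rw [← ppr_comp t ht σ, ppr_succ]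
        simp only [Function.comp, hσ, Equiv.swap_apply_left]
        rw [Equiv.prod_comp (Equiv.swap 0 m) (fun i => 1 - t m * t i)]
        rfl
      have hd : (∏ j ∈ Finset.univ.erase m, (t j - t m)) ≠ 0 :=
        Finset.prod_ne_zero_iff.2 fun j hj => sub_ne_zero.2 fun h => (Finset.mem_erase.1 hj).1 (ht h)
      have hss : ((σ.sign : ℤ) : L) * ((σ.sign : ℤ) : L) = 1 := by
        rcases Int.units_eq_one_or σ.sign with h | h <;> simp [h]
      rw [hPP, mul_inv, Finset.prod_mul_distrib, Finset.prod_inv_distrib]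
      have hV2 : (Matrix.vandermonde (t ∘ σ ∘ Fin.succ)).det = (∏ j ∈ Finset.univ.erase m, (t j - t m))⁻¹ *
          (((σ.sign : ℤ) : L) * (Matrix.vandermonde t).det) := by
        rw [← hV, inv_mul_cancel_left₀ hd]
      rw [hV2]
      have := hp0 m
      have e2 := mul_inv_cancel₀ this
      set P := ∏ j, (1 - t m * t j)
      set Q := (ppr (t ∘ σ ∘ Fin.succ))⁻¹
      set D := (∏ j ∈ Finset.univ.erase m, (t j - t m))⁻¹
      set V := (Matrix.vandermonde t).det
      set T := ∏ j ∈ Finset.univ.erase m, t j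
      set U := (1 - ∏ j, t j ^ 2)⁻¹
      set s := ((σ.sign : ℤ) : L)
      linear_combination (U * T * D * V * Q) * hss - U * V * Q * D * T * e2
    rw [Finset.sum_congr rfl fun m _ => key m, ← Finset.mul_sum, lagrange_id t ht ht0]
    have := ht2 Finset.univ Finset.univ_nonempty
    rw [mul_right_comm, inv_mul_cancel₀ this, one_mul]


lemma littlewood_dec {L : Type} [Field L] {n : ℕ} (t : Fin n → L) (ht : Function.Injective t)
    (ht0 : ∀ i, t i ≠ 0) (ht1 : ∀ i j, 1 - t i * t j ≠ 0)
    (ht2 : ∀ S : Finset (Fin n), S.Nonempty → 1 - ∏ i ∈ S, t i ^ 2 ≠ 0) :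
    ∑ w : Equiv.Perm (Fin n), ((w.sign : ℤ) : L) *
      ∏ i, (t (w i) ^ (n - 1 - (i : ℕ)) * (1 - ∏ j ∈ Finset.Iic i, t (w j) ^ 2)⁻¹)
    = (Matrix.of fun i j : Fin n => t i ^ (n - 1 - (j : ℕ))).det * (ppr t)⁻¹ := by
  have h := littlewood_field t ht ht0 ht1 ht2
  set r : Equiv.Perm (Fin n) := Fin.revPerm with hr
  have hdet : (Matrix.of fun i j : Fin n => t i ^ (n - 1 - (j : ℕ))).det
      = ((r.sign : ℤ) : L) * (Matrix.vandermonde t).det := by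
    rw [← Matrix.det_permute' r (Matrix.vandermonde t)]
    congr 1
    ext i j
    simp only [Matrix.of_apply, Matrix.submatrix_apply, id, Matrix.vandermonde_apply, hr,
      Fin.revPerm_apply, Fin.val_rev]
    congr 1
    omega
  rw [hdet, mul_assoc, ← h, Finset.mul_sum, ← Equiv.sum_comp (Equiv.mulRight r)]
  refine Finset.sum_congr rfl fun w _ => ?_
  rw [Equiv.coe_mulRight, Equiv.Perm.sign_mul, ← mul_assoc]
  congr 1
  · push_cast; ring
  rw [← Equiv.prod_comp r]
  refine Finset.prod_congr rfl fun i _ => ?_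
  have hrr : ∀ x, r (r x) = x := fun x => by simp [hr]
  rw [Equiv.Perm.mul_apply, hrr]
  congr 1
  · congr 1
    simp only [hr, Fin.revPerm_apply, Fin.val_rev]
    omega
  · congr 2
    refine Finset.prod_equiv r ?_ (fun j _ => by rw [Equiv.Perm.mul_apply])
    intro j
    simp only [Finset.mem_Iic, Finset.mem_Ici, hr, Fin.revPerm_apply]
    exact Fin.le_rev_iff

lemma eInv_eq (K : Type) [CommRing K] (k : ℕ) : eInv K k = ppr (fun i => MvPowerSeries.X i) := rfl

lemma littlewood_ps {K : Type} [Field K] {k : ℕ} (S : Equiv.Perm (Fin k) → MvPowerSeries (Fin k) K)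
    (hS : ∀ w, S w * ∏ i, (1 - ∏ j ∈ Finset.Iic i, MvPowerSeries.X (w j) ^ 2) = 1) :
    eInv K k * ∑ w : Equiv.Perm (Fin k), ((w.sign : ℤ) : MvPowerSeries (Fin k) K) *
      ((∏ i, MvPowerSeries.X (w i) ^ (k - 1 - (i : ℕ))) * S w) = aRho K k := by
  let R := MvPowerSeries (Fin k) K
  let L := FractionRing R
  let φ : R →+* L := algebraMap R L
  have hφ : Function.Injective φ := IsFractionRing.injective R L
  have hX : Function.Injective (MvPowerSeries.X : Fin k → R) := by
    intro i j hij
    have := congrArg (MvPowerSeries.coeff (Finsupp.single i 1)) hij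
    rw [MvPowerSeries.coeff_index_single_X, MvPowerSeries.coeff_index_single_X, if_pos rfl] at this
    by_contra hne
    rw [if_neg hne] at this
    exact one_ne_zero this
  have hX0 : ∀ i : Fin k, (MvPowerSeries.X i : R) ≠ 0 := by
    intro i hi
    have := congrArg (MvPowerSeries.coeff (Finsupp.single i 1)) hi
    rw [MvPowerSeries.coeff_index_single_X, if_pos rfl, map_zero] at this
    exact one_ne_zero this
  have hne : ∀ a : R, MvPowerSeries.constantCoeff a ≠ 0 → φ a ≠ 0 := by
    intro a ha h
    apply ha
    have : a = 0 := hφ (by rw [h, map_zero])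
    rw [this, map_zero]
  have h1 : ∀ i j : Fin k, 1 - φ (MvPowerSeries.X i) * φ (MvPowerSeries.X j) ≠ 0 := by
    intro i j
    rw [← map_mul, ← map_one φ, ← map_sub]
    apply hne
    simp
  have h2 : ∀ s : Finset (Fin k), s.Nonempty → 1 - ∏ i ∈ s, φ (MvPowerSeries.X i) ^ 2 ≠ 0 := by
    intro s hs
    simp only [← map_pow]
    rw [← map_prod, ← map_one φ, ← map_sub]
    apply hne
    obtain ⟨a, ha⟩ := hs
    rw [map_sub, map_prod, Finset.prod_eq_zero ha (by simp)]
    simp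
  have h := littlewood_dec (fun i => φ (MvPowerSeries.X i)) (hφ.comp hX)
    (fun i h => hX0 i (hφ (by rw [h, map_zero]))) h1 h2
  have hp : φ (eInv K k) = ppr (fun i => φ (MvPowerSeries.X i)) := by
    simp [eInv, ppr, map_prod, R, φ]
  have hp0 : ppr (fun i : Fin k => φ (MvPowerSeries.X i)) ≠ 0 := by
    rw [← hp]
    apply hne
    rw [eInv]
    simp [map_prod]
  have ha : φ (aRho K k) = (Matrix.of fun i j : Fin k => φ (MvPowerSeries.X i) ^ (k - 1 - (j : ℕ))).det := by
    rw [aRho, RingHom.map_det]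
    congr 1
    ext i j
    simp
  apply hφ
  rw [map_mul, hp, ha]
  rw [eq_mul_inv_iff_mul_eq₀ hp0] at h
  rw [← h, mul_comm, map_sum]
  congr 1
  refine Finset.sum_congr rfl fun w _ => ?_
  have hs := congrArg φ (hS w)
  rw [map_mul, map_one] at hs
  rw [map_mul, map_intCast, map_mul, Finset.prod_mul_distrib, map_prod, eq_inv_of_mul_eq_one_left hs,
    map_prod, Finset.prod_inv_distrib]
  simp only [map_sub, map_one, map_prod, map_pow]

def cone {ι σ : Type} [Fintype ι] (v : ι → (σ →₀ ℕ)) (S : Finset ι) (d : σ →₀ ℕ) : Prop :=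
  ∃ m : ι → ℕ, (∀ i, i ∉ S → m i = 0) ∧ d = ∑ i, m i • v i

noncomputable def coneSer (K : Type) [CommRing K] {ι σ : Type} [Fintype ι] (v : ι → (σ →₀ ℕ))
    (S : Finset ι) : MvPowerSeries σ K := fun d => if cone v S d then 1 else 0

lemma coeff_coneSer (K : Type) [CommRing K] {ι σ : Type} [Fintype ι] (v : ι → (σ →₀ ℕ))
    (S : Finset ι) (d : σ →₀ ℕ) :
    MvPowerSeries.coeff d (coneSer K v S) = if cone v S d then 1 else 0 := rfl

lemma cone_step {K : Type} [CommRing K] {ι σ : Type} [Fintype ι] (v : ι → (σ →₀ ℕ))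
    (hv : Function.Injective fun m : ι → ℕ => ∑ i, m i • v i) (a : ι) (S : Finset ι) (ha : a ∉ S) :
    coneSer K v (insert a S) * (1 - MvPowerSeries.monomial (v a) 1) = coneSer K v S := by
  ext d
  rw [mul_sub, mul_one, map_sub, MvPowerSeries.coeff_mul_monomial, coeff_coneSer, coeff_coneSer,
    coeff_coneSer]
  have hadd : ∀ m : ι → ℕ, ∑ i, (m + (Pi.single a 1 : ι → ℕ)) i • v i = ∑ i, m i • v i + v a := by
    intro m
    simp only [Pi.add_apply, add_smul, Finset.sum_add_distrib]
    congr 1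
    rw [Finset.sum_eq_single a]
    · simp
    · intro b _ hb; simp [hb]
    · simp
  by_cases hd : cone v (insert a S) d
  · rw [if_pos hd]
    obtain ⟨m, hm, rfl⟩ := hd
    by_cases hma : m a = 0
    · have hc : cone v S (∑ i, m i • v i) := by
        refine ⟨m, fun i hi => ?_, rfl⟩
        by_cases hia : i = a
        · rw [hia, hma]
        · exact hm i (by simp [hi, hia])
      rw [if_pos hc]
      have : ¬ (v a ≤ (∑ i, m i • v i) ∧ cone v (insert a S) (∑ i, m i • v i - v a)) := by
        rintro ⟨h1, m', -, h2⟩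
        have h3 : ∑ i, m i • v i = ∑ i, (m' + (Pi.single a 1 : ι → ℕ)) i • v i := by
          rw [hadd, ← h2, tsub_add_cancel_of_le h1]
        have h4 := congrFun (hv h3) a
        simp [hma] at h4
      by_cases h5 : v a ≤ (∑ i, m i • v i)
      · rw [if_pos h5, if_neg (fun h => this ⟨h5, h⟩)]; simp
      · rw [if_neg h5]; simp
    · have h0 : m = (fun i => m i - (Pi.single a 1 : ι → ℕ) i) + Pi.single a 1 := by
        ext i
        by_cases hia : i = a
        · subst hia; simp; omega
        · simp [hia]
      set m' : ι → ℕ := fun i => m i - (Pi.single a 1 : ι → ℕ) i with hm'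
      have h1 : ∑ i, m i • v i = ∑ i, m' i • v i + v a := by
        rw [← hadd, ← h0]
      have hle : v a ≤ ∑ i, m i • v i := by rw [h1]; exact le_add_self
      have hc : cone v (insert a S) (∑ i, m i • v i - v a) := by
        refine ⟨m', fun i hi => ?_, ?_⟩
        · rw [hm']; simp [hm i hi]
        · rw [h1, add_tsub_cancel_right]
      have hn : ¬ cone v S (∑ i, m i • v i) := by
        rintro ⟨n, hn, h⟩
        exact hma (by rw [hv h]; exact hn a ha)
      rw [if_pos hle, if_pos hc, if_neg hn]; simp
  · rw [if_neg hd]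
    have h1 : ¬ cone v S d := by
      rintro ⟨m, hm, h⟩
      exact hd ⟨m, fun i hi => hm i (fun h => hi (Finset.mem_insert_of_mem h)), h⟩
    rw [if_neg h1]
    by_cases h5 : v a ≤ d
    · rw [if_pos h5, if_neg]
      · simp
      rintro ⟨m, hm, h⟩
      refine hd ⟨m + Pi.single a 1, fun i hi => ?_, ?_⟩
      · have : i ≠ a := fun h => hi (by simp [h])
        simp [hm i hi, this]
      · rw [hadd, ← h, tsub_add_cancel_of_le h5]
    · rw [if_neg h5]; simp

lemma cone_inv {K : Type} [CommRing K] {ι σ : Type} [Fintype ι] (v : ι → (σ →₀ ℕ))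
    (hv : Function.Injective fun m : ι → ℕ => ∑ i, m i • v i) (S : Finset ι) :
    coneSer K v S * ∏ i ∈ S, (1 - MvPowerSeries.monomial (v i) 1) = 1 := by
  induction S using Finset.induction_on with
  | empty =>
    rw [Finset.prod_empty, mul_one]
    ext d
    rw [coeff_coneSer, MvPowerSeries.coeff_one]
    congr 1
    apply propext
    constructor
    · rintro ⟨m, hm, rfl⟩
      exact Finset.sum_eq_zero fun i _ => by rw [hm i (by simp), zero_smul]
    · rintro rfl
      exact ⟨0, by simp, by simp⟩
  | insert a S ha ih =>
    rw [Finset.prod_insert ha, ← mul_assoc, cone_step v hv a S ha, ih]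


/-- Tail sums. -/
def tsum' {k : ℕ} (m : Fin k → ℕ) (j : ℕ) : ℕ := ∑ i : Fin k, if j ≤ (i : ℕ) then m i else 0

lemma tsum'_step {k : ℕ} (m : Fin k → ℕ) (j : Fin k) :
    tsum' m j = m j + tsum' m (j + 1) := by
  unfold tsum'
  have : m j = ∑ i : Fin k, if i = j then m i else 0 := by simp
  rw [this, ← Finset.sum_add_distrib]
  refine Finset.sum_congr rfl fun i _ => ?_
  by_cases h1 : i = j
  · subst h1; simp
  · have h2 : (i : ℕ) ≠ j := fun h => h1 (Fin.ext h)
    rw [if_neg h1, zero_add]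
    congr 1
    apply propext
    omega

lemma tsum'_ge {k : ℕ} (m : Fin k → ℕ) (j : ℕ) (hj : k ≤ j) : tsum' m j = 0 :=
  Finset.sum_eq_zero fun i _ => if_neg (by have := i.isLt; omega)

lemma tsum'_anti {k : ℕ} (m : Fin k → ℕ) (i j : ℕ) (hij : i ≤ j) : tsum' m j ≤ tsum' m i := by
  refine Finset.sum_le_sum fun x _ => ?_
  split_ifs <;> omega

noncomputable def vw {k : ℕ} (w : Equiv.Perm (Fin k)) (i : Fin k) : Fin k →₀ ℕ :=
  ∑ j ∈ Finset.Iic i, Finsupp.single (w j) 2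

lemma vw_apply {k : ℕ} (w : Equiv.Perm (Fin k)) (i j : Fin k) :
    vw w i (w j) = if j ≤ i then 2 else 0 := by
  rw [vw, Finsupp.finsetSum_apply]
  simp only [Finsupp.single_apply, w.injective.eq_iff]
  rw [Finset.sum_ite_eq']
  simp

lemma vw_sum {k : ℕ} (w : Equiv.Perm (Fin k)) (m : Fin k → ℕ) (j : Fin k) :
    (∑ i, m i • vw w i) (w j) = 2 * tsum' m j := by
  rw [Finsupp.finsetSum_apply, tsum', Finset.mul_sum]
  refine Finset.sum_congr rfl fun i _ => ?_
  rw [Finsupp.smul_apply, vw_apply, smul_eq_mul]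
  simp only [Fin.le_def]
  split_ifs <;> ring

lemma vw_inj {k : ℕ} (w : Equiv.Perm (Fin k)) :
    Function.Injective fun m : Fin k → ℕ => ∑ i, m i • vw w i := by
  intro m m' h
  have h1 : ∀ j : Fin k, tsum' m j = tsum' m' j := by
    intro j
    have := DFunLike.congr_fun h (w j)
    simp only [vw_sum] at this
    omega
  have h2 : ∀ j : ℕ, tsum' m j = tsum' m' j := by
    intro j
    by_cases hj : j < k
    · exact h1 ⟨j, hj⟩
    · rw [tsum'_ge m j (by omega), tsum'_ge m' j (by omega)]
  ext j
  have a := tsum'_step m j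
  have b := tsum'_step m' j
  rw [h2, h2] at a
  omega

lemma cone_vw {k : ℕ} (w : Equiv.Perm (Fin k)) (d : Fin k →₀ ℕ) :
    cone (vw w) Finset.univ d ↔ ∃ δ : Partn, (∀ i, Even (δ.parts i)) ∧ δ.LengthLE k ∧
      ∀ j : Fin k, d (w j) = δ.parts j := by
  constructor
  · rintro ⟨m, -, rfl⟩
    refine ⟨⟨fun j => 2 * tsum' m j, fun i j hij => Nat.mul_le_mul_left _ (tsum'_anti m i j hij),
      k, fun i hi => by rw [tsum'_ge m i hi]⟩, fun i => even_two_mul _,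
      fun i hi => by simp [tsum'_ge m i hi], fun j => vw_sum w m j⟩
  · rintro ⟨δ, h1, h2, h3⟩
    let m : Fin k → ℕ := fun i => (δ.parts i - δ.parts (i + 1)) / 2
    have key : ∀ n j : ℕ, k ≤ j + n → 2 * tsum' m j = δ.parts j := by
      intro n
      induction n with
      | zero => intro j hj; rw [tsum'_ge m j (by omega), h2 j (by omega)]
      | succ n ih =>
        intro j hj
        by_cases hjk : j < k
        · have a := tsum'_step m ⟨j, hjk⟩
          have b := ih (j + 1) (by omega)
          have c : m ⟨j, hjk⟩ = (δ.parts j - δ.parts (j+1)) / 2 := rfl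
          have e := δ.antitone j (j+1) (by omega)
          obtain ⟨x, hx⟩ := h1 j
          obtain ⟨y, hy⟩ := h1 (j+1)
          simp only at a
          omega
        · exact ih j (by omega)
    refine ⟨m, by simp, ?_⟩
    ext x
    obtain ⟨j, rfl⟩ := w.surjective x
    rw [h3, vw_sum, key k j (by omega)]

lemma Partn.ext' {p q : Partn} (h : p.parts = q.parts) : p = q := by
  cases p; cases q; simp at h; subst h; rfl

lemma boxFin (k B : ℕ) : {δ : Partn | δ.LengthLE k ∧ ∀ i, δ.parts i ≤ B}.Finite := by
  refine Set.Finite.of_injOn (f := fun (δ : Partn) (i : Fin k) => δ.parts i)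
    (t := Set.pi Set.univ fun _ => Set.Iic B) ?_ ?_ (Set.Finite.pi fun _ => Set.finite_Iic B)
  · intro δ hδ i _
    exact hδ.2 i
  · intro p hp q hq h
    apply Partn.ext'
    ext i
    by_cases hi : i < k
    · exact congrFun h ⟨i, hi⟩
    · rw [hp.1 i (by omega), hq.1 i (by omega)]

noncomputable def boxF (k B : ℕ) : Finset Partn := (boxFin k B).toFinset

lemma mem_boxF {k B : ℕ} {δ : Partn} : δ ∈ boxF k B ↔ δ.LengthLE k ∧ ∀ i, δ.parts i ≤ B := by
  simp [boxF]

noncomputable def aDet (K : Type) [CommRing K] (k : ℕ) (a : Fin k → ℕ) : MvPowerSeries (Fin k) K :=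
  (Matrix.of fun i j : Fin k => (MvPowerSeries.X i : MvPowerSeries (Fin k) K) ^ a j).det

noncomputable def wexp {k : ℕ} (w : Equiv.Perm (Fin k)) (a : Fin k → ℕ) : Fin k →₀ ℕ :=
  fexp (a ∘ w.symm)

lemma prodX_pow_w {K : Type} [CommRing K] {k : ℕ} (w : Equiv.Perm (Fin k)) (a : Fin k → ℕ) :
    ∏ i, (MvPowerSeries.X (w i) : MvPowerSeries (Fin k) K) ^ a i =
      MvPowerSeries.monomial (wexp w a) 1 := by
  rw [MvPowerSeries.monomial_one_eq, Finsupp.prod_fintype _ _ (by simp),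
    ← Equiv.prod_comp w (fun i => (MvPowerSeries.X i : MvPowerSeries (Fin k) K) ^ wexp w a i)]
  simp [wexp]

lemma wexp_eq {k : ℕ} (w : Equiv.Perm (Fin k)) (a : Fin k → ℕ) (e : Fin k →₀ ℕ) :
    e = wexp w a ↔ ∀ i, e (w i) = a i := by
  constructor
  · rintro rfl i; simp [wexp]
  · intro h
    ext x
    obtain ⟨i, rfl⟩ := w.surjective x
    rw [h]; simp [wexp]

lemma coeff_sign_mul {K : Type} [CommRing K] {k : ℕ} (w : Equiv.Perm (Fin k)) (e : Fin k →₀ ℕ)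
    (f : MvPowerSeries (Fin k) K) :
    MvPowerSeries.coeff e (((w.sign : ℤ) : MvPowerSeries (Fin k) K) * f)
      = ((w.sign : ℤ) : K) * MvPowerSeries.coeff e f := by
  rcases Int.units_eq_one_or w.sign with h | h <;> simp [h]

lemma coeff_aDet {K : Type} [CommRing K] {k : ℕ} (a : Fin k → ℕ) (e : Fin k →₀ ℕ) :
    MvPowerSeries.coeff e (aDet K k a) =
      ∑ w : Equiv.Perm (Fin k), ((w.sign : ℤ) : K) * if ∀ i, e (w i) = a i then 1 else 0 := by
  rw [aDet, Matrix.det_apply', map_sum]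
  refine Finset.sum_congr rfl fun w _ => ?_
  simp only [Matrix.of_apply]
  rw [coeff_sign_mul, prodX_pow_w, MvPowerSeries.coeff_monomial]
  simp only [wexp_eq]

lemma expo_inj {k : ℕ} {p q : Partn} (hp : p.LengthLE k) (hq : q.LengthLE k)
    (h : ∀ j : Fin k, expo k p.parts j = expo k q.parts j) : p = q := by
  apply Partn.ext'
  ext i
  by_cases hi : i < k
  · have := h ⟨i, hi⟩
    simp only [expo] at this
    omega
  · rw [hp i (by omega), hq i (by omega)]

lemma littlewood_coeff {K : Type} [Field K] {k : ℕ} (T : MvPowerSeries (Fin k) K)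
    (hT : eInv K k * T = aRho K k) (e : Fin k →₀ ℕ) (B : ℕ) (he : ∀ i, e i ≤ B) :
    MvPowerSeries.coeff e T = ∑ δ ∈ (boxF k B).filter (fun δ => ∀ i, Even (δ.parts i)),
      MvPowerSeries.coeff e (aDet K k (expo k δ.parts)) := by
  have h := littlewood_ps (K := K) (k := k) (fun w => coneSer K (vw w) Finset.univ) (by
    intro w
    refine Eq.trans ?_ (cone_inv (K := K) (vw w) (vw_inj w) Finset.univ)
    congr 1
    refine Finset.prod_congr rfl fun i _ => ?_
    congr 1
    rw [MvPowerSeries.monomial_one_eq, Finsupp.prod_fintype _ _ (by simp),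
      ← Equiv.prod_comp w (fun x => (MvPowerSeries.X x : MvPowerSeries (Fin k) K) ^ vw w i x)]
    simp only [vw_apply]
    rw [← Finset.prod_subset (Finset.subset_univ (Finset.Iic i))]
    · refine Finset.prod_congr rfl fun j hj => ?_
      rw [if_pos (Finset.mem_Iic.1 hj)]
    · intro j _ hj
      rw [if_neg (fun h => hj (Finset.mem_Iic.2 h)), pow_zero])
  have hne : eInv K k ≠ 0 := by
    intro h0
    have : MvPowerSeries.constantCoeff (eInv K k) = 1 := by
      rw [eInv]; simp [map_prod]
    rw [h0, map_zero] at this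
    exact zero_ne_one this
  rw [← h] at hT
  rw [mul_left_cancel₀ hne hT, map_sum]
  simp only [coeff_aDet]
  rw [Finset.sum_comm]
  refine Finset.sum_congr rfl fun w _ => ?_
  rw [coeff_sign_mul, ← Finset.mul_sum, prodX_pow_w w (fun i => k - 1 - (i : ℕ)),
    MvPowerSeries.coeff_monomial_mul]
  congr 1
  rw [coeff_coneSer, one_mul]
  have hiff : (wexp w (fun i => k - 1 - (i : ℕ)) ≤ e ∧
      cone (vw w) Finset.univ (e - wexp w (fun i => k - 1 - (i : ℕ)))) ↔
      ∃ δ : Partn, (∀ i, Even (δ.parts i)) ∧ δ.LengthLE k ∧ ∀ j : Fin k, e (w j) = expo k δ.parts j := by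
    have hw : ∀ j, wexp w (fun i => k - 1 - (i : ℕ)) (w j) = k - 1 - j := by
      intro j; simp [wexp]
    rw [cone_vw]
    constructor
    · rintro ⟨hle, δ, h1, h2, h3⟩
      refine ⟨δ, h1, h2, fun j => ?_⟩
      have a := hle (w j)
      have b := h3 j
      rw [Finsupp.tsub_apply, hw] at b
      rw [hw] at a
      simp only [expo]
      omega
    · rintro ⟨δ, h1, h2, h3⟩
      refine ⟨?_, δ, h1, h2, fun j => ?_⟩
      · intro x
        obtain ⟨j, rfl⟩ := w.surjective x
        rw [hw, h3]; simp only [expo]; omega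
      · rw [Finsupp.tsub_apply, hw, h3]; simp only [expo]; omega
  by_cases hex : ∃ δ : Partn, (∀ i, Even (δ.parts i)) ∧ δ.LengthLE k ∧
      ∀ j : Fin k, e (w j) = expo k δ.parts j
  · have h2 := hiff.2 hex
    rw [if_pos h2.1, if_pos h2.2]
    obtain ⟨δ, d1, d2, d3⟩ := hex
    rw [Finset.sum_eq_single δ]
    · rw [if_pos d3]
    · intro b hb hbd
      rw [if_neg]
      intro h
      apply hbd
      rw [Finset.mem_filter, mem_boxF] at hb
      exact expo_inj hb.1.1 d2 fun j => by rw [← h j, d3 j]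
    · intro hn
      exfalso
      apply hn
      rw [Finset.mem_filter, mem_boxF]
      refine ⟨⟨d2, fun i => ?_⟩, d1⟩
      by_cases hi : i < k
      · have a := d3 ⟨i, hi⟩
        have b := he (w ⟨i, hi⟩)
        simp only [expo] at a
        omega
      · rw [d2 i (by omega)]; omega
  · rw [Finset.sum_eq_zero]
    · by_cases h1 : wexp w (fun i => k - 1 - (i : ℕ)) ≤ e
      · rw [if_pos h1, if_neg (fun h2 => hex (hiff.1 ⟨h1, h2⟩))]
      · rw [if_neg h1]
    · intro δ hδ
      rw [Finset.mem_filter, mem_boxF] at hδ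
      exact if_neg fun h => hex ⟨δ, hδ.2, hδ.1.1, h⟩


lemma expo_strictAnti (k : ℕ) (p : Partn) : StrictAnti (expo k p.parts) := by
  intro i j hij
  have := p.antitone i j hij.le
  have h2 : (i : ℕ) < j := hij
  have := j.isLt
  simp only [expo]
  omega

lemma altF_expand {K : Type} [CommRing K] {k : ℕ} (f : (Fin k → ℕ) → K) (hf : AltF f)
    (e : Fin k →₀ ℕ) (B : ℕ) (he : ∀ i, e i ≤ B) :
    f e = ∑ μ ∈ boxF k B, f (expo k μ.parts) * MvPowerSeries.coeff e (aDet K k (expo k μ.parts)) := by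
  simp only [coeff_aDet]
  by_cases hinj : Function.Injective e
  · let g : Fin k → ℕᵒᵈ := OrderDual.toDual ∘ e
    have hg : Function.Injective g := OrderDual.toDual.injective.comp hinj
    set σ := Tuple.sort g with hσ
    have hm : Monotone (g ∘ σ) := Tuple.monotone_sort g
    have hanti : StrictAnti (e ∘ σ) := by
      intro i j hij
      have h1 : g (σ i) < g (σ j) :=
        lt_of_le_of_ne (hm hij.le) fun h => hij.ne (σ.injective (hg h))
      exact h1
    have huniq : ∀ w : Equiv.Perm (Fin k), StrictAnti (e ∘ w) → w = σ := by
      intro w hw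
      have h1 : Monotone (g ∘ w) := by
        intro i j hij
        exact hw.antitone hij
      have h2 := Tuple.comp_sort_eq_comp_iff_monotone.2 h1
      ext x
      have := congrFun h2 x
      exact congrArg Fin.val (hg this)
    have hlow : ∀ n : ℕ, ∀ j : Fin k, (j : ℕ) + n + 1 = k → n ≤ e (σ j) := by
      intro n
      induction n with
      | zero => intro j _; omega
      | succ n ih =>
        intro j hj
        have h1 := ih ⟨j + 1, by omega⟩ (by simp; omega)
        have h2 : e (σ ⟨j + 1, by omega⟩) < e (σ j) := hanti (by rw [Fin.lt_def]; simp)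
        omega
    have hlow' : ∀ j : Fin k, k - 1 - (j : ℕ) ≤ e (σ j) := fun j => hlow _ j (by omega)
    have hstep : ∀ (n : ℕ) (i j : Fin k), (i : ℕ) + n = j →
        e (σ j) + n ≤ e (σ i) := by
      intro n
      induction n with
      | zero => intro i j h; have : i = j := Fin.ext (by omega); subst this; omega
      | succ n ih =>
        intro i j h
        have h1 := ih ⟨i + 1, by omega⟩ j (by simp; omega)
        have h2 : e (σ ⟨i + 1, by omega⟩) < e (σ i) := hanti (by rw [Fin.lt_def]; simp)
        omega
    let μ : Partn := ⟨fun j => if h : j < k then e (σ ⟨j, h⟩) - (k - 1 - j) else 0, by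
      intro i j hij
      by_cases hj : j < k
      · have hi : i < k := by omega
        have := hstep (j - i) ⟨i, hi⟩ ⟨j, hj⟩ (by simp; omega)
        simp only [hi, hj, dif_pos]
        omega
      · simp [hj], k, fun i hi => by simp; omega⟩
    have hμl : μ.LengthLE k := fun i hi => by simp only [μ]; rw [dif_neg (by omega)]
    have hμe : ∀ j, expo k μ.parts j = e (σ j) := by
      intro j
      have := hlow' j
      simp only [expo, μ, j.isLt, dif_pos]
      simp only [Fin.eta]
      omega
    have hμb : μ ∈ boxF k B := by
      rw [mem_boxF]
      refine ⟨hμl, fun i => ?_⟩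
      by_cases hi : i < k
      · have := he (σ ⟨i, hi⟩)
        simp only [μ, hi, dif_pos]
        omega
      · rw [hμl i (by omega)]; omega
    rw [Finset.sum_eq_single μ, Finset.sum_eq_single σ]
    · rw [if_pos fun i => (hμe i).symm, mul_one]
      have h1 : expo k μ.parts = (e : Fin k → ℕ) ∘ σ := funext hμe
      rw [h1, hf.2]
      have hss : ((σ.sign : ℤ) : K) * ((σ.sign : ℤ) : K) = 1 := by
        rcases Int.units_eq_one_or σ.sign with h | h <;> simp [h]
      linear_combination (- f e) * hss
    · intro w _ hw
      rw [if_neg, mul_zero]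
      intro h
      apply hw
      apply huniq
      have : (e : Fin k → ℕ) ∘ w = expo k μ.parts := funext h
      rw [this]
      exact expo_strictAnti k μ
    · simp
    · intro ν hν hne
      rw [Finset.sum_eq_zero, mul_zero]
      intro w _
      rw [if_neg, mul_zero]
      intro h
      apply hne
      have h1 : (e : Fin k → ℕ) ∘ w = expo k ν.parts := funext h
      have h2 : w = σ := huniq w (by rw [h1]; exact expo_strictAnti k ν)
      subst h2
      exact expo_inj (mem_boxF.1 hν).1 hμl fun j => by rw [hμe, ← h j]
    · intro h; exact absurd hμb h
  · rw [hf.1 _ hinj, Finset.sum_eq_zero]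
    intro μ _
    rw [Finset.sum_eq_zero, mul_zero]
    intro w _
    rw [if_neg, mul_zero]
    intro h
    apply hinj
    have h1 : (e : Fin k → ℕ) ∘ w = expo k μ.parts := funext h
    have h2 : Function.Injective ((e : Fin k → ℕ) ∘ w) := by
      rw [h1]; exact (expo_strictAnti k μ).injective
    intro x y hxy
    obtain ⟨a, rfl⟩ := w.surjective x
    obtain ⟨b, rfl⟩ := w.surjective y
    rw [h2 hxy]

noncomputable def toPS (K : Type) [CommRing K] (k : ℕ) :
    MvPolynomial (Fin k) ℤ →+* MvPowerSeries (Fin k) K :=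
  (MvPolynomial.coeToMvPowerSeries.ringHom).comp (MvPolynomial.map (Int.castRingHom K))

lemma toPS_X (K : Type) [CommRing K] (k : ℕ) (i : Fin k) : toPS K k (X i) = MvPowerSeries.X i := by
  simp [toPS]

lemma coeff_toPS (K : Type) [CommRing K] (k : ℕ) (p : MvPolynomial (Fin k) ℤ) (e : Fin k →₀ ℕ) :
    MvPowerSeries.coeff e (toPS K k p) = ((MvPolynomial.coeff e p : ℤ) : K) := by
  simp [toPS, MvPolynomial.coeff_map]

lemma toPS_alternant (K : Type) [CommRing K] (k : ℕ) (l : ℕ → ℕ) :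
    toPS K k (alternant k l) = aDet K k (expo k l) := by
  rw [alternant, aDet, RingHom.map_det]
  congr 1
  ext i j
  simp [toPS_X, expo]

lemma toPS_vandermonde (K : Type) [CommRing K] (k : ℕ) :
    toPS K k (vandermondeP k) = aRho K k := by
  rw [vandermondeP, aRho, RingHom.map_det]
  congr 1
  ext i j
  simp [toPS_X]

lemma coeff_mul_congr_box {K : Type} [CommRing K] {k : ℕ} {ι : Type} (s : Finset ι)
    (A T : MvPowerSeries (Fin k) K) (c : ι → K) (Q : ι → MvPowerSeries (Fin k) K)
    (e : Fin k →₀ ℕ)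
    (h : ∀ a : Fin k →₀ ℕ, a ≤ e → MvPowerSeries.coeff a T = ∑ i ∈ s, c i * MvPowerSeries.coeff a (Q i)) :
    MvPowerSeries.coeff e (A * T) = ∑ i ∈ s, c i * MvPowerSeries.coeff e (A * Q i) := by
  simp only [MvPowerSeries.coeff_mul, Finset.mul_sum]
  rw [Finset.sum_comm]
  refine Finset.sum_congr rfl fun p hp => ?_
  rw [h p.2 (by
    rw [← Finset.HasAntidiagonal.mem_antidiagonal.1 hp]; exact le_add_self), Finset.mul_sum]
  refine Finset.sum_congr rfl fun i _ => by ring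

theorem branching_core {K : Type} [Field K] {k : ℕ} (N : (Fin k → ℕ) → K) (hN : AltF N)
    (Φ : MvPowerSeries (Fin k) K) (c : K) (Ψ : MvPowerSeries (Fin k) K)
    (hΨ : Ψ = MvPowerSeries.C c * (eInv K k * Φ))
    (hΨN : ∀ e : Fin k →₀ ℕ, MvPowerSeries.coeff e Ψ = N e)
    (l : Partn) (B : ℕ) (hB : ∀ i, expo k l.parts i ≤ B) :
    c * MvPowerSeries.coeff (fexp (expo k l.parts)) Φ =
      ∑ μ ∈ boxF k B, N (expo k μ.parts) *
        ∑ δ ∈ (boxF k B).filter (fun δ => ∀ i, Even (δ.parts i)), ((lrN k δ μ l : ℤ) : K) := by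
  have hE : MvPowerSeries.constantCoeff (eInv K k) ≠ 0 := by
    rw [eInv]; simp [map_prod]
  set E := (eInv K k)⁻¹ with hEdef
  have hEE : eInv K k * E = 1 := MvPowerSeries.mul_inv_cancel _ hE
  set e := fexp (expo k l.parts) with he
  have heB : ∀ a : Fin k →₀ ℕ, a ≤ e → ∀ i, a i ≤ B := fun a ha i => (ha i).trans (hB i)
  have h1 : MvPowerSeries.C c * Φ = E * Ψ := by
    rw [hΨ]
    linear_combination (- MvPowerSeries.C c * Φ) * hEE
  have h2 : c * MvPowerSeries.coeff e Φ = MvPowerSeries.coeff e (E * Ψ) := by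
    rw [← h1, MvPowerSeries.coeff_C_mul]
  rw [h2, coeff_mul_congr_box (boxF k B) E Ψ (fun μ => N (expo k μ.parts))
    (fun μ => aDet K k (expo k μ.parts)) e
    (fun a ha => by rw [hΨN]; exact altF_expand N hN a B (heB a ha))]
  refine Finset.sum_congr rfl fun μ hμ => ?_
  congr 1
  have h3 : E * aDet K k (expo k μ.parts) = toPS K k (schur k μ.parts) * (E * aRho K k) := by
    rw [← toPS_alternant, ← schur_mul, map_mul, toPS_vandermonde]
    ring
  rw [h3, coeff_mul_congr_box ((boxF k B).filter (fun δ => ∀ i, Even (δ.parts i)))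
    (toPS K k (schur k μ.parts)) (E * aRho K k) (fun _ => 1) (fun δ => aDet K k (expo k δ.parts)) e
    (fun a ha => by
      simp only [one_mul]
      exact littlewood_coeff _ (by rw [← mul_assoc, hEE, one_mul]) a B (heB a ha))]
  refine Finset.sum_congr rfl fun δ hδ => ?_
  rw [one_mul, ← toPS_alternant, ← schur_mul, ← map_mul, coeff_toPS, lrN,
    if_pos ⟨(mem_boxF.1 (Finset.mem_filter.1 hδ).1).1, (mem_boxF.1 hμ).1⟩]
  congr 2
  ring


lemma xv_ne_zero (k : ℕ) (i : Fin k) : xv k i ≠ 0 := by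
  rw [xv, Ne, map_eq_zero_iff _ (IsFractionRing.injective (MvPolynomial (Fin k) ℚ) (RatFn k))]
  exact MvPolynomial.X_ne_zero i

lemma xv_poly_ne (k : ℕ) (p : MvPolynomial (Fin k) ℚ) (v : Fin k → ℚ) (h : MvPolynomial.eval v p ≠ 0) :
    algebraMap (MvPolynomial (Fin k) ℚ) (RatFn k) p ≠ 0 := by
  rw [Ne, map_eq_zero_iff _ (IsFractionRing.injective (MvPolynomial (Fin k) ℚ) (RatFn k))]
  rintro rfl
  exact h (map_zero _)

lemma xv_sub_inv (k : ℕ) (i : Fin k) : xv k i - (xv k i)⁻¹ ≠ 0 := by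
  intro h
  have h1 := xv_poly_ne k (X i ^ 2 - 1) (fun _ => 0) (by simp)
  apply h1
  have h0 := xv_ne_zero k i
  have h2 : xv k i * (xv k i)⁻¹ = 1 := mul_inv_cancel₀ h0
  rw [map_sub, map_pow, map_one]
  change xv k i ^ 2 - 1 = 0
  linear_combination xv k i * h + h2

lemma xv_u_inj (k : ℕ) : Function.Injective fun i => xv k i ^ 2 + (xv k i)⁻¹ ^ 2 := by
  intro i j hij
  by_contra hne
  simp only at hij
  have h1 := xv_poly_ne k (X i ^ 2 - X j ^ 2) (fun x => if x = i then 1 else 0)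
    (by simp [Ne.symm hne])
  have h2 := xv_poly_ne k (X i ^ 2 * X j ^ 2 - 1) (fun _ => 0) (by simp)
  apply mul_ne_zero h1 h2
  simp only [map_sub, map_mul, map_pow, map_one]
  change (xv k i ^ 2 - xv k j ^ 2) * (xv k i ^ 2 * xv k j ^ 2 - 1) = 0
  have a := xv_ne_zero k i
  have b := xv_ne_zero k j
  field_simp at hij
  linear_combination hij

lemma prod_soEval {M : Type} [CommMonoid M] (k : ℕ) (g : RatFn k → M) :
    ∏ l, g (soEval k l) = (∏ i, g (xv k i ^ 2)) * (∏ i, g ((xv k i)⁻¹ ^ 2)) * g 1 := by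
  rw [Fin.prod_univ_castSucc]
  congr 1
  · rw [← Fin.prod_congr' (fun l : Fin (2 * k) => g (soEval k l.castSucc)) (by omega : k + k = 2 * k),
      Fin.prod_univ_add]
    congr 1
    · refine Finset.prod_congr rfl fun i _ => ?_
      simp [soEval]
    · refine Finset.prod_congr rfl fun i _ => ?_
      have := i.isLt
      simp [soEval]
      rw [if_pos (by omega)]
  · have : ¬ (2 * k < k) := by omega
    simp [soEval, this]

lemma hgen_so (k : ℕ) : hgen (soEval k) * ((1 - PowerSeries.X) *
    ∏ l, ((1 - PowerSeries.C (xv k l ^ 2) * PowerSeries.X) *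
      (1 - PowerSeries.C ((xv k l)⁻¹ ^ 2) * PowerSeries.X))) = 1 := by
  rw [hgen, prod_soEval k (fun x => PowerSeries.mk (fun m => x ^ m)), Finset.prod_mul_distrib]
  have h1 := geom_mul (1 : RatFn k)
  rw [map_one, one_mul] at h1
  have h2 : (∏ i, PowerSeries.mk (fun m => (xv k i ^ 2) ^ m)) *
      ∏ l, (1 - PowerSeries.C (xv k l ^ 2) * PowerSeries.X) = 1 := by
    rw [← Finset.prod_mul_distrib]
    exact Finset.prod_eq_one fun i _ => geom_mul _
  have h3 : (∏ i, PowerSeries.mk (fun m => ((xv k i)⁻¹ ^ 2) ^ m)) *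
      ∏ l, (1 - PowerSeries.C ((xv k l)⁻¹ ^ 2) * PowerSeries.X) = 1 := by
    rw [← Finset.prod_mul_distrib]
    exact Finset.prod_eq_one fun i _ => geom_mul _
  have h4 : ∀ {R : Type} [CommRing R] (a b c d e f : R), a * b = 1 → c * d = 1 → e * f = 1 →
      a * c * e * (f * (b * d)) = 1 := by
    intro R _ a b c d e f h1 h2 h3
    linear_combination c * d * e * f * h1 + e * f * h2 + h3
  exact h4 _ _ _ _ _ _ h2 h3 h1

lemma schur_aeval_int {S : Type} [CommRing S] [a : Algebra ℤ S] (n : ℕ) (l : ℕ → ℕ) (y : Fin n → S) :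
    MvPolynomial.aeval y (schur n l) = (jtMat n (hgen y) (expo n l)).det := by
  have h : a = Ring.toIntAlgebra S := Subsingleton.elim _ _
  subst h
  exact schur_aeval n l y

theorem gl_to_o_branching (k : ℕ) (hk : 0 < k) (l : Partn) (hl : l.LengthLE k) :
    MvPolynomial.aeval (soEval k) (schur (2 * k + 1) l.parts) =
    ∑ᶠ (μ : Partn) (_ : μ.LengthLE k),
      (((∑ᶠ (δ : Partn) (_ : ∀ i, Even (δ.parts i)), lrCoeff δ μ l) : ℤ) : RatFn k) *
        soChar k μ.parts := by
  set B := l.weight + k with hB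
  set N : (Fin k → ℕ) → RatFn k := fun e =>
    (Matrix.of fun i j : Fin k => PowerSeries.coeff (e j) (gser (xv k i))).det with hNdef
  have hN : AltF N := altF_det fun i m => PowerSeries.coeff m (gser (xv k i))
  obtain ⟨c, hc, hcau⟩ := cauchy_so (xv k) (xv_ne_zero k) (xv_sub_inv k) (xv_u_inj k)
    (hgen (soEval k)) (hgen_so k)
  set Φ := aRho (RatFn k) k * ∏ j, iota j (hgen (soEval k)) with hΦ
  set Ψ := (Matrix.of fun i j : Fin k => iota j (gser (xv k i))).det with hΨ
  have hΨN : ∀ e : Fin k →₀ ℕ, MvPowerSeries.coeff e Ψ = N e := fun e => coeff_det_iota _ e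
  have hH0 : PowerSeries.constantCoeff (hgen (soEval k)) = 1 := hgen_coeff_zero _
  have hD : N (fun j : Fin k => k - 1 - (j : ℕ)) = c := by
    have h1 := hΨN (fexp fun j : Fin k => k - 1 - (j : ℕ))
    rw [hcau, MvPowerSeries.coeff_C_mul, coeff_rho_mul (eInv (RatFn k) k) Φ
      (fun e => (jtMat k (hgen (soEval k)) e).det) (altF_det fun r m =>
        PowerSeries.coeff m (PowerSeries.X ^ (k - 1 - (r : ℕ)) * hgen (soEval k))) (fun e => coeff_Phi _ e),
      jtMat_rho k _ hH0] at h1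
    have h2 : MvPowerSeries.coeff 0 (eInv (RatFn k) k) = 1 := by
      rw [MvPowerSeries.coeff_zero_eq_constantCoeff_apply, eInv]; simp [map_prod]
    rw [h2, mul_one, mul_one] at h1
    exact h1.symm
  have hso : ∀ μ : Partn, soChar k μ.parts = N (expo k μ.parts) / c := by
    intro μ
    rw [← hD]
    simp only [soChar, hNdef, gser, PowerSeries.coeff_mk, expo]
  have hLHS : MvPolynomial.aeval (soEval k) (schur (2 * k + 1) l.parts) =
      MvPowerSeries.coeff (fexp (expo k l.parts)) Φ := by
    rw [schur_aeval_int, jtMat_stable k (2 * k + 1) _ hH0 l.parts hl (by omega), hΦ, coeff_Phi]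
    rfl
  have hcore := branching_core N hN Φ c Ψ hcau hΨN l B (fun i => by
    have := parts_le_weight l i
    simp only [expo]
    omega)
  have hbox : ∀ μ : Partn, μ.LengthLE k → μ.weight ≤ l.weight → μ ∈ boxF k B := by
    intro μ h1 h2
    rw [mem_boxF]
    refine ⟨h1, fun i => ?_⟩
    have := parts_le_weight μ i
    omega
  have hin : ∀ μ : Partn, (∑ᶠ (δ : Partn) (_ : ∀ i, Even (δ.parts i)), lrCoeff δ μ l) =
      ∑ δ ∈ (boxF k B).filter (fun δ => ∀ i, Even (δ.parts i)), lrN k δ μ l := by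
    intro μ
    simp only [lrCoeff_eq k _ _ l hl]
    refine finsum_mem_eq_sum_of_subset (s := {δ : Partn | ∀ i, Even (δ.parts i)})
      (fun δ => lrN k δ μ l) ?_ ?_
    · rintro δ ⟨h1, h2⟩
      have h3 := lrN_weight k δ μ l hl h2
      have h4 : δ.LengthLE k := by
        by_contra h
        exact h2 (if_neg fun h' => h h'.1)
      rw [Finset.mem_coe, Finset.mem_filter]
      exact ⟨hbox δ h4 (by omega), h1⟩
    · intro δ h
      rw [Finset.mem_coe, Finset.mem_filter] at h
      exact h.2
  simp only [hin, hso]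
  have hfin := finsum_mem_eq_sum_of_subset (s := {μ : Partn | μ.LengthLE k}) (t := boxF k B)
    (fun μ => ((∑ δ ∈ (boxF k B).filter (fun δ => ∀ i, Even (δ.parts i)), lrN k δ μ l : ℤ) : RatFn k) *
      (N (expo k μ.parts) / c)) (by
      rintro μ ⟨h1, h2⟩
      have h3 : (∑ δ ∈ (boxF k B).filter (fun δ => ∀ i, Even (δ.parts i)), lrN k δ μ l) ≠ 0 := by
        intro h
        apply h2
        simp only [h, Int.cast_zero, zero_mul]
      obtain ⟨δ, -, h4⟩ := Finset.exists_ne_zero_of_sum_ne_zero h3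
      have h5 := lrN_weight k δ μ l hl h4
      exact hbox μ h1 (by omega)) (fun μ h => (mem_boxF.1 h).1)
  refine Eq.trans ?_ hfin.symm
  rw [hLHS, ← mul_right_inj' hc, hcore, Finset.mul_sum]
  refine Finset.sum_congr rfl fun μ _ => ?_
  rw [Int.cast_sum]
  field_simp
end
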